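/- arXiv:1504.07449 — 2 statements merged into one kernel-verified Lean document; each statement's English description precedes it below -/
import Mathlib

section
/- Let Γ be a finite simplicial graph and let 𝒦 denote the image of Aut(A_Γ) under the natural homomorphism Aut(A_Γ) → Aut(A_Γ^{ab}) (so 𝒦 ≅ Aut(A_Γ)/IA_Γ). Then Γ satisfies property (B2) if and only if 𝒦 is not virtually indicable, i.e. if and only if there is no finite-index subgroup of 𝒦 admitting a surjective group homomorphism onto ℤ. -/
open SimpleGraph

namespace RaagPaper

variable {V : Type} [Fintype V] [DecidableEq V]

/-- The defining relations of the right-angled Artin group of a graph `Γ`. -/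
def Rels (Γ : SimpleGraph V) : Set (FreeGroup V) :=
  {r | ∃ u v : V, Γ.Adj u v ∧
    r = FreeGroup.of u * FreeGroup.of v * (FreeGroup.of u)⁻¹ * (FreeGroup.of v)⁻¹}

/-- The right-angled Artin group of `Γ`. -/
abbrev Raag (Γ : SimpleGraph V) := PresentedGroup (Rels Γ)

/-- The generator of `Raag Γ` corresponding to the vertex `v`. -/
def gen (Γ : SimpleGraph V) (v : V) : Raag Γ := PresentedGroup.of v

/-- The link of a vertex. -/
def lk (Γ : SimpleGraph V) (v : V) : Set V := Γ.neighborSet v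

/-- The star of a vertex. -/
def st (Γ : SimpleGraph V) (v : V) : Set V := insert v (Γ.neighborSet v)

/-- The partial preorder `v ≤ w ↔ lk v ⊆ st w` on vertices. -/
def Le (Γ : SimpleGraph V) (v w : V) : Prop := lk Γ v ⊆ st Γ w

/-- The equivalence `v ∼ w`. -/
def Sim (Γ : SimpleGraph V) (v w : V) : Prop := Le Γ v w ∧ Le Γ w v

/-- The equivalence class of a vertex under `∼`. -/
def simClass (Γ : SimpleGraph V) (v : V) : Set V := {u | Sim Γ u v}

/-- Property (B1): any two distinct non-adjacent vertices are `∼`-equivalent. -/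
def B1 (Γ : SimpleGraph V) : Prop :=
  ∀ u v : V, u ≠ v → ¬ Γ.Adj u v → Sim Γ u v

/-- Property (B2). -/
def B2 (Γ : SimpleGraph V) : Prop :=
  ∀ v w : V, v ≠ w → Le Γ v w → ∃ u : V, u ≠ v ∧ u ≠ w ∧ Le Γ v u ∧ Le Γ u w

/-- `α` is the transvection `t_{vw}` for some `v ≤ w`. -/
def IsTransvection (Γ : SimpleGraph V) (α : MulAut (Raag Γ)) : Prop :=
  ∃ v w : V, v ≠ w ∧ Le Γ v w ∧ α (gen Γ v) = gen Γ v * gen Γ w ∧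
    ∀ z : V, z ≠ v → α (gen Γ z) = gen Γ z

/-- `Y` is (the vertex set of) a connected component of the subgraph of `Γ` induced on `S`. -/
def IsCompOf (Γ : SimpleGraph V) (S : Set V) (Y : Set V) : Prop :=
  ∃ C : (Γ.induce S).ConnectedComponent, Y = Subtype.val '' C.supp

/-- `α` is a partial conjugation `c_{v,Y}`. -/
def IsPartialConj (Γ : SimpleGraph V) (α : MulAut (Raag Γ)) : Prop :=
  ∃ (v : V) (Y : Set V), IsCompOf Γ (st Γ v)ᶜ Y ∧
    (∀ y ∈ Y, α (gen Γ y) = (gen Γ v)⁻¹ * gen Γ y * gen Γ v) ∧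
    (∀ z : V, z ∉ Y → α (gen Γ z) = gen Γ z)

/-- `α` is the inversion `ι_v`. -/
def IsInversion (Γ : SimpleGraph V) (α : MulAut (Raag Γ)) : Prop :=
  ∃ v : V, α (gen Γ v) = (gen Γ v)⁻¹ ∧ ∀ z : V, z ≠ v → α (gen Γ z) = gen Γ z

/-- `SAut⁰(A_Γ)`: the subgroup generated by transvections and partial conjugations. -/
def SAut0 (Γ : SimpleGraph V) : Subgroup (MulAut (Raag Γ)) :=
  Subgroup.closure {α | IsTransvection Γ α ∨ IsPartialConj Γ α}

/-- `Aut⁰(A_Γ)`: the subgroup generated by transvections, partial conjugations and inversions. -/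
def Aut0 (Γ : SimpleGraph V) : Subgroup (MulAut (Raag Γ)) :=
  Subgroup.closure {α | IsTransvection Γ α ∨ IsPartialConj Γ α ∨ IsInversion Γ α}

/-- The natural map `Aut(A_Γ) → Aut(A_Γ^{ab})`. -/
def abAutHom (Γ : SimpleGraph V) :
    MulAut (Raag Γ) →* MulAut (Abelianization (Raag Γ)) :=
  MonoidHom.mk' (fun e => MulEquiv.abelianizationCongr e) (by
    intro e f
    exact (abelianizationCongr_trans f e).symm)

/-- The Torelli subgroup `IA_Γ`. -/
def IA (Γ : SimpleGraph V) : Subgroup (MulAut (Raag Γ)) := (abAutHom Γ).ker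

/-- The subgroup of `m`-th powers of `A_Γ^{ab}`; the quotient by it is `A_Γ^{ab} ⊗ ℤ/mℤ`. -/
def powN (Γ : SimpleGraph V) (m : ℕ) : Subgroup (Abelianization (Raag Γ)) :=
  (powMonoidHom m : Abelianization (Raag Γ) →* Abelianization (Raag Γ)).range

/-- `IA_Γ(m)`: the kernel of `Aut(A_Γ) → Aut(A_Γ^{ab} ⊗ ℤ/mℤ)`, i.e. the automorphisms
acting trivially on the abelianization modulo `m`-th powers. -/
def IAm (Γ : SimpleGraph V) (m : ℕ) : Subgroup (MulAut (Raag Γ)) where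
  carrier := {α | ∀ x : Abelianization (Raag Γ), abAutHom Γ α x * x⁻¹ ∈ powN Γ m}
  one_mem' := by
    intro x
    simp only [map_one, MulAut.one_apply, mul_inv_cancel]
    exact one_mem _
  mul_mem' := by
    intro a b ha hb x
    have h : abAutHom Γ (a * b) x * x⁻¹ =
        (abAutHom Γ a (abAutHom Γ b x) * (abAutHom Γ b x)⁻¹) * (abAutHom Γ b x * x⁻¹) := by
      simp only [map_mul, MulAut.mul_apply]
      group
    rw [h]
    exact mul_mem (ha _) (hb x)
  inv_mem' := by
    intro a ha x
    have h : abAutHom Γ a (abAutHom Γ a⁻¹ x) = x := by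
      have : abAutHom Γ a * abAutHom Γ a⁻¹ = 1 := by
        rw [← map_mul, mul_inv_cancel, map_one]
      calc abAutHom Γ a (abAutHom Γ a⁻¹ x) = (abAutHom Γ a * abAutHom Γ a⁻¹) x := rfl
        _ = x := by rw [this]; rfl
    have := inv_mem (ha (abAutHom Γ a⁻¹ x))
    rw [h] at this
    simpa [mul_comm] using this
  
/-- `SIA_Γ(m) = SAut⁰(A_Γ) ∩ IA_Γ(m)`. -/
def SIA (Γ : SimpleGraph V) (m : ℕ) : Subgroup (MulAut (Raag Γ)) := SAut0 Γ ⊓ IAm Γ m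

/-- The group of inner automorphisms of `A_Γ`. -/
def innSub (Γ : SimpleGraph V) : Subgroup (MulAut (Raag Γ)) :=
  (MulAut.conj : Raag Γ →* MulAut (Raag Γ)).range


/-- Property (NL): three pairwise distinct, pairwise non-adjacent vertices with
`v₃ ≤ v₁` and `v₃ ≤ v₂`. -/
def NL (Γ : SimpleGraph V) : Prop :=
  ∃ v₁ v₂ v₃ : V, v₁ ≠ v₂ ∧ v₁ ≠ v₃ ∧ v₂ ≠ v₃ ∧
    ¬ Γ.Adj v₁ v₂ ∧ ¬ Γ.Adj v₁ v₃ ∧ ¬ Γ.Adj v₂ v₃ ∧ Le Γ v₃ v₁ ∧ Le Γ v₃ v₂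

open Classical in
/-- The multiset of cardinalities of the equivalence classes of vertices under `∼`. -/
noncomputable def classSizes (Γ : SimpleGraph V) : Multiset ℕ :=
  (Finset.image (fun v => Set.toFinset (simClass Γ v)) Finset.univ).val.map Finset.card

section GroupTheory

variable {G : Type*} [Group G]

/-- A group is virtually indicable if some finite-index subgroup surjects onto `ℤ`. -/
def VirtuallyIndicable (G : Type*) [Group G] : Prop :=
  ∃ K : Subgroup G, K.FiniteIndex ∧ ∃ φ : K →* Multiplicative ℤ, Function.Surjective φ

theorem multiplicative_int_pow_eq_one {a : Multiplicative ℤ} {n : ℕ} (hn : n ≠ 0)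
    (h : a ^ n = 1) : a = 1 := by
  have h' : n • a.toAdd = 0 := congrArg Multiplicative.toAdd h
  have : a.toAdd = 0 := by simpa [hn] using h'
  exact congrArg Multiplicative.ofAdd this

theorem finiteIndex_subgroupOf_of_finite_fibres (H L : Subgroup G) {α : Type*} [Finite α]
    (F : L → α) (hF : ∀ g h : L, F g = F h → (g : G)⁻¹ * h ∈ H) :
    (H.subgroupOf L).FiniteIndex := by
  have : Finite (L ⧸ H.subgroupOf L) := by
    refine Finite.of_injective (fun q : L ⧸ H.subgroupOf L => F q.out) fun p q hpq => ?_
    have h1 := hF _ _ hpq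
    rw [← QuotientGroup.out_eq' p, ← QuotientGroup.out_eq' q, QuotientGroup.eq,
      Subgroup.mem_subgroupOf]
    simpa using h1
  exact Subgroup.finiteIndex_of_finite_quotient

theorem exists_pow_mem_of_finiteIndex (H : Subgroup G) [H.FiniteIndex] (g : G) :
    ∃ n : ℕ, n ≠ 0 ∧ g ^ n ∈ H := by
  obtain ⟨n, hn, -, h⟩ := Subgroup.exists_pow_mem_of_index_ne_zero
    (Subgroup.FiniteIndex.index_ne_zero (H := H)) g
  exact ⟨n, hn.ne', h⟩

theorem virtuallyIndicable_of_hom_ne_one (K : Subgroup G) [hK : K.FiniteIndex]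
    (φ : K →* Multiplicative ℤ) (g : K) (hg : φ g ≠ 1) : VirtuallyIndicable G := by
  have hn : φ.range ≠ ⊥ := by
    intro h
    exact hg ((Subgroup.eq_bot_iff_forall _).1 h _ ⟨g, rfl⟩)
  have hinf : Infinite φ.range := by
    refine Infinite.of_injective (fun n : ℤ => (⟨φ g ^ n, φ.range.zpow_mem ⟨g, rfl⟩ n⟩ : φ.range)) ?_
    intro a b hab
    have h1 : φ g ^ a = φ g ^ b := congrArg Subtype.val hab
    have h2 : a * (φ g).toAdd = b * (φ g).toAdd := by
      simpa using congrArg Multiplicative.toAdd h1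
    have h3 : (φ g).toAdd ≠ 0 := fun h => hg (congrArg Multiplicative.ofAdd h)
    exact mul_right_cancel₀ h3 h2
  have hcyc : IsCyclic φ.range := inferInstance
  let e : Multiplicative ℤ ≃* φ.range := intCyclicMulEquiv
  exact ⟨K, hK, e.symm.toMonoidHom.comp φ.rangeRestrict,
    e.symm.surjective.comp φ.rangeRestrict_surjective⟩

theorem VirtuallyIndicable.of_mulEquiv {G' : Type*} [Group G'] (e : G ≃* G')
    (h : VirtuallyIndicable G) : VirtuallyIndicable G' := by
  obtain ⟨K, hK, φ, hφ⟩ := h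
  refine ⟨K.map e.toMonoidHom, ?_, φ.comp (e.subgroupMap K).symm.toMonoidHom,
    hφ.comp (e.subgroupMap K).symm.surjective⟩
  constructor
  have := hK.index_ne_zero
  rwa [← Subgroup.index_map_equiv K e] at this

theorem VirtuallyIndicable.subgroup (h : VirtuallyIndicable G) (H : Subgroup G)
    [H.FiniteIndex] : VirtuallyIndicable H := by
  obtain ⟨K, hK, φ, hφ⟩ := h
  obtain ⟨x, hx⟩ := hφ (Multiplicative.ofAdd 1)
  obtain ⟨n, hn, hxn⟩ := exists_pow_mem_of_finiteIndex H (x : G)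
  have hle : ∀ y : K.subgroupOf H, ((y : H) : G) ∈ K := fun y => y.2
  let ι : K.subgroupOf H →* K :=
    (H.subtype.comp (K.subgroupOf H).subtype).codRestrict K hle
  refine virtuallyIndicable_of_hom_ne_one (K.subgroupOf H) (φ.comp ι)
    ⟨⟨(x : G) ^ n, hxn⟩, K.pow_mem x.2 n⟩ ?_
  intro h1
  have h2 : φ (x ^ n) = 1 := h1
  rw [map_pow] at h2
  have := multiplicative_int_pow_eq_one hn h2
  rw [hx] at this
  exact absurd (congrArg Multiplicative.toAdd this) (by decide)

/-- The intersection of the kernels of all homomorphisms `K → ℤ`, as a subgroup of the ambient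
group. -/
def intKernel (K : Subgroup G) : Subgroup G :=
  (⨅ ψ : K →* Multiplicative ℤ, ψ.ker).map K.subtype

theorem mem_intKernel {K : Subgroup G} {g : G} :
    g ∈ intKernel K ↔ ∃ h : g ∈ K, ∀ ψ : K →* Multiplicative ℤ, ψ ⟨g, h⟩ = 1 := by
  simp only [intKernel, Subgroup.mem_map, Subgroup.mem_iInf, MonoidHom.mem_ker]
  constructor
  · rintro ⟨x, hx, rfl⟩
    exact ⟨x.2, hx⟩
  · rintro ⟨h, hψ⟩
    exact ⟨⟨g, h⟩, hψ, rfl⟩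

theorem intKernel_le (K : Subgroup G) : intKernel K ≤ K := fun _ hg => (mem_intKernel.1 hg).1

instance intKernel_normal (K : Subgroup G) [hK : K.Normal] : (intKernel K).Normal := by
  refine ⟨fun g hg x => ?_⟩
  obtain ⟨h, hψ⟩ := mem_intKernel.1 hg
  refine mem_intKernel.2 ⟨hK.conj_mem g h x, fun ψ => ?_⟩
  exact hψ (ψ.comp (MulAut.conjNormal x : MulAut K).toMonoidHom)

theorem mem_intKernel_of_pow_mem {K : Subgroup G} {g : G} (hg : g ∈ K) {n : ℕ} (hn : n ≠ 0)
    (h : g ^ n ∈ intKernel K) : g ∈ intKernel K := by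
  obtain ⟨h', hψ⟩ := mem_intKernel.1 h
  refine mem_intKernel.2 ⟨hg, fun ψ => multiplicative_int_pow_eq_one hn ?_⟩
  rw [← map_pow]
  exact hψ ψ

theorem commutator_mem_intKernel {K : Subgroup G} {g h : G} (hg : g ∈ K) (hh : h ∈ K) :
    g * h * g⁻¹ * h⁻¹ ∈ intKernel K := by
  refine mem_intKernel.2 ⟨K.mul_mem (K.mul_mem (K.mul_mem hg hh) (K.inv_mem hg)) (K.inv_mem hh),
    fun ψ => ?_⟩
  have : (⟨g * h * g⁻¹ * h⁻¹, K.mul_mem (K.mul_mem (K.mul_mem hg hh) (K.inv_mem hg))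
      (K.inv_mem hh)⟩ : K) = ⟨g, hg⟩ * ⟨h, hh⟩ * ⟨g, hg⟩⁻¹ * ⟨h, hh⟩⁻¹ := rfl
  rw [this]
  simp only [map_mul, map_inv]
  rw [mul_comm (ψ ⟨g, hg⟩)]
  simp

/-- If `G` has no homomorphism to `ℤ` then, by transfer, an element of `K` that is central modulo
`intKernel K` lies in `intKernel K`. -/
theorem mem_intKernel_of_central (hG : ∀ Φ : G →* Multiplicative ℤ, Φ = 1) (K : Subgroup G)
    [K.Normal] [K.FiniteIndex] {g : G} (hg : g ∈ K)
    (hc : ∀ x : G, x⁻¹ * g * x * g⁻¹ ∈ intKernel K) : g ∈ intKernel K := by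
  classical
  refine mem_intKernel.2 ⟨hg, fun ψ => ?_⟩
  have hconj : ∀ x : G, ∀ h : x⁻¹ * g * x ∈ K, ψ ⟨x⁻¹ * g * x, h⟩ = ψ ⟨g, hg⟩ := by
    intro x h
    obtain ⟨h', hψ⟩ := mem_intKernel.1 (hc x)
    have h1 := hψ ψ
    have : (⟨x⁻¹ * g * x * g⁻¹, h'⟩ : K) = ⟨x⁻¹ * g * x, h⟩ * ⟨g, hg⟩⁻¹ := rfl
    rw [this, map_mul, map_inv, mul_inv_eq_one] at h1
    exact h1
  have : Finite (G ⧸ K) := inferInstance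
  have : Fintype (G ⧸ K) := Fintype.ofFinite _
  have : Fintype (Quotient (MulAction.orbitRel (Subgroup.zpowers g) (G ⧸ K))) :=
    Fintype.ofFinite _
  have h := MonoidHom.transfer_eq_prod_quotient_orbitRel_zpowers_quot ψ g
  rw [hG (MonoidHom.transfer ψ)] at h
  have hterm : ∀ q : Quotient (MulAction.orbitRel (Subgroup.zpowers g) (G ⧸ K)),
      ψ ⟨q.out.out⁻¹ * g ^ Function.minimalPeriod (g • ·) q.out * q.out.out,
            QuotientGroup.out_conj_pow_minimalPeriod_mem K g q.out⟩ =
        ψ ⟨g, hg⟩ ^ Function.minimalPeriod (g • ·) q.out := by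
    intro q
    have hm : q.out.out⁻¹ * g * q.out.out ∈ K := by
      simpa using Subgroup.Normal.conj_mem ‹K.Normal› g hg q.out.out⁻¹
    rw [← hconj _ hm, ← map_pow]
    congr 1
    ext
    simp only [SubmonoidClass.mk_pow]
    have := conj_pow (i := Function.minimalPeriod (g • ·) q.out) (a := q.out.out⁻¹) (b := g)
    simpa using this.symm
  rw [Finset.prod_congr rfl (fun q _ => hterm q), Finset.prod_pow_eq_pow_sum,
    MonoidHom.one_apply] at h
  refine multiplicative_int_pow_eq_one ?_ h.symm
  intro h0
  rw [Finset.sum_eq_zero_iff] at h0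
  have h1 := h0 (Quotient.mk _ ((1 : G) : G ⧸ K)) (Finset.mem_univ _)
  have hp : ∀ x : G ⧸ K, g • x ∈ ({x} : Set (G ⧸ K)) := by
    intro x
    induction x using QuotientGroup.induction_on with
    | H z =>
      rw [Set.mem_singleton_iff, MulAction.Quotient.smul_coe, QuotientGroup.eq, smul_eq_mul]
      have := Subgroup.Normal.conj_mem ‹K.Normal› g⁻¹ (K.inv_mem hg) z⁻¹
      simpa [mul_assoc] using this
  rw [Function.minimalPeriod_eq_one_iff_isFixedPt.2 (hp _)] at h1
  exact one_ne_zero h1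

end GroupTheory

section IncidenceGroups

open Matrix

variable {ι : Type*} [Fintype ι] [DecidableEq ι]

/-- The elementary matrix `1 + c E_{ij}` for `i ≠ j`, and `1` for `i = j`. -/
def elemGL (i j : ι) (c : ℤ) : GL ι ℤ :=
  if h : i ≠ j then
    ⟨transvection i j c, transvection i j (-c),
      by rw [transvection_mul_transvection_same _ _ h]; simp,
      by rw [transvection_mul_transvection_same _ _ h]; simp⟩
  else 1

theorem elemGL_val {i j : ι} (h : i ≠ j) (c : ℤ) : (elemGL i j c).1 = transvection i j c := by
  simp [elemGL, h]

theorem elemGL_inv {i j : ι} (h : i ≠ j) (c : ℤ) : (elemGL i j c)⁻¹ = elemGL i j (-c) := by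
  ext1
  simp [elemGL, h, Units.inv_mk]

theorem elemGL_mul {i j : ι} (h : i ≠ j) (a b : ℤ) :
    elemGL i j a * elemGL i j b = elemGL i j (a + b) := by
  ext1
  rw [Units.val_mul, elemGL_val h, elemGL_val h, elemGL_val h,
    transvection_mul_transvection_same _ _ h]

theorem elemGL_pow {i j : ι} (h : i ≠ j) (a : ℤ) (n : ℕ) :
    elemGL i j a ^ n = elemGL i j (n * a) := by
  induction n with
  | zero => ext1; simp [elemGL_val h]
  | succ n ih => rw [pow_succ, ih, elemGL_mul h]; congr 1; push_cast; ring

theorem elemGL_commutator {i j k : ι} (hij : i ≠ j) (hjk : j ≠ k) (hik : i ≠ k) (a b : ℤ) :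
    elemGL i j a * elemGL j k b * (elemGL i j a)⁻¹ * (elemGL j k b)⁻¹ = elemGL i k (a * b) := by
  rw [mul_inv_eq_iff_eq_mul, mul_inv_eq_iff_eq_mul]
  ext1
  simp only [Units.val_mul, elemGL_val hij, elemGL_val hjk, elemGL_val hik]
  simp [transvection, add_mul, mul_add, hjk.symm, hik.symm]
  abel

/-- The principal congruence subgroup of level `m`. -/
def congGL (ι : Type*) [Fintype ι] [DecidableEq ι] (m : ℕ) : Subgroup (GL ι ℤ) :=
  (GeneralLinearGroup.map (n := ι) (Int.castRingHom (ZMod m))).ker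

theorem mem_congGL {m : ℕ} {g : GL ι ℤ} :
    g ∈ congGL ι m ↔ ∀ i j, (m : ℤ) ∣ g.1 i j - (1 : Matrix ι ι ℤ) i j := by
  rw [congGL, MonoidHom.mem_ker, Units.ext_iff, ← Matrix.ext_iff]
  refine forall_congr' fun i => forall_congr' fun j => ?_
  rw [← ZMod.intCast_eq_intCast_iff_dvd_sub, eq_comm]
  have : (((1 : Matrix ι ι ℤ) i j : ℤ) : ZMod m) = (1 : Matrix ι ι (ZMod m)) i j := by
    by_cases h : i = j <;> simp [Matrix.one_apply, h]
  rw [this]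
  rfl

instance congGL_finiteIndex (m : ℕ) [NeZero m] : (congGL ι m).FiniteIndex := by
  unfold congGL
  infer_instance

/-- The invertible matrices whose rows and columns indexed by `S` vanish off the diagonal. -/
def offAt (S : Set ι) : Subgroup (GL ι ℤ) where
  carrier := {g | ∀ s ∈ S, ∀ i, i ≠ s → g.1 s i = 0 ∧ g.1 i s = 0}
  one_mem' := by
    intro s _ i hi
    simp [hi, hi.symm]
  mul_mem' := by
    intro g h hg hh s hs i hi
    simp only [Units.val_mul, Matrix.mul_apply]
    constructor
    · refine Finset.sum_eq_zero fun l _ => ?_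
      by_cases hl : l = s
      · rw [hl, (hh s hs i hi).1, mul_zero]
      · rw [(hg s hs l hl).1, zero_mul]
    · refine Finset.sum_eq_zero fun l _ => ?_
      by_cases hl : l = s
      · rw [hl, (hg s hs i hi).2, zero_mul]
      · rw [(hh s hs l hl).2, mul_zero]
  inv_mem' := by
    intro g hg s hs i hi
    have h1 : ∀ a b, ∑ l, g.1 a l * (g⁻¹).1 l b = (1 : Matrix ι ι ℤ) a b := by
      intro a b
      rw [← Matrix.mul_apply, ← Units.val_mul, mul_inv_cancel, Units.val_one]
    have h2 : ∀ a b, ∑ l, (g⁻¹).1 a l * g.1 l b = (1 : Matrix ι ι ℤ) a b := by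
      intro a b
      rw [← Matrix.mul_apply, ← Units.val_mul, inv_mul_cancel, Units.val_one]
    have h3 : ∀ b, g.1 s s * (g⁻¹).1 s b = (1 : Matrix ι ι ℤ) s b := by
      intro b
      rw [← h1, Finset.sum_eq_single s _ (by simp)]
      intro l _ hl
      rw [(hg s hs l hl).1, zero_mul]
    have h4 : ∀ a, (g⁻¹).1 a s * g.1 s s = (1 : Matrix ι ι ℤ) a s := by
      intro a
      rw [← h2, Finset.sum_eq_single s _ (by simp)]
      intro l _ hl
      rw [(hg s hs l hl).2, mul_zero]
    have h0 : g.1 s s ≠ 0 := by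
      intro h
      simpa [h] using h3 s
    have h5 := h3 i
    have h6 := h4 i
    rw [Matrix.one_apply_ne hi.symm] at h5
    rw [Matrix.one_apply_ne hi] at h6
    exact ⟨(mul_eq_zero.1 h5).resolve_left h0, (mul_eq_zero.1 h6).resolve_right h0⟩

theorem sum_inv_mul (g : GL ι ℤ) (a b : ι) :
    ∑ l, (g⁻¹).1 a l * g.1 l b = (1 : Matrix ι ι ℤ) a b := by
  rw [← Matrix.mul_apply, ← Units.val_mul, inv_mul_cancel, Units.val_one]

theorem offAt_diag_isUnit {S : Set ι} {g : GL ι ℤ} (hg : g ∈ offAt S) {s : ι} (hs : s ∈ S) :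
    IsUnit (g.1 s s) := by
  have h := sum_inv_mul g s s
  rw [Finset.sum_eq_single s _ (by simp), Matrix.one_apply_eq] at h
  · exact IsUnit.of_mul_eq_one_right _ h
  · intro l _ hl
    rw [(hg s hs l hl).2, mul_zero]

theorem one_add_vecMulVec_single_mul (x : ι → ℤ) (v : ι) (M : Matrix ι ι ℤ) (i b : ι) :
    ((1 + vecMulVec x (Pi.single v 1)) * M) i b = M i b + x i * M v b := by
  rw [add_mul, one_mul, vecMulVec_mul]
  simp [vecMulVec_apply]

theorem mul_one_add_vecMulVec_single (y : ι → ℤ) (v : ι) (M : Matrix ι ι ℤ) (a b : ι) :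
    (M * (1 + vecMulVec (Pi.single v 1) y)) a b = M a b + M a v * y b := by
  rw [mul_add, mul_one, mul_vecMulVec]
  simp [vecMulVec_apply]

theorem one_add_single_vecMulVec_mul (y : ι → ℤ) (v : ι) (M : Matrix ι ι ℤ) (a b : ι) :
    ((1 + vecMulVec (Pi.single v 1) y) * M) a b =
      M a b + if a = v then ∑ j, y j * M j b else 0 := by
  rw [add_mul, one_mul, vecMulVec_mul]
  by_cases h : a = v
  · subst h; simp [vecMulVec_apply, vecMul, dotProduct]
  · simp [vecMulVec_apply, h]

variable [Preorder ι]

/-- The invertible integral matrices supported, together with their inverse, on a preorder. -/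
def incGL (ι : Type*) [Fintype ι] [DecidableEq ι] [Preorder ι] : Subgroup (GL ι ℤ) where
  carrier := {g | (∀ i j, g.1 i j ≠ 0 → i ≤ j) ∧ ∀ i j, (g⁻¹).1 i j ≠ 0 → i ≤ j}
  one_mem' := by
    have : ∀ i j : ι, (1 : Matrix ι ι ℤ) i j ≠ 0 → i ≤ j := by
      intro i j h
      by_cases hij : i = j
      · exact hij.le
      · exact absurd (Matrix.one_apply_ne hij) h
    exact ⟨this, by simpa using this⟩
  mul_mem' := by
    have key : ∀ M N : Matrix ι ι ℤ, (∀ i j, M i j ≠ 0 → i ≤ j) → (∀ i j, N i j ≠ 0 → i ≤ j) →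
        ∀ i j, (M * N) i j ≠ 0 → i ≤ j := by
      intro M N hM hN i j h
      obtain ⟨l, -, hl⟩ := Finset.exists_ne_zero_of_sum_ne_zero (by rwa [Matrix.mul_apply] at h)
      exact (hM i l (left_ne_zero_of_mul hl)).trans (hN l j (right_ne_zero_of_mul hl))
    intro g h hg hh
    refine ⟨key _ _ hg.1 hh.1, ?_⟩
    rw [_root_.mul_inv_rev]
    exact key _ _ hh.2 hg.2
  inv_mem' := by
    intro g hg
    exact ⟨hg.2, by simpa using hg.1⟩

theorem elemGL_mem_incGL {i j : ι} (h : i ≤ j) (c : ℤ) : elemGL i j c ∈ incGL ι := by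
  by_cases hij : i = j
  · simp [elemGL, hij]
  have key : ∀ (d : ℤ) (a b : ι), (elemGL i j d).1 a b ≠ 0 → a ≤ b := by
    intro d a b hab
    rw [elemGL_val hij, transvection, Matrix.add_apply] at hab
    by_cases h1 : a = b
    · exact h1.le
    rw [Matrix.one_apply_ne h1, zero_add, Matrix.single_apply] at hab
    obtain ⟨rfl, rfl⟩ : i = a ∧ j = b := by
      by_contra hc
      exact hab (if_neg hc)
    exact h
  exact ⟨key c, by rw [elemGL_inv hij]; exact key _⟩

/-- The subgroup generated by the elementary matrices `1 + c E_{ij}` with `i ≤ j`, `m ∣ c` and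
`i, j ∉ S`. -/
def elemSubgroup (m : ℕ) (S : Set ι) : Subgroup (GL ι ℤ) :=
  Subgroup.closure {g | ∃ i j c, i ≠ j ∧ i ≤ j ∧ i ∉ S ∧ j ∉ S ∧ (m : ℤ) ∣ c ∧ g = elemGL i j c}

theorem elemGL_mem_elemSubgroup {m : ℕ} {S : Set ι} {i j : ι} {c : ℤ} (hij : i ≤ j)
    (hi : i ∉ S) (hj : j ∉ S) (hc : (m : ℤ) ∣ c) : elemGL i j c ∈ elemSubgroup m S := by
  by_cases h : i = j
  · simp only [elemGL, h, ne_eq, not_true_eq_false, dite_false]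
    exact one_mem _
  · exact Subgroup.subset_closure ⟨i, j, c, h, hij, hi, hj, hc, rfl⟩

theorem elemSubgroup_mono {m n : ℕ} {S T : Set ι} (hmn : m ∣ n) (hST : T ⊆ S) :
    elemSubgroup n S ≤ elemSubgroup m T := by
  refine Subgroup.closure_mono ?_
  rintro g ⟨i, j, c, h, hij, hi, hj, hc, rfl⟩
  exact ⟨i, j, c, h, hij, fun h => hi (hST h), fun h => hj (hST h),
    (Int.natCast_dvd_natCast.2 hmn).trans hc, rfl⟩

theorem elemSubgroup_le_incGL (m : ℕ) (S : Set ι) : elemSubgroup m S ≤ incGL ι := by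
  rw [elemSubgroup, Subgroup.closure_le]
  rintro g ⟨i, j, c, h, hij, hi, hj, hc, rfl⟩
  exact elemGL_mem_incGL hij c

theorem elemSubgroup_le_congGL (m : ℕ) (S : Set ι) : elemSubgroup m S ≤ congGL ι m := by
  rw [elemSubgroup, Subgroup.closure_le]
  rintro g ⟨i, j, c, h, hij, hi, hj, hc, rfl⟩
  refine mem_congGL.2 fun a b => ?_
  rw [elemGL_val h, transvection, Matrix.add_apply, add_sub_cancel_left, Matrix.single_apply]
  split_ifs
  · exact hc
  · exact dvd_zero _

theorem elemSubgroup_le_offAt (m : ℕ) (S : Set ι) : elemSubgroup m S ≤ offAt S := by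
  rw [elemSubgroup, Subgroup.closure_le]
  rintro g ⟨i, j, c, h, hij, hi, hj, hc, rfl⟩ s hs l hl
  have h1 : i ≠ s := fun h => hi (h ▸ hs)
  have h2 : j ≠ s := fun h => hj (h ▸ hs)
  rw [elemGL_val h, transvection]
  simp [hl, hl.symm, h1, h2]

theorem exists_elemSubgroup_col (m : ℕ) (S : Set ι) {v : ι} (hv : v ∉ S) (x : ι → ℤ)
    (hxv : x v = 0) (hx : ∀ i, x i ≠ 0 → i ≤ v ∧ i ∉ S) (hm : ∀ i, (m : ℤ) ∣ x i) :
    ∃ u ∈ elemSubgroup m S, u.1 = 1 + vecMulVec x (Pi.single v 1) := by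
  suffices H : ∀ s : Finset ι, v ∉ s → ∃ u ∈ elemSubgroup m S,
      u.1 = 1 + vecMulVec (fun i => if i ∈ s then x i else 0) (Pi.single v 1) by
    obtain ⟨u, hu, h⟩ := H (Finset.univ.erase v) (by simp)
    refine ⟨u, hu, h.trans ?_⟩
    congr 2
    ext i
    by_cases hi : i = v <;> simp [hi, hxv]
  intro s
  induction s using Finset.induction_on with
  | empty =>
    intro _
    refine ⟨1, one_mem _, ?_⟩
    ext i j
    simp [vecMulVec_apply]
  | insert a s ha ih =>
    intro hvs
    rw [Finset.mem_insert, not_or] at hvs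
    obtain ⟨u, hu, h⟩ := ih hvs.2
    have hav : a ≠ v := fun h => hvs.1 h.symm
    refine ⟨elemGL a v (x a) * u, mul_mem ?_ hu, ?_⟩
    · by_cases hxa : x a = 0
      · have : elemGL a v (x a) = 1 := by ext1; simp [elemGL_val hav, hxa]
        rw [this]
        exact one_mem _
      · exact elemGL_mem_elemSubgroup (hx a hxa).1 (hx a hxa).2 hv (hm a)
    · rw [Units.val_mul, elemGL_val hav, h]
      ext i j
      by_cases hi : i = a
      · subst hi
        simp [vecMulVec_apply, ha, hvs.2, Matrix.one_apply, Pi.single_apply, eq_comm]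
      · rw [transvection_mul_apply_of_ne _ _ _ _ hi]
        simp [vecMulVec_apply, hi]

theorem exists_elemSubgroup_row (m : ℕ) (S : Set ι) {v : ι} (hv : v ∉ S) (y : ι → ℤ)
    (hyv : y v = 0) (hy : ∀ j, y j ≠ 0 → v ≤ j ∧ j ∉ S) (hm : ∀ j, (m : ℤ) ∣ y j) :
    ∃ u ∈ elemSubgroup m S, u.1 = 1 + vecMulVec (Pi.single v 1) y := by
  suffices H : ∀ s : Finset ι, v ∉ s → ∃ u ∈ elemSubgroup m S,
      u.1 = 1 + vecMulVec (Pi.single v 1) (fun i => if i ∈ s then y i else 0) by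
    obtain ⟨u, hu, h⟩ := H (Finset.univ.erase v) (by simp)
    refine ⟨u, hu, h.trans ?_⟩
    congr 2
    ext i
    by_cases hi : i = v <;> simp [hi, hyv]
  intro s
  induction s using Finset.induction_on with
  | empty =>
    intro _
    refine ⟨1, one_mem _, ?_⟩
    ext i j
    simp [vecMulVec_apply]
  | insert a s ha ih =>
    intro hvs
    rw [Finset.mem_insert, not_or] at hvs
    obtain ⟨u, hu, h⟩ := ih hvs.2
    have hva : v ≠ a := hvs.1
    refine ⟨u * elemGL v a (y a), mul_mem hu ?_, ?_⟩
    · by_cases hya : y a = 0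
      · have : elemGL v a (y a) = 1 := by ext1; simp [elemGL_val hva, hya]
        rw [this]
        exact one_mem _
      · exact elemGL_mem_elemSubgroup (hy a hya).1 hv (hy a hya).2 (hm a)
    · rw [Units.val_mul, elemGL_val hva, h]
      ext i j
      by_cases hj : j = a
      · subst hj
        simp [vecMulVec_apply, ha, hvs.2, Matrix.one_apply, Pi.single_apply, eq_comm]
      · rw [mul_transvection_apply_of_ne _ _ _ _ hj]
        simp [vecMulVec_apply, hj]

/-- A unit on the diagonal allows one to clear its row and column. -/
theorem exists_clear_of_isUnit {m : ℕ} {S : Set ι} {v : ι} (hv : v ∉ S) {g : GL ι ℤ}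
    (hg : g ∈ incGL ι) (hgS : g ∈ offAt S) (hgm : g ∈ congGL ι m) (hu : IsUnit (g.1 v v)) :
    ∃ h ∈ elemSubgroup m S, ∃ k ∈ elemSubgroup m S, h * g * k ∈ offAt (insert v S) := by
  obtain ⟨ε, hε⟩ : ∃ ε : ℤ, ε * g.1 v v = 1 := by
    obtain ⟨u, hu⟩ := hu
    exact ⟨(u⁻¹ : ℤˣ), by rw [← hu]; simp⟩
  have step : ∀ g' : GL ι ℤ, g' ∈ incGL ι → g' ∈ offAt S → g' ∈ congGL ι m →
      (∀ i, i ≠ v → g'.1 i v ≠ 0 → i ≤ v ∧ i ∉ S) ∧ (∀ i, i ≠ v → g'.1 v i ≠ 0 → v ≤ i ∧ i ∉ S) ∧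
      (∀ i, i ≠ v → (m : ℤ) ∣ g'.1 i v) ∧ (∀ i, i ≠ v → (m : ℤ) ∣ g'.1 v i) := by
    intro g' h1 h2 h3
    rw [mem_congGL] at h3
    refine ⟨fun i hi h => ⟨h1.1 _ _ h, fun hs => h (h2 i hs v fun e => hv (e ▸ hs)).1⟩,
      fun i hi h => ⟨h1.1 _ _ h, fun hs => h (h2 i hs v fun e => hv (e ▸ hs)).2⟩,
      fun i hi => ?_, fun i hi => ?_⟩
    · simpa [Matrix.one_apply, hi] using h3 i v
    · simpa [Matrix.one_apply, hi.symm] using h3 v i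
  obtain ⟨c1, -, c3, -⟩ := step g hg hgS hgm
  obtain ⟨h, hh, hval⟩ := exists_elemSubgroup_col m S hv
    (fun i => if i = v then 0 else -(ε * g.1 i v)) (by simp)
    (by
      intro i hi
      by_cases h : i = v
      · simp [h] at hi
      · simp only [h, if_false, ne_eq, neg_eq_zero, mul_eq_zero, not_or] at hi
        exact c1 i h hi.2)
    (by
      intro i
      by_cases h : i = v
      · simp [h]
      · simp only [h, if_false]
        exact (dvd_mul_of_dvd_right (c3 i h) _).neg_right)
  have e1 : ∀ i b, (h * g).1 i b = g.1 i b + (if i = v then 0 else -(ε * g.1 i v)) * g.1 v b := by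
    intro i b
    rw [Units.val_mul, hval, one_add_vecMulVec_single_mul]
  have hgv : (h * g).1 v v = g.1 v v := by rw [e1]; simp
  have hgc : ∀ i, i ≠ v → (h * g).1 i v = 0 := by
    intro i hi
    rw [e1, if_neg hi]
    linear_combination (-g.1 i v) * hε
  have hS' : h * g ∈ offAt S := mul_mem (elemSubgroup_le_offAt _ _ hh) hgS
  obtain ⟨-, c2, -, c4⟩ := step (h * g) (mul_mem (elemSubgroup_le_incGL _ _ hh) hg) hS'
    (mul_mem (elemSubgroup_le_congGL _ _ hh) hgm)
  obtain ⟨k, hk, kval⟩ := exists_elemSubgroup_row m S hv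
    (fun i => if i = v then 0 else -(ε * (h * g).1 v i)) (by simp)
    (by
      intro i hi
      by_cases h : i = v
      · simp [h] at hi
      · simp only [h, if_false, ne_eq, neg_eq_zero, mul_eq_zero, not_or] at hi
        exact c2 i h hi.2)
    (by
      intro i
      by_cases h : i = v
      · simp [h]
      · simp only [h, if_false]
        exact (dvd_mul_of_dvd_right (c4 i h) _).neg_right)
  have e2 : ∀ a b, (h * g * k).1 a b =
      (h * g).1 a b + (h * g).1 a v * (if b = v then 0 else -(ε * (h * g).1 v b)) := by
    intro a b
    rw [Units.val_mul, kval, mul_one_add_vecMulVec_single]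
  refine ⟨h, hh, k, hk, ?_⟩
  have hS'' : h * g * k ∈ offAt S := mul_mem hS' (elemSubgroup_le_offAt _ _ hk)
  intro s hs i hi
  rcases hs with rfl | hs
  · rw [e2, e2, if_neg hi, hgc i hi, hgv]
    refine ⟨?_, by simp⟩
    linear_combination (-(h * g).1 s i) * hε
  · exact hS'' s hs i hi

end IncidenceGroups

section Elementary

open Matrix

variable {ι : Type*} [Fintype ι] [DecidableEq ι]

theorem elemGL_mul_apply_same {i j : ι} (h : i ≠ j) (c : ℤ) (g : GL ι ℤ) (b : ι) :
    (elemGL i j c * g).1 i b = g.1 i b + c * g.1 j b := by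
  rw [Units.val_mul, elemGL_val h, transvection_mul_apply_same]

theorem elemGL_mul_apply_of_ne {i j a : ι} (ha : a ≠ i) (h : i ≠ j) (c : ℤ) (g : GL ι ℤ) (b : ι) :
    (elemGL i j c * g).1 a b = g.1 a b := by
  rw [Units.val_mul, elemGL_val h, transvection_mul_apply_of_ne _ _ _ _ ha]

theorem elemGL_conj_of_offAt_univ {d : GL ι ℤ} (hd : d ∈ offAt (Set.univ : Set ι)) {i j : ι}
    (hij : i ≠ j) (c : ℤ) : ∃ c', d * elemGL i j c * d⁻¹ = elemGL i j c' := by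
  have hdd := offAt_diag_isUnit hd (Set.mem_univ j)
  refine ⟨d.1 i i * c * d.1 j j, ?_⟩
  rw [mul_inv_eq_iff_eq_mul]
  have hdiag : d.1 = diagonal fun a => d.1 a a := by
    ext a b
    by_cases hab : a = b
    · subst hab; simp
    · rw [diagonal_apply_ne _ hab]
      exact (hd b (Set.mem_univ b) a hab).2
  have hsq : d.1 j j * d.1 j j = 1 := by
    rcases Int.isUnit_iff.1 hdd with h | h <;> simp [h]
  ext1
  rw [Units.val_mul, Units.val_mul, elemGL_val hij, elemGL_val hij, hdiag]
  ext a b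
  simp only [transvection, mul_add, add_mul, Matrix.add_apply, diagonal_mul,
    mul_diagonal, Matrix.single_apply, diagonal_apply_eq]
  congr 1
  · by_cases hab : a = b
    · subst hab; simp
    · simp [hab]
  split_ifs with h
  · obtain ⟨rfl, rfl⟩ := h
    linear_combination (-(d.1 i i * c)) * hsq
  · simp

theorem exists_natAbs_add_mul_lt {x y : ℤ} (hy : y ≠ 0) (h : y.natAbs ≤ x.natAbs) :
    ∃ c : ℤ, (x + c * y).natAbs < x.natAbs := by
  by_cases hxy : (x + y).natAbs < x.natAbs
  · exact ⟨1, by simpa using hxy⟩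
  · exact ⟨-1, by omega⟩

variable [Preorder ι]

/-- The Euclidean algorithm in a column. -/
theorem exists_isUnit_pivot {S : Set ι} {v : ι} (hv : v ∉ S) {g : GL ι ℤ}
    (hg : g ∈ incGL ι) (hgS : g ∈ offAt S) :
    ∃ h ∈ elemSubgroup 1 S, IsUnit ((h * g).1 v v) := by
  classical
  set C : Finset ι := Finset.univ.filter fun i => i ≤ v ∧ v ≤ i ∧ i ∉ S with hC
  have memC : ∀ i, i ∈ C ↔ i ≤ v ∧ v ≤ i ∧ i ∉ S := by simp [hC]
  clear_value C
  induction hn : ∑ i ∈ C, (g.1 i v).natAbs using Nat.strong_induction_on generalizing g with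
  | _ n ih =>
  subst hn
  by_cases H : ∃ i ∈ C, ∃ j ∈ C, i ≠ j ∧ g.1 i v ≠ 0 ∧ (g.1 i v).natAbs ≤ (g.1 j v).natAbs
  · obtain ⟨i, hi, j, hj, hij, hi0, hle⟩ := H
    obtain ⟨c, hc⟩ := exists_natAbs_add_mul_lt hi0 hle
    have hi' := (memC i).1 hi
    have hj' := (memC j).1 hj
    have hE : elemGL j i c ∈ elemSubgroup 1 S :=
      elemGL_mem_elemSubgroup (hj'.1.trans hi'.2.1) hj'.2.2 hi'.2.2 (by simp)
    obtain ⟨h, hh, hu⟩ := ih (∑ a ∈ C, ((elemGL j i c * g).1 a v).natAbs)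
      (by
        refine Finset.sum_lt_sum (fun a _ => ?_) ⟨j, hj, ?_⟩
        · by_cases ha : a = j
          · subst ha
            rw [elemGL_mul_apply_same hij.symm]
            exact hc.le
          · rw [elemGL_mul_apply_of_ne ha hij.symm]
        · rwa [elemGL_mul_apply_same hij.symm])
      (mul_mem (elemSubgroup_le_incGL _ _ hE) hg) (mul_mem (elemSubgroup_le_offAt _ _ hE) hgS) rfl
    exact ⟨h * elemGL j i c, mul_mem hh hE, by rwa [mul_assoc]⟩
  · have huniq : ∀ i ∈ C, ∀ j ∈ C, g.1 i v ≠ 0 → i ≠ j → g.1 j v = 0 := by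
      intro i hi j hj h0 hij
      by_contra hj0
      rcases le_total (g.1 i v).natAbs (g.1 j v).natAbs with h | h
      · exact H ⟨i, hi, j, hj, hij, h0, h⟩
      · exact H ⟨j, hj, i, hi, hij.symm, hj0, h⟩
    have hsum := sum_inv_mul g v v
    rw [Matrix.one_apply_eq] at hsum
    have hterm : ∀ l, (g⁻¹).1 v l * g.1 l v ≠ 0 → l ∈ C := by
      intro l hl
      rw [memC]
      refine ⟨hg.1 _ _ (right_ne_zero_of_mul hl), hg.2 _ _ (left_ne_zero_of_mul hl), fun hlS => ?_⟩
      exact right_ne_zero_of_mul hl (hgS l hlS v fun e => hv (e ▸ hlS)).1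
    obtain ⟨i, -, hi⟩ := Finset.exists_ne_zero_of_sum_ne_zero (by rw [hsum]; exact one_ne_zero)
    have hiC := hterm i hi
    have hi0 := right_ne_zero_of_mul hi
    rw [Finset.sum_eq_single i _ (by simp)] at hsum
    · have hunit : IsUnit (g.1 i v) := IsUnit.of_mul_eq_one_right _ hsum
      by_cases hiv : i = v
      · subst hiv
        exact ⟨1, one_mem _, by simpa using hunit⟩
      · have hvC : v ∈ C := (memC v).2 ⟨le_rfl, le_rfl, hv⟩
        have hi' := (memC i).1 hiC
        refine ⟨elemGL v i 1, elemGL_mem_elemSubgroup hi'.2.1 hv hi'.2.2 (by simp), ?_⟩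
        rw [elemGL_mul_apply_same (Ne.symm hiv), huniq i hiC v hvC hi0 hiv]
        simpa using hunit
    · intro l _ hl
      by_contra hl0
      exact hl0 (by rw [huniq i hiC l (hterm l hl0) hi0 hl.symm, mul_zero])

theorem exists_elementary_diagonal (S : Finset ι) {g : GL ι ℤ} (hg : g ∈ incGL ι) :
    ∃ h ∈ elemSubgroup (ι := ι) 1 ∅, ∃ k ∈ elemSubgroup (ι := ι) 1 ∅,
      h * g * k ∈ offAt (S : Set ι) := by
  induction S using Finset.induction_on with
  | empty => exact ⟨1, one_mem _, 1, one_mem _, by intro s hs; simp at hs⟩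
  | insert v S hv ih =>
    obtain ⟨h, hh, k, hk, hS⟩ := ih
    have hinc : ∀ {x}, x ∈ elemSubgroup (ι := ι) 1 ∅ → x ∈ incGL ι :=
      fun hx => elemSubgroup_le_incGL _ _ hx
    have hmono : elemSubgroup (ι := ι) 1 (S : Set ι) ≤ elemSubgroup 1 ∅ :=
      elemSubgroup_mono dvd_rfl (Set.empty_subset _)
    have hg' : h * g * k ∈ incGL ι := mul_mem (mul_mem (hinc hh) hg) (hinc hk)
    have hv' : v ∉ (S : Set ι) := by simpa using hv
    obtain ⟨p, hp, hpu⟩ := exists_isUnit_pivot hv' hg' hS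
    obtain ⟨a, ha, b, hb, hab⟩ := exists_clear_of_isUnit (m := 1) hv'
      (mul_mem (elemSubgroup_le_incGL _ _ hp) hg') (mul_mem (elemSubgroup_le_offAt _ _ hp) hS)
      (mem_congGL.2 (by simp)) hpu
    refine ⟨a * p * h, mul_mem (mul_mem (hmono ha) (hmono hp)) hh, k * b, mul_mem hk (hmono hb), ?_⟩
    rw [Finset.coe_insert]
    convert hab using 1
    group

theorem conj_mem_elemSubgroup_of_offAt_univ {d : GL ι ℤ} (hd : d ∈ offAt (Set.univ : Set ι))
    {x : GL ι ℤ} (hx : x ∈ elemSubgroup (ι := ι) 1 ∅) :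
    d * x * d⁻¹ ∈ elemSubgroup (ι := ι) 1 ∅ := by
  suffices H : elemSubgroup (ι := ι) 1 ∅ ≤
      (elemSubgroup (ι := ι) 1 ∅).comap (MulAut.conj d).toMonoidHom by
    simpa using H hx
  conv_lhs => rw [elemSubgroup]
  rw [Subgroup.closure_le]
  rintro _ ⟨i, j, c, h, hij, hi, hj, -, rfl⟩
  obtain ⟨c', hc'⟩ := elemGL_conj_of_offAt_univ hd h c
  change d * elemGL i j c * d⁻¹ ∈ elemSubgroup (ι := ι) 1 ∅
  rw [hc']
  exact elemGL_mem_elemSubgroup hij hi hj (by simp)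

theorem finiteIndex_elemSubgroup_incGL :
    ((elemSubgroup (ι := ι) 1 ∅).subgroupOf (incGL ι)).FiniteIndex := by
  classical
  set E := elemSubgroup (ι := ι) 1 ∅ with hE
  have key : ∀ g : incGL ι, ∃ d ∈ offAt (Set.univ : Set ι), g.1⁻¹ * d ∈ E := by
    intro g
    obtain ⟨h, hh, k, hk, hd⟩ := exists_elementary_diagonal Finset.univ g.2
    rw [Finset.coe_univ] at hd
    refine ⟨h * g * k, hd, ?_⟩
    have h1 := conj_mem_elemSubgroup_of_offAt_univ (inv_mem hd) hh
    have h2 : g.1⁻¹ * (h * g * k) = k * ((h * g.1 * k)⁻¹ * h * (h * g.1 * k)⁻¹⁻¹) := by group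
    rw [h2]
    exact mul_mem hk h1
  choose d hd hdE using key
  refine finiteIndex_subgroupOf_of_finite_fibres E (incGL ι)
    (F := fun g => fun i => (offAt_diag_isUnit (hd g) (Set.mem_univ i)).unit) ?_
  intro g h hgh
  have : d g = d h := by
    ext1
    ext i j
    by_cases hij : i = j
    · subst hij
      have := congrArg Units.val (congrFun hgh i)
      simpa using this
    · rw [((hd g) j (Set.mem_univ j) i hij).2, ((hd h) j (Set.mem_univ j) i hij).2]
  have h3 : (g.1⁻¹ * h.1) = (g.1⁻¹ * d g) * (h.1⁻¹ * d h)⁻¹ := by rw [this]; group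
  rw [h3]
  exact mul_mem (hdE g) (inv_mem (hdE h))

end Elementary

section CongruenceReduction

open Matrix

theorem exists_isCoprime_add_mul {y₁ y₂ q : ℤ} (h0 : y₂ ≠ 0)
    (h : ∀ p : ℕ, p.Prime → (p : ℤ) ∣ y₁ → (p : ℤ) ∣ y₂ → ¬ (p : ℤ) ∣ q) :
    ∃ t : ℤ, IsCoprime (y₁ + t * q) y₂ := by
  classical
  set P := y₂.natAbs.primeFactors.filter fun p : ℕ => ¬ (p : ℤ) ∣ y₁ with hP
  have memP : ∀ p : ℕ, p ∈ P ↔ (p.Prime ∧ (p : ℤ) ∣ y₂) ∧ ¬ (p : ℤ) ∣ y₁ := by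
    intro p
    simp [hP, h0, Int.natCast_dvd]
  refine ⟨((∏ p ∈ P, p : ℕ) : ℤ), ?_⟩
  rw [Int.isCoprime_iff_gcd_eq_one]
  by_contra hgcd
  obtain ⟨p, hp, hdvd⟩ := Nat.exists_prime_and_dvd hgcd
  have hd1 : (p : ℤ) ∣ y₁ + ((∏ p ∈ P, p : ℕ) : ℤ) * q :=
    (Int.natCast_dvd_natCast.2 hdvd).trans (Int.gcd_dvd_left ..)
  have hd2 : (p : ℤ) ∣ y₂ := (Int.natCast_dvd_natCast.2 hdvd).trans (Int.gcd_dvd_right ..)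
  by_cases hp1 : (p : ℤ) ∣ y₁
  · rw [dvd_add_right hp1] at hd1
    rcases (Nat.prime_iff_prime_int.1 hp).dvd_or_dvd hd1 with h1 | h1
    · rw [Int.natCast_dvd_natCast, Prime.dvd_finsetProd_iff hp.prime] at h1
      obtain ⟨r, hr, hpr⟩ := h1
      have hr' := (memP r).1 hr
      rw [(Nat.prime_dvd_prime_iff_eq hp hr'.1.1).1 hpr] at hp1
      exact hr'.2 hp1
    · exact h p hp hp1 hd2 h1
  · have : (p : ℤ) ∣ ((∏ p ∈ P, p : ℕ) : ℤ) :=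
      Int.natCast_dvd_natCast.2 (Finset.dvd_prod_of_mem _ ((memP p).2 ⟨⟨hp, hd2⟩, hp1⟩))
    exact hp1 ((dvd_add_left (this.mul_right q)).1 hd1)

variable {ι : Type*} [Fintype ι] [DecidableEq ι] [Preorder ι]

/-- A unit pivot can be reached by elementary matrices of level `m` from level `m ^ 2`, provided
the equivalence class of the pivot does not have exactly two elements. -/
theorem exists_isUnit_pivot_of_mem_congGL {m : ℕ} (hm : 2 ≤ m) {S : Set ι} {v : ι}
    (hS : ∀ i, i ≤ v → v ≤ i → i ∉ S)
    (hcl : ∀ i, i ≤ v → v ≤ i → i ≠ v → ∃ j, j ≤ v ∧ v ≤ j ∧ j ≠ v ∧ j ≠ i) {g : GL ι ℤ}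
    (hg : g ∈ incGL ι) (hgS : g ∈ offAt S) (hgm : g ∈ congGL ι (m ^ 2)) :
    ∃ h ∈ elemSubgroup m S, IsUnit ((h * g).1 v v) := by
  have hv : v ∉ S := hS v le_rfl le_rfl
  by_cases H : ∃ i, i ≤ v ∧ v ≤ i ∧ i ≠ v
  swap
  · push Not at H
    refine ⟨1, one_mem _, ?_⟩
    rw [one_mul]
    have hsum := sum_inv_mul g v v
    rw [Matrix.one_apply_eq, Finset.sum_eq_single v _ (by simp)] at hsum
    · exact IsUnit.of_mul_eq_one_right _ hsum
    · intro l _ hl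
      by_contra h0
      exact hl (H l (hg.1 _ _ (right_ne_zero_of_mul h0)) (hg.2 _ _ (left_ne_zero_of_mul h0)))
  obtain ⟨c₁, hc₁v, hvc₁, hc₁⟩ := H
  obtain ⟨c₂, hc₂v, hvc₂, hc₂, hc₂₁⟩ := hcl c₁ hc₁v hvc₁ hc₁
  have hS₁ := hS c₁ hc₁v hvc₁
  have hS₂ := hS c₂ hc₂v hvc₂
  have hm0 : (m : ℤ) ≠ 0 := by positivity
  have hgvv : (m : ℤ) ^ 2 ∣ g.1 v v - 1 := by simpa using mem_congGL.1 hgm v v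
  have hgm' : g ∈ congGL ι m := by
    refine mem_congGL.2 fun i j => dvd_trans ?_ (mem_congGL.1 hgm i j)
    push_cast
    exact dvd_pow_self _ two_ne_zero
  obtain ⟨h₁, hh₁, hne, hvv⟩ : ∃ h ∈ elemSubgroup m S, (h * g).1 c₂ v ≠ 0 ∧
      (m : ℤ) ^ 2 ∣ (h * g).1 v v - 1 := by
    by_cases h0 : g.1 c₂ v = 0
    · refine ⟨elemGL c₂ v m, elemGL_mem_elemSubgroup hc₂v hS₂ hv dvd_rfl, ?_, ?_⟩
      · rw [elemGL_mul_apply_same hc₂, h0, zero_add]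
        refine mul_ne_zero hm0 fun ha => ?_
        rw [ha, zero_sub, dvd_neg] at hgvv
        have := Int.le_of_dvd one_pos hgvv
        have h2 : (2 : ℤ) ≤ m := by exact_mod_cast hm
        nlinarith
      · rwa [elemGL_mul_apply_of_ne hc₂.symm hc₂]
    · exact ⟨1, one_mem _, by rwa [one_mul], by rwa [one_mul]⟩
  set g₁ := h₁ * g with hg₁
  have hg₁S : g₁ ∈ offAt S := mul_mem (elemSubgroup_le_offAt _ _ hh₁) hgS
  have hg₁m : g₁ ∈ congGL ι m := mul_mem (elemSubgroup_le_congGL _ _ hh₁) hgm'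
  have hg₁i : g₁ ∈ incGL ι := mul_mem (elemSubgroup_le_incGL _ _ hh₁) hg
  obtain ⟨y₁, hy₁⟩ : (m : ℤ) ∣ g₁.1 c₁ v := by simpa [hc₁] using mem_congGL.1 hg₁m c₁ v
  obtain ⟨y₂, hy₂⟩ : (m : ℤ) ∣ g₁.1 c₂ v := by simpa [hc₂] using mem_congGL.1 hg₁m c₂ v
  have hy₂0 : y₂ ≠ 0 := by
    rintro rfl
    exact hne (by rw [hy₂, mul_zero])
  set r : ι → ℤ := fun j => if j = c₁ ∨ j = c₂ then 0 else (g₁⁻¹).1 v j with hr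
  set q : ℤ := ∑ j, r j * g₁.1 j v with hq
  have hsum : q + (g₁⁻¹).1 v c₁ * g₁.1 c₁ v + (g₁⁻¹).1 v c₂ * g₁.1 c₂ v = 1 := by
    have h1 := sum_inv_mul g₁ v v
    rw [Matrix.one_apply_eq] at h1
    rw [← h1, hq]
    have h2 : ∀ j, (g₁⁻¹).1 v j * g₁.1 j v = r j * g₁.1 j v +
        (if j = c₁ then (g₁⁻¹).1 v c₁ * g₁.1 c₁ v else 0) +
        (if j = c₂ then (g₁⁻¹).1 v c₂ * g₁.1 c₂ v else 0) := by
      intro j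
      by_cases hj₁ : j = c₁
      · subst hj₁; simp [hr, hc₂₁.symm]
      · by_cases hj₂ : j = c₂
        · subst hj₂; simp [hr, hj₁]
        · simp [hr, hj₁, hj₂]
    rw [Finset.sum_congr rfl fun j _ => h2 j, Finset.sum_add_distrib, Finset.sum_add_distrib]
    simp
  obtain ⟨t, ht⟩ : ∃ t : ℤ, IsCoprime (y₁ + t * q) y₂ := by
    refine exists_isCoprime_add_mul hy₂0 fun p hp h1 h2 h3 => ?_
    have : (p : ℤ) ∣ 1 := by
      rw [← hsum, hy₁, hy₂]
      exact dvd_add (dvd_add h3 ((h1.mul_left _).mul_left _)) ((h2.mul_left _).mul_left _)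
    exact hp.one_lt.ne' (by exact_mod_cast Int.eq_one_of_dvd_one (by positivity) this)
  obtain ⟨u, hu, huval⟩ := exists_elemSubgroup_row m S hS₁ (fun j => m * t * r j) (by simp [hr])
    (by
      intro j hj
      have hj' : r j ≠ 0 := right_ne_zero_of_mul hj
      have hj'' : (g₁⁻¹).1 v j ≠ 0 := by
        intro h0
        exact hj' (by simp only [hr, h0, ite_self])
      refine ⟨hc₁v.trans (hg₁i.2 _ _ hj''), fun hjS => hj'' ?_⟩
      exact ((inv_mem hg₁S) j hjS v fun e => hv (e ▸ hjS)).2)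
    (fun j => ⟨t * r j, by ring⟩)
  have e2 : ∀ a, (u * g₁).1 a v = g₁.1 a v + if a = c₁ then m * t * q else 0 := by
    intro a
    rw [Units.val_mul, huval, one_add_single_vecMulVec_mul, hq, Finset.mul_sum]
    simp only [mul_assoc]
  obtain ⟨α, β, hαβ⟩ := ht
  obtain ⟨k, hk⟩ := hvv
  refine ⟨elemGL v c₁ (-(m * k * α)) * elemGL v c₂ (-(m * k * β)) * u * h₁,
    mul_mem (mul_mem (mul_mem (elemGL_mem_elemSubgroup hvc₁ hv hS₁ ?_)
      (elemGL_mem_elemSubgroup hvc₂ hv hS₂ ?_)) hu) hh₁, ?_⟩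
  · exact ⟨-(k * α), by ring⟩
  · exact ⟨-(k * β), by ring⟩
  have e3 : (elemGL v c₁ (-(m * k * α)) * elemGL v c₂ (-(m * k * β)) * u * h₁ * g).1 v v = 1 := by
    rw [mul_assoc _ h₁ g, ← hg₁, mul_assoc, mul_assoc, elemGL_mul_apply_same hc₁.symm,
      elemGL_mul_apply_same hc₂.symm, elemGL_mul_apply_of_ne hc₁ hc₂.symm, e2, e2, e2,
      if_neg hc₁.symm, if_neg hc₂₁, if_pos rfl, hy₁, hy₂]
    linear_combination hk - (m : ℤ) ^ 2 * k * hαβ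
  rw [e3]
  exact isUnit_one

theorem exists_offAt_of_mem_congGL (S : Finset ι)
    (hS : ∀ i ∈ S, ∀ j ∈ S, i ≤ j → j ≤ i → i = j)
    (hcl : ∀ v i : ι, i ≤ v → v ≤ i → i ≠ v → ∃ j, j ≤ v ∧ v ≤ j ∧ j ≠ v ∧ j ≠ i)
    {m : ℕ} (hm : 2 ≤ m) {g : GL ι ℤ} (hg : g ∈ incGL ι) (hgm : g ∈ congGL ι (m ^ 2 ^ S.card)) :
    ∃ h ∈ elemSubgroup (ι := ι) m ∅, ∃ k ∈ elemSubgroup (ι := ι) m ∅,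
      h * g * k ∈ offAt (S : Set ι) := by
  induction S using Finset.induction_on generalizing m with
  | empty => exact ⟨1, one_mem _, 1, one_mem _, by intro s hs; simp at hs⟩
  | insert v S hv ih =>
    have hm2 : 2 ≤ m ^ 2 := by nlinarith
    have hv' : v ∉ (S : Set ι) := by simpa using hv
    have hcard : m ^ 2 ^ (insert v S).card = (m ^ 2) ^ 2 ^ S.card := by
      rw [Finset.card_insert_of_notMem hv, pow_succ, mul_comm, pow_mul]
    have hgm2 : g ∈ congGL ι (m ^ 2) := by
      refine mem_congGL.2 fun i j => dvd_trans ?_ (mem_congGL.1 hgm i j)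
      rw [hcard]
      push_cast
      exact dvd_pow_self _ (by positivity)
    obtain ⟨h, hh, k, hk, hhk⟩ := ih
      (fun i hi j hj => hS i (Finset.mem_insert_of_mem hi) j (Finset.mem_insert_of_mem hj)) hm2
      (hcard ▸ hgm)
    have hgi : h * g * k ∈ incGL ι :=
      mul_mem (mul_mem (elemSubgroup_le_incGL _ _ hh) hg) (elemSubgroup_le_incGL _ _ hk)
    have hgc : h * g * k ∈ congGL ι (m ^ 2) :=
      mul_mem (mul_mem (elemSubgroup_le_congGL _ _ hh) hgm2) (elemSubgroup_le_congGL _ _ hk)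
    have hgc' : h * g * k ∈ congGL ι m := by
      refine mem_congGL.2 fun i j => dvd_trans ?_ (mem_congGL.1 hgc i j)
      push_cast
      exact dvd_pow_self _ two_ne_zero
    obtain ⟨p, hp, hpu⟩ := exists_isUnit_pivot_of_mem_congGL hm (S := (S : Set ι)) (v := v)
      (fun i h1 h2 hi => hv' (hS i (Finset.mem_insert_of_mem hi) v (Finset.mem_insert_self _ _)
        h1 h2 ▸ hi)) (hcl v) hgi hhk hgc
    obtain ⟨a, ha, b, hb, hab⟩ := exists_clear_of_isUnit (m := m) hv'
      (mul_mem (elemSubgroup_le_incGL _ _ hp) hgi) (mul_mem (elemSubgroup_le_offAt _ _ hp) hhk)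
      (mul_mem (elemSubgroup_le_congGL _ _ hp) hgc') hpu
    have hmono : elemSubgroup (ι := ι) m (S : Set ι) ≤ elemSubgroup m ∅ :=
      elemSubgroup_mono dvd_rfl (Set.empty_subset _)
    have hmono' : elemSubgroup (ι := ι) (m ^ 2) ∅ ≤ elemSubgroup m ∅ :=
      elemSubgroup_mono (dvd_pow_self _ two_ne_zero) (Set.empty_subset _)
    refine ⟨a * p * h, mul_mem (mul_mem (hmono ha) (hmono hp)) (hmono' hh), k * b,
      mul_mem (hmono' hk) (hmono hb), ?_⟩
    rw [Finset.coe_insert]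
    convert hab using 1
    group

end CongruenceReduction

section NotIndicable

open Matrix

variable {ι : Type*} [Fintype ι] [DecidableEq ι]

theorem mul_elemGL_apply {i j : ι} (h : i ≠ j) (c : ℤ) (g : GL ι ℤ) (a b : ι) :
    (g * elemGL i j c).1 a b = g.1 a b + if b = j then c * g.1 a i else 0 := by
  rw [Units.val_mul, elemGL_val h]
  by_cases hb : b = j
  · subst hb
    rw [mul_transvection_apply_same, if_pos rfl]
  · rw [mul_transvection_apply_of_ne _ _ _ _ hb, if_neg hb, add_zero]

theorem elemGL_mul_apply {i j : ι} (h : i ≠ j) (c : ℤ) (g : GL ι ℤ) (a b : ι) :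
    (elemGL i j c * g).1 a b = g.1 a b + if a = i then c * g.1 j b else 0 := by
  by_cases ha : a = i
  · subst ha
    rw [elemGL_mul_apply_same h, if_pos rfl]
  · rw [elemGL_mul_apply_of_ne ha h, if_neg ha, add_zero]

theorem diag_eq_one_of_mem_offAt {S : Set ι} {m : ℕ} (hm : 3 ≤ m) {g : GL ι ℤ} (hg : g ∈ offAt S)
    (hgm : g ∈ congGL ι m) {v : ι} (hv : v ∈ S) : g.1 v v = 1 := by
  have h1 : (m : ℤ) ∣ g.1 v v - 1 := by simpa using mem_congGL.1 hgm v v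
  rcases Int.isUnit_iff.1 (offAt_diag_isUnit hg hv) with h | h
  · exact h
  · rw [h] at h1
    have := Int.le_of_dvd (by norm_num : (0 : ℤ) < 2) (by simpa using (dvd_neg.2 h1))
    omega

variable [Preorder ι]

theorem exists_mul_elemGL_eq_of_mem_offAt {S : Set ι} {m : ℕ} (hm : 3 ≤ m) {g : GL ι ℤ}
    (hgi : g ∈ incGL ι) (hg : g ∈ offAt S) (hgm : g ∈ congGL ι m) {i v : ι} (hv : v ∈ S)
    (hiv : i ≠ v) (hle : i ≤ v) (c : ℤ) :
    ∃ u ∈ elemSubgroup (ι := ι) m ∅, g * elemGL i v c = u * (elemGL i v c * g) := by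
  have hvv := diag_eq_one_of_mem_offAt hm hg hgm hv
  have hrow : ∀ b, g.1 v b = (1 : Matrix ι ι ℤ) v b := by
    intro b
    by_cases hb : b = v
    · subst hb; simpa using hvv
    · rw [(hg v hv b hb).1, Matrix.one_apply_ne (Ne.symm hb)]
  obtain ⟨u, hu, huval⟩ := exists_elemSubgroup_col m ∅ (v := v) (by simp)
    (fun l => c * (g.1 l i - (1 : Matrix ι ι ℤ) l i)) (by simp [hrow])
    (by
      intro l hl
      refine ⟨?_, by simp⟩
      by_cases hli : l = i
      · exact hli ▸ hle
      · refine (hgi.1 l i fun h0 => hl ?_).trans hle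
        simp [h0, hli])
    (fun l => (mem_congGL.1 hgm l i).mul_left c)
  refine ⟨u, hu, ?_⟩
  ext1
  ext a b
  rw [Units.val_mul u, huval, one_add_vecMulVec_single_mul, mul_elemGL_apply hiv,
    elemGL_mul_apply hiv, elemGL_mul_apply hiv, if_neg hiv.symm, hrow]
  by_cases hb : b = v
  · subst hb
    by_cases ha : a = i
    · subst ha; simp; ring
    · simp [ha]
  · simp [hb, Ne.symm hb]

theorem exists_elemGL_mul_eq_of_mem_offAt {S : Set ι} {m : ℕ} (hm : 3 ≤ m) {g : GL ι ℤ}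
    (hgi : g ∈ incGL ι) (hg : g ∈ offAt S) (hgm : g ∈ congGL ι m) {v j : ι} (hv : v ∈ S)
    (hvj : v ≠ j) (hle : v ≤ j) (c : ℤ) :
    ∃ u ∈ elemSubgroup (ι := ι) m ∅, elemGL v j c * g = g * elemGL v j c * u := by
  have hvv := diag_eq_one_of_mem_offAt hm hg hgm hv
  have hcol : ∀ a, g.1 a v = (1 : Matrix ι ι ℤ) a v := by
    intro a
    by_cases ha : a = v
    · subst ha; simpa using hvv
    · rw [(hg v hv a ha).2, Matrix.one_apply_ne ha]
  obtain ⟨u, hu, huval⟩ := exists_elemSubgroup_row m ∅ (v := v) (by simp)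
    (fun b => c * (g.1 j b - (1 : Matrix ι ι ℤ) j b)) (by simp [hcol])
    (by
      intro b hb
      refine ⟨?_, by simp⟩
      by_cases hbj : j = b
      · exact hbj ▸ hle
      · refine hle.trans (hgi.1 j b fun h0 => hb ?_)
        simp [h0, hbj])
    (fun b => (mem_congGL.1 hgm j b).mul_left c)
  refine ⟨u, hu, ?_⟩
  ext1
  ext a b
  rw [Units.val_mul _ u, huval, mul_one_add_vecMulVec_single, elemGL_mul_apply hvj,
    mul_elemGL_apply hvj, mul_elemGL_apply hvj, if_neg hvj, hcol]
  by_cases ha : a = v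
  · subst ha
    by_cases hb : b = j
    · subst hb; simp; ring
    · simp [hb, Ne.symm hb]
  · simp [ha]

/-- An elementary matrix as an element of the elementary group of a preorder. -/
def elemOf {i j : ι} (h : i ≤ j) (c : ℤ) : elemSubgroup (ι := ι) 1 ∅ :=
  ⟨elemGL i j c, elemGL_mem_elemSubgroup h (by simp) (by simp) (by simp)⟩

theorem elemOf_commutator {i j k : ι} (hij : i ≠ j) (hjk : j ≠ k) (hik : i ≠ k) (h₁ : i ≤ j)
    (h₂ : j ≤ k) (a b : ℤ) :
    elemOf h₁ a * elemOf h₂ b * (elemOf h₁ a)⁻¹ * (elemOf h₂ b)⁻¹ =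
      elemOf (h₁.trans h₂) (a * b) :=
  Subtype.ext (elemGL_commutator hij hjk hik a b)

theorem elemOf_pow {i j : ι} (hij : i ≠ j) (h : i ≤ j) (a : ℤ) (n : ℕ) :
    elemOf h a ^ n = elemOf h (n * a) :=
  Subtype.ext (elemGL_pow hij a n)

theorem mk_mem_of_mem_elemSubgroup {m : ℕ} (P : Subgroup (elemSubgroup (ι := ι) 1 ∅))
    (hP : ∀ (i j : ι) (h : i ≤ j) (c : ℤ), i ≠ j → (m : ℤ) ∣ c → elemOf h c ∈ P) {u : GL ι ℤ}
    (hu : u ∈ elemSubgroup (ι := ι) m ∅) : ∃ h : u ∈ elemSubgroup (ι := ι) 1 ∅, ⟨u, h⟩ ∈ P := by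
  have key : elemSubgroup (ι := ι) m ∅ ≤ P.map (elemSubgroup (ι := ι) 1 ∅).subtype := by
    conv_lhs => rw [elemSubgroup]
    rw [Subgroup.closure_le]
    rintro _ ⟨i, j, c, h, hij, -, -, hc, rfl⟩
    exact ⟨elemOf hij c, hP i j hij c h hc, rfl⟩
  obtain ⟨x, hx, rfl⟩ := key hu
  exact ⟨x.2, hx⟩

theorem eq_top_of_elemOf_mem (P : Subgroup (elemSubgroup (ι := ι) 1 ∅))
    (hP : ∀ (i j : ι) (h : i ≤ j) (c : ℤ), i ≠ j → elemOf h c ∈ P) : P = ⊤ := by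
  rw [eq_top_iff]
  intro x _
  exact (mk_mem_of_mem_elemSubgroup P (fun i j h c hij _ => hP i j h c hij) x.2).2

theorem hom_elemSubgroup_eq_one
    (hB : ∀ i j : ι, i ≠ j → i ≤ j → ∃ k, k ≠ i ∧ k ≠ j ∧ i ≤ k ∧ k ≤ j)
    (Φ : elemSubgroup (ι := ι) 1 ∅ →* Multiplicative ℤ) : Φ = 1 := by
  rw [← MonoidHom.ker_eq_top_iff]
  refine eq_top_of_elemOf_mem _ fun i j h c hij => ?_
  obtain ⟨k, hki, hkj, hik, hkj'⟩ := hB i j hij h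
  have := elemOf_commutator hki.symm hkj hij hik hkj' c 1
  rw [mul_one] at this
  rw [MonoidHom.mem_ker, ← this]
  simp only [map_mul, map_inv]
  rw [mul_comm (Φ (elemOf hik c))]
  simp

theorem elemOf_mem_intKernel
    (hB : ∀ i j : ι, i ≠ j → i ≤ j → ∃ k, k ≠ i ∧ k ≠ j ∧ i ≤ k ∧ k ≤ j)
    (K : Subgroup (elemSubgroup (ι := ι) 1 ∅)) [K.Normal] [hK : K.FiniteIndex] {i j : ι} (h : i ≤ j)
    (hij : i ≠ j) {c : ℤ} (hc : (K.index : ℤ) ∣ c) : elemOf h c ∈ intKernel K := by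
  have hmem : ∀ (a b : ι) (hab : a ≤ b) (d : ℤ), a ≠ b → (K.index : ℤ) ∣ d → elemOf hab d ∈ K := by
    rintro a b hab _ hne ⟨d, rfl⟩
    rw [← elemOf_pow hne]
    exact K.pow_index_mem _
  obtain ⟨k, hki, hkj, hik, hkj'⟩ := hB i j hij h
  refine mem_intKernel_of_pow_mem (hmem i j h c hij hc) hK.index_ne_zero ?_
  rw [elemOf_pow hij, ← elemOf_commutator hki.symm hkj hij hik hkj']
  exact commutator_mem_intKernel (hmem _ _ _ _ hki.symm dvd_rfl) (hmem _ _ _ _ hkj hc)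

/-- A system of representatives for the equivalence relation of a finite preorder. -/
theorem exists_representatives : ∃ S : Finset ι, (∀ i ∈ S, ∀ j ∈ S, i ≤ j → j ≤ i → i = j) ∧
    ∀ i, ∃ v ∈ S, v ≤ i ∧ i ≤ v := by
  classical
  let s := AntisymmRel.setoid ι (· ≤ ·)
  have hrep : ∀ i : ι, (Quotient.mk s i).out ≤ i ∧ i ≤ (Quotient.mk s i).out :=
    fun i => Quotient.mk_out (s := s) i
  refine ⟨Finset.univ.image fun i => (Quotient.mk s i).out, ?_, fun i =>
    ⟨_, Finset.mem_image_of_mem _ (Finset.mem_univ i), hrep i⟩⟩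
  intro i hi j hj hij hji
  obtain ⟨a, -, rfl⟩ := Finset.mem_image.1 hi
  obtain ⟨b, -, rfl⟩ := Finset.mem_image.1 hj
  congr 1
  refine Quotient.sound (s := s) ⟨?_, ?_⟩
  · exact (hrep a).2.trans (hij.trans (hrep b).1)
  · exact (hrep b).2.trans (hji.trans (hrep a).1)

theorem mem_intKernel_of_mem_offAt
    (hB : ∀ i j : ι, i ≠ j → i ≤ j → ∃ k, k ≠ i ∧ k ≠ j ∧ i ≤ k ∧ k ≤ j)
    (K : Subgroup (elemSubgroup (ι := ι) 1 ∅)) [K.Normal] [K.FiniteIndex] {S : Finset ι}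
    (hS : ∀ i, ∃ v ∈ S, v ≤ i ∧ i ≤ v) {m : ℕ} (hm : 3 ≤ m) (hKm : K.index ∣ m)
    {g : elemSubgroup (ι := ι) 1 ∅} (hgK : g ∈ K) (hgS : g.1 ∈ offAt (S : Set ι))
    (hgm : g.1 ∈ congGL ι m) : g ∈ intKernel K := by
  have hgi : g.1 ∈ incGL ι := elemSubgroup_le_incGL _ _ g.2
  have hD : ∀ u ∈ elemSubgroup (ι := ι) m ∅, ∃ h : u ∈ elemSubgroup (ι := ι) 1 ∅,
      ⟨u, h⟩ ∈ intKernel K := fun u hu => mk_mem_of_mem_elemSubgroup _ (fun i j h c hij hc =>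
        elemOf_mem_intKernel hB K h hij ((Int.natCast_dvd_natCast.2 hKm).trans hc)) hu
  let π := QuotientGroup.mk' (intKernel K)
  let P := (Subgroup.centralizer {π g}).comap π
  have hP : ∀ x, x ∈ P ↔ π g * π x = π x * π g := by
    intro x
    rw [Subgroup.mem_comap, Subgroup.mem_centralizer_singleton_iff]
    exact eq_comm
  have hker : ∀ x ∈ intKernel K, π x = 1 := fun x hx => (QuotientGroup.eq_one_iff x).2 hx
  have hleft : ∀ (i v : ι) (h : i ≤ v) (c : ℤ), i ≠ v → v ∈ S → elemOf h c ∈ P := by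
    intro i v h c hiv hv
    obtain ⟨u, hu, hue⟩ := exists_mul_elemGL_eq_of_mem_offAt hm hgi hgS hgm hv hiv h c
    obtain ⟨huE, huD⟩ := hD u hu
    have : g * elemOf h c = ⟨u, huE⟩ * (elemOf h c * g) := Subtype.ext hue
    rw [hP, ← map_mul, this, map_mul, hker _ huD, one_mul, map_mul]
  have hright : ∀ (v j : ι) (h : v ≤ j) (c : ℤ), v ≠ j → v ∈ S → elemOf h c ∈ P := by
    intro v j h c hvj hv
    obtain ⟨u, hu, hue⟩ := exists_elemGL_mul_eq_of_mem_offAt hm hgi hgS hgm hv hvj h c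
    obtain ⟨huE, huD⟩ := hD u hu
    have : elemOf h c * g = g * elemOf h c * ⟨u, huE⟩ := Subtype.ext hue
    rw [hP, ← map_mul π _ g, this, map_mul π, hker _ huD, mul_one, map_mul]
  have htop : P = ⊤ := by
    refine eq_top_of_elemOf_mem P fun i j h c hij => ?_
    obtain ⟨v, hv, hvj, hjv⟩ := hS j
    by_cases h1 : v = j
    · subst h1
      exact hleft i v h c hij hv
    by_cases h2 : v = i
    · subst h2
      exact hright v j h c hij hv
    have e := elemOf_commutator (Ne.symm h2) h1 hij (h.trans hjv) hvj c 1
    have m1 := hleft i v (h.trans hjv) c (Ne.symm h2) hv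
    have m2 := hright v j hvj 1 h1 hv
    rw [mul_one] at e
    rw [← e]
    exact mul_mem (mul_mem (mul_mem m1 m2) (inv_mem m1)) (inv_mem m2)
  refine mem_intKernel_of_central (hom_elemSubgroup_eq_one hB) K hgK fun x => ?_
  have hx := (hP x).1 (htop ▸ Subgroup.mem_top x)
  rw [← QuotientGroup.eq_one_iff]
  change π (x⁻¹ * g * x * g⁻¹) = 1
  rw [map_mul, map_mul, map_mul, map_inv, map_inv, mul_assoc (π x)⁻¹, hx]
  group

theorem not_virtuallyIndicable_elemSubgroup
    (hB : ∀ i j : ι, i ≠ j → i ≤ j → ∃ k, k ≠ i ∧ k ≠ j ∧ i ≤ k ∧ k ≤ j) :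
    ¬ VirtuallyIndicable (elemSubgroup (ι := ι) 1 ∅) := by
  rintro ⟨K₀, hK₀, φ, hφ⟩
  let K := K₀.normalCore
  have hKle : K ≤ K₀ := K₀.normalCore_le
  obtain ⟨S, hS₁, hS₂⟩ := exists_representatives (ι := ι)
  set m := 3 * K.index with hm
  have hidx : K.index ≠ 0 := Subgroup.FiniteIndex.index_ne_zero
  have hm3 : 3 ≤ m := by omega
  have hKm : K.index ∣ m := Dvd.intro_left _ rfl
  have : NeZero (m ^ 2 ^ S.card) := ⟨by positivity⟩
  obtain ⟨x, hx⟩ := hφ (Multiplicative.ofAdd 1)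
  obtain ⟨n₁, hn₁, hx₁⟩ := exists_pow_mem_of_finiteIndex K x.1
  obtain ⟨n₂, hn₂, hx₂⟩ := exists_pow_mem_of_finiteIndex (congGL ι (m ^ 2 ^ S.card)) x.1.1
  set g := x.1 ^ (n₁ * n₂) with hg
  have hgK : g ∈ K := by
    rw [hg, pow_mul]
    exact K.pow_mem hx₁ _
  have hgm : g.1 ∈ congGL ι (m ^ 2 ^ S.card) := by
    rw [hg, mul_comm, pow_mul]
    exact Subgroup.pow_mem _ hx₂ _
  have hgm' : g.1 ∈ congGL ι m := by
    refine mem_congGL.2 fun i j => dvd_trans ?_ (mem_congGL.1 hgm i j)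
    push_cast
    exact dvd_pow_self _ (by positivity)
  obtain ⟨h, hh, k, hk, hhk⟩ := exists_offAt_of_mem_congGL S hS₁
    (fun v i h1 h2 h3 => by
      obtain ⟨j, hji, hjv, hij, hjv'⟩ := hB i v h3 h1
      exact ⟨j, hjv', h2.trans hij, hjv, hji⟩)
    (by omega : 2 ≤ m) (elemSubgroup_le_incGL _ _ g.2) hgm
  have hD : ∀ u ∈ elemSubgroup (ι := ι) m ∅, ∃ h : u ∈ elemSubgroup (ι := ι) 1 ∅,
      ⟨u, h⟩ ∈ intKernel K := fun u hu => mk_mem_of_mem_elemSubgroup _ (fun i j h c hij hc =>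
        elemOf_mem_intKernel hB K h hij ((Int.natCast_dvd_natCast.2 hKm).trans hc)) hu
  obtain ⟨hhE, hhD⟩ := hD h hh
  obtain ⟨hkE, hkD⟩ := hD k hk
  have hmem : ⟨h, hhE⟩ * g * ⟨k, hkE⟩ ∈ intKernel K :=
    mem_intKernel_of_mem_offAt hB K hS₂ hm3 hKm
      (K.mul_mem (K.mul_mem (intKernel_le K hhD) hgK) (intKernel_le K hkD)) hhk
      (mul_mem (mul_mem (elemSubgroup_le_congGL _ _ hh) hgm') (elemSubgroup_le_congGL _ _ hk))
  have hgD : g ∈ intKernel K := by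
    rwa [Subgroup.mul_mem_cancel_right _ hkD, Subgroup.mul_mem_cancel_left _ hhD] at hmem
  obtain ⟨hgK', hψ⟩ := mem_intKernel.1 hgD
  have h1 : φ (x ^ (n₁ * n₂)) = 1 := hψ (φ.comp (Subgroup.inclusion hKle))
  rw [map_pow] at h1
  have h2 := multiplicative_int_pow_eq_one (mul_ne_zero hn₁ hn₂) h1
  rw [hx] at h2
  exact absurd (congrArg Multiplicative.toAdd h2) (by decide)

end NotIndicable

section Sanov

open Matrix

/-- Sanov's generators of a free subgroup of `GL₂(ℤ)`. -/
def sanov : Fin 2 → GL (Fin 2) ℤ := ![elemGL 0 1 2, elemGL 1 0 2]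

/-- The action of `GL₂(ℤ)` on nonzero vectors. -/
instance : MulAction (GL (Fin 2) ℤ) {p : Fin 2 → ℤ // p ≠ 0} where
  smul g p := ⟨g.1 *ᵥ p.1, fun h => p.2 (by
    have : (g⁻¹).1 *ᵥ (g.1 *ᵥ p.1) = p.1 := by
      rw [mulVec_mulVec, ← Units.val_mul, inv_mul_cancel, Units.val_one, one_mulVec]
    rw [← this, h, mulVec_zero])⟩
  one_smul p := Subtype.ext (by change (1 : GL (Fin 2) ℤ).1 *ᵥ p.1 = p.1; simp)
  mul_smul g h p := Subtype.ext (by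
    change (g * h).1 *ᵥ p.1 = g.1 *ᵥ (h.1 *ᵥ p.1)
    rw [Units.val_mul, mulVec_mulVec])

theorem smul_nonzero_val (g : GL (Fin 2) ℤ) (p : {p : Fin 2 → ℤ // p ≠ 0}) :
    (g • p).1 = g.1 *ᵥ p.1 := rfl

theorem elemGL_zero_one_smul (c : ℤ) (p : {p : Fin 2 → ℤ // p ≠ 0}) :
    (elemGL (0 : Fin 2) 1 c • p).1 = ![p.1 0 + c * p.1 1, p.1 1] := by
  rw [smul_nonzero_val, elemGL_val (by decide)]
  ext l
  fin_cases l <;> simp [transvection, add_mulVec]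

theorem elemGL_one_zero_smul (c : ℤ) (p : {p : Fin 2 → ℤ // p ≠ 0}) :
    (elemGL (1 : Fin 2) 0 c • p).1 = ![p.1 0, p.1 1 + c * p.1 0] := by
  rw [smul_nonzero_val, elemGL_val (by decide)]
  ext l
  fin_cases l <;> simp [transvection, add_mulVec]

theorem ne_zero_or_ne_zero_of_nonzero (p : {p : Fin 2 → ℤ // p ≠ 0}) :
    p.1 0 ≠ 0 ∨ p.1 1 ≠ 0 := by
  by_contra h
  push Not at h
  exact p.2 (by ext l; fin_cases l <;> simp [h])

theorem ping_pong_lower {x y : ℤ} (hne : x ≠ 0 ∨ y ≠ 0) (h : -(y * y) ≤ x * y → 0 ≤ x * y) :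
    0 ≤ x * (y + 2 * x) ∧ x * (y + 2 * x) < (y + 2 * x) * (y + 2 * x) := by
  by_cases hxy : 0 ≤ x * y
  · rcases hne with h0 | h0
    · have := mul_self_pos.2 h0
      constructor <;> nlinarith [mul_self_nonneg y]
    · have := mul_self_pos.2 h0
      constructor <;> nlinarith [mul_self_nonneg x]
  · have h1 : x * y < -(y * y) := by
      by_contra hc
      exact hxy (h (not_lt.1 hc))
    rcases lt_trichotomy y 0 with hy | hy | hy
    · have hx : 0 < x + y := by nlinarith
      constructor <;> nlinarith
    · simp [hy] at h1
    · have hx : x + y < 0 := by nlinarith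
      constructor <;> nlinarith

theorem ping_pong_lower_inv {x y : ℤ} (hne : x ≠ 0 ∨ y ≠ 0) (h : 0 ≤ x * y → y * y ≤ x * y) :
    -((y + -2 * x) * (y + -2 * x)) ≤ x * (y + -2 * x) ∧ x * (y + -2 * x) < 0 := by
  by_cases hxy : x * y < 0
  · constructor <;> nlinarith [mul_self_nonneg x, mul_self_nonneg y]
  · have h1 := h (not_lt.1 hxy)
    rcases lt_trichotomy y 0 with hy | hy | hy
    · have hx : x ≤ y := by nlinarith
      constructor <;> nlinarith
    · have hx : x ≠ 0 := by simpa [hy] using hne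
      have := mul_self_pos.2 hx
      constructor <;> nlinarith
    · have hx : y ≤ x := by nlinarith
      constructor <;> nlinarith

theorem sanov_injective : Function.Injective (FreeGroup.lift sanov) := by
  refine FreeGroup.injective_lift_of_ping_pong sanov (α := {p : Fin 2 → ℤ // p ≠ 0})
    ![{p | p.1 1 * p.1 1 ≤ p.1 0 * p.1 1},
      {p | 0 ≤ p.1 0 * p.1 1 ∧ p.1 0 * p.1 1 < p.1 1 * p.1 1}]
    ![{p | p.1 0 * p.1 1 < -(p.1 1 * p.1 1)},
      {p | -(p.1 1 * p.1 1) ≤ p.1 0 * p.1 1 ∧ p.1 0 * p.1 1 < 0}] ?_ ?_ ?_ ?_ ?_ ?_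
  · intro i
    fin_cases i
    · exact ⟨⟨![1, 1], fun h => by simpa using congrFun h 0⟩, by simp⟩
    · exact ⟨⟨![0, 1], fun h => by simpa using congrFun h 1⟩, by simp⟩
  · intro i j hij
    refine Set.disjoint_left.2 fun p hp hq => ?_
    fin_cases i <;> fin_cases j <;> simp at hij hp hq <;> omega
  · intro i j hij
    refine Set.disjoint_left.2 fun p hp hq => ?_
    fin_cases i <;> fin_cases j <;> simp at hij hp hq <;> omega
  · intro i j
    refine Set.disjoint_left.2 fun p hp hq => ?_
    have := mul_self_nonneg (p.1 1)
    fin_cases i <;> fin_cases j <;> simp at hp hq <;> omega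
  · intro i
    rintro _ ⟨p, hp, rfl⟩
    have hne := ne_zero_or_ne_zero_of_nonzero p
    fin_cases i
    · simp only [Fin.zero_eta, Matrix.cons_val_zero, Set.mem_compl_iff, Set.mem_ofPred_eq,
        not_lt, sanov, elemGL_zero_one_smul, Matrix.cons_val_one] at hp ⊢
      linarith
    · simp only [Fin.mk_one, Matrix.cons_val_zero, Set.mem_compl_iff, Set.mem_ofPred_eq,
        not_and, not_lt, sanov, elemGL_one_zero_smul, Matrix.cons_val_one] at hp ⊢
      exact ping_pong_lower hne hp
  · intro i
    rintro _ ⟨p, hp, rfl⟩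
    have hne := ne_zero_or_ne_zero_of_nonzero p
    fin_cases i
    · simp only [Fin.zero_eta, Matrix.cons_val_zero, Set.mem_compl_iff, Set.mem_ofPred_eq,
        not_le, sanov, Pi.inv_apply, elemGL_inv (zero_ne_one' (Fin 2)), elemGL_zero_one_smul,
        Matrix.cons_val_one] at hp ⊢
      linarith
    · simp only [Fin.mk_one, Matrix.cons_val_zero, Set.mem_compl_iff, Set.mem_ofPred_eq, not_and,
        not_lt, sanov, Pi.inv_apply, elemGL_inv (zero_ne_one' (Fin 2)).symm, elemGL_one_zero_smul,
        Matrix.cons_val_one] at hp ⊢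
      exact ping_pong_lower_inv hne hp

/-- Sanov's subgroup contains the level 4 congruence subgroup of `GL₂(ℤ)`. -/
theorem mem_range_sanov {g : GL (Fin 2) ℤ} (h00 : (4 : ℤ) ∣ g.1 0 0 - 1) (h01 : (2 : ℤ) ∣ g.1 0 1)
    (h10 : (2 : ℤ) ∣ g.1 1 0) (h11 : (4 : ℤ) ∣ g.1 1 1 - 1) :
    g ∈ (FreeGroup.lift sanov).range := by
  have h0 : elemGL 0 1 2 ∈ (FreeGroup.lift sanov).range := ⟨FreeGroup.of 0, by simp [sanov]⟩
  have h1 : elemGL 1 0 2 ∈ (FreeGroup.lift sanov).range := ⟨FreeGroup.of 1, by simp [sanov]⟩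
  have hA : ∀ c : ℤ, elemGL 0 1 (2 * c) ∈ (FreeGroup.lift sanov).range := by
    intro c
    have : elemGL (0 : Fin 2) 1 (2 * c) = elemGL 0 1 2 ^ c := by
      induction c using Int.induction_on with
      | zero => ext1; simp [elemGL_val]
      | succ n ih => rw [_root_.zpow_add_one, ← ih, elemGL_mul (by decide)]; congr 1
      | pred n ih =>
        rw [_root_.zpow_sub_one, ← ih, elemGL_inv (by decide), elemGL_mul (by decide)]; congr 1; ring
    rw [this]
    exact Subgroup.zpow_mem _ h0 c
  have hinv : ∀ c : ℤ, c = 2 ∨ c = -2 → elemGL 0 1 c ∈ (FreeGroup.lift sanov).range ∧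
      elemGL 1 0 c ∈ (FreeGroup.lift sanov).range := by
    rintro c (rfl | rfl)
    · exact ⟨h0, h1⟩
    · rw [← elemGL_inv (by decide), ← elemGL_inv (by decide)]
      exact ⟨inv_mem h0, inv_mem h1⟩
  induction hn : (g.1 0 0).natAbs + (g.1 1 0).natAbs using Nat.strong_induction_on
    generalizing g with
  | _ n ih =>
  subst hn
  by_cases hc : g.1 1 0 = 0
  · have hoff := sum_inv_mul g 0 0
    have hdet := sum_inv_mul g⁻¹ 1 1
    simp only [inv_inv, Fin.sum_univ_two, hc, mul_zero, add_zero, zero_mul, zero_add,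
      Matrix.one_apply_eq] at hoff hdet
    have u0 := Int.isUnit_iff.1 (IsUnit.of_mul_eq_one_right _ hoff)
    have u1 := Int.isUnit_iff.1 (IsUnit.of_mul_eq_one _ hdet)
    have e0 : g.1 0 0 = 1 := by omega
    have e1 : g.1 1 1 = 1 := by omega
    obtain ⟨b, hb⟩ := h01
    have : g = elemGL 0 1 (2 * b) := by
      ext1
      rw [elemGL_val (by decide)]
      ext i j
      fin_cases i <;> fin_cases j <;> simp [transvection, e0, e1, hc, hb]
    rw [this]
    exact hA b
  · rcases lt_or_ge (g.1 1 0).natAbs (g.1 0 0).natAbs with hlt | hge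
    · obtain ⟨c, hc2, hdec⟩ : ∃ c : ℤ, (c = 2 ∨ c = -2) ∧
          (g.1 0 0 + c * g.1 1 0).natAbs < (g.1 0 0).natAbs := by
        by_cases h : (g.1 0 0 + 2 * g.1 1 0).natAbs < (g.1 0 0).natAbs
        · exact ⟨2, Or.inl rfl, h⟩
        · exact ⟨-2, Or.inr rfl, by omega⟩
      rw [← Subgroup.mul_mem_cancel_left _ (hinv c hc2).1]
      refine ih _ ?_ ?_ ?_ ?_ ?_ rfl <;> simp only [elemGL_mul_apply (zero_ne_one' (Fin 2)),
        one_ne_zero, if_false, if_true, add_zero] <;> rcases hc2 with rfl | rfl <;> omega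
    · obtain ⟨c, hc2, hdec⟩ : ∃ c : ℤ, (c = 2 ∨ c = -2) ∧
          (g.1 1 0 + c * g.1 0 0).natAbs < (g.1 1 0).natAbs := by
        by_cases h : (g.1 1 0 + 2 * g.1 0 0).natAbs < (g.1 1 0).natAbs
        · exact ⟨2, Or.inl rfl, h⟩
        · exact ⟨-2, Or.inr rfl, by omega⟩
      rw [← Subgroup.mul_mem_cancel_left _ (hinv c hc2).2]
      refine ih _ ?_ ?_ ?_ ?_ ?_ rfl <;> simp only [elemGL_mul_apply (zero_ne_one' (Fin 2)).symm,
        zero_ne_one, if_false, if_true, add_zero] <;> rcases hc2 with rfl | rfl <;> omega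

/-- The homomorphism from Sanov's subgroup to `ℤ` counting the first generator. -/
theorem exists_sanov_hom : ∃ ψ : (FreeGroup.lift sanov).range →* Multiplicative ℤ,
    ∀ x : (FreeGroup.lift sanov).range, x.1 = elemGL 0 1 4 → ψ x ≠ 1 := by
  let e := MonoidHom.ofInjective sanov_injective
  refine ⟨(FreeGroup.lift ![Multiplicative.ofAdd 1, 1]).comp e.symm.toMonoidHom, ?_⟩
  intro x hx
  have : x = e (FreeGroup.of 0 ^ 2) := by
    refine Subtype.ext ?_
    rw [hx, MonoidHom.ofInjective_apply, map_pow]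
    simp [sanov, elemGL_pow]
  rw [this]
  simp only [MulEquiv.toMonoidHom_eq_coe, MonoidHom.coe_comp, MonoidHom.coe_coe,
    Function.comp_apply, MulEquiv.symm_apply_apply, map_pow, FreeGroup.lift_apply_of]
  decide

end Sanov

section Indicable

open Matrix

variable {ι : Type*} [Fintype ι] [DecidableEq ι] [Preorder ι]

/-- The restriction of a matrix supported on a preorder to an interval with two elements. -/
def intervalBlock {i j : ι} (hij : i ≤ j) (hne : i ≠ j) (h : ∀ l, i ≤ l → l ≤ j → l = i ∨ l = j) :
    incGL ι →* Matrix (Fin 2) (Fin 2) ℤ where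
  toFun g := g.1.1.submatrix ![i, j] ![i, j]
  map_one' := by
    ext a b
    fin_cases a <;> fin_cases b <;> simp [Matrix.one_apply, hne, hne.symm]
  map_mul' g g' := by
    have hi : ∀ a : Fin 2, i ≤ ![i, j] a ∧ ![i, j] a ≤ j := by
      intro a
      fin_cases a <;> simp [hij]
    ext a b
    have : ∀ l, l ≠ i ∧ l ≠ j → g.1.1 (![i, j] a) l * g'.1.1 l (![i, j] b) = 0 := by
      rintro l ⟨hl1, hl2⟩
      by_contra h0
      rcases h l ((hi a).1.trans (g.2.1 _ _ (left_ne_zero_of_mul h0)))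
        ((g'.2.1 _ _ (right_ne_zero_of_mul h0)).trans (hi b).2) with h | h
      · exact hl1 h
      · exact hl2 h
    rw [submatrix_apply, Subgroup.coe_mul, Units.val_mul, Matrix.mul_apply,
      Fintype.sum_eq_add i j hne this, Matrix.mul_apply, Fin.sum_univ_two]
    rfl

theorem virtuallyIndicable_of_interval {i j : ι} (hij : i ≤ j) (hne : i ≠ j)
    (h : ∀ l, i ≤ l → l ≤ j → l = i ∨ l = j) (H : Subgroup (GL ι ℤ)) (hH : elemGL i j 4 ∈ H)
    (hfin : ((incGL ι).subgroupOf H).FiniteIndex) : VirtuallyIndicable H := by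
  obtain ⟨ψ, hψ⟩ := exists_sanov_hom
  let K : Subgroup H := (incGL ι).subgroupOf H ⊓ (congGL ι 4).subgroupOf H
  let β : K →* GL (Fin 2) ℤ := (intervalBlock hij hne h).toHomUnits.comp
    ((H.subtype.comp K.subtype).codRestrict (incGL ι) fun x => x.2.1)
  have hβ : ∀ (x : K) (a b : Fin 2), (β x).1 a b = x.1.1.1 (![i, j] a) (![i, j] b) :=
    fun x a b => rfl
  have hmem : ∀ x, β x ∈ (FreeGroup.lift sanov).range := by
    intro x
    have hx : ∀ a b, (4 : ℤ) ∣ x.1.1.1 a b - (1 : Matrix ι ι ℤ) a b := mem_congGL.1 x.2.2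
    apply mem_range_sanov
    · simpa [hβ] using hx i i
    · have := hx i j
      rw [Matrix.one_apply_ne hne, sub_zero] at this
      rw [hβ]
      exact (by norm_num : (2 : ℤ) ∣ 4).trans this
    · have := hx j i
      rw [Matrix.one_apply_ne hne.symm, sub_zero] at this
      rw [hβ]
      exact (by norm_num : (2 : ℤ) ∣ 4).trans this
    · simpa [hβ] using hx j j
  have hc4 : elemGL i j 4 ∈ congGL ι 4 :=
    elemSubgroup_le_congGL 4 ∅ (elemGL_mem_elemSubgroup hij (by simp) (by simp) (by simp))
  refine virtuallyIndicable_of_hom_ne_one K (ψ.comp (β.codRestrict _ hmem))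
    ⟨⟨elemGL i j 4, hH⟩, elemGL_mem_incGL hij 4, hc4⟩ (hψ _ ?_)
  ext1
  ext a b
  change (elemGL i j 4).1 (![i, j] a) (![i, j] b) = _
  rw [elemGL_val hne, elemGL_val (by decide)]
  fin_cases a <;> fin_cases b <;> simp [transvection, hne, hne.symm]

end Indicable

section RaagMatrices

open Matrix

theorem gen_commute (Γ : SimpleGraph V) {u v : V} (h : Γ.Adj u v) :
    Commute (gen Γ u) (gen Γ v) := by
  have : (PresentedGroup.mk (Rels Γ)) (FreeGroup.of u * FreeGroup.of v * (FreeGroup.of u)⁻¹ *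
      (FreeGroup.of v)⁻¹) = 1 :=
    PresentedGroup.one_of_mem ⟨u, v, h, rfl⟩
  rw [map_mul, map_mul, map_mul, map_inv, map_inv, mul_inv_eq_one, mul_inv_eq_iff_eq_mul] at this
  exact this

/-- The homomorphism out of a right-angled Artin group determined by elements that commute along
edges. -/
def raagLift {Γ : SimpleGraph V} {G : Type*} [Group G] (f : V → G)
    (hf : ∀ u v, Γ.Adj u v → Commute (f u) (f v)) : Raag Γ →* G :=
  PresentedGroup.toGroup (f := f) (by
    rintro _ ⟨u, v, h, rfl⟩
    rw [map_mul, map_mul, map_mul, map_inv, map_inv, mul_inv_eq_one, mul_inv_eq_iff_eq_mul]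
    simpa using (hf u v h).eq)

theorem raagLift_gen {Γ : SimpleGraph V} {G : Type*} [Group G] (f : V → G)
    (hf : ∀ u v, Γ.Adj u v → Commute (f u) (f v)) (v : V) : raagLift f hf (gen Γ v) = f v :=
  PresentedGroup.toGroup.of _

theorem raag_hom_ext {Γ : SimpleGraph V} {G : Type*} [Group G] {φ ψ : Raag Γ →* G}
    (h : ∀ v, φ (gen Γ v) = ψ (gen Γ v)) : φ = ψ :=
  PresentedGroup.ext h

/-- The exponent-sum homomorphism. -/
def expHom (Γ : SimpleGraph V) : Raag Γ →* Multiplicative (V → ℤ) :=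
  raagLift (fun v => Multiplicative.ofAdd (Pi.single v 1)) fun _ _ _ => Commute.all _ _

theorem expHom_gen (Γ : SimpleGraph V) (v : V) :
    expHom Γ (gen Γ v) = Multiplicative.ofAdd (Pi.single v 1) := raagLift_gen _ _ v

/-- The exponent-sum homomorphism on the abelianization. -/
def abExp (Γ : SimpleGraph V) : Abelianization (Raag Γ) →* Multiplicative (V → ℤ) :=
  Abelianization.lift (expHom Γ)

theorem abExp_of (Γ : SimpleGraph V) (x : Raag Γ) :
    abExp Γ (Abelianization.of x) = expHom Γ x := Abelianization.lift_apply_of _ _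

theorem abExp_injective (Γ : SimpleGraph V) : Function.Injective (abExp Γ) := by
  let s : Multiplicative (V → ℤ) →* Abelianization (Raag Γ) :=
    { toFun := fun x => ∏ v, Abelianization.of (gen Γ v) ^ (x.toAdd v)
      map_one' := by simp
      map_mul' := fun x y => by
        rw [← Finset.prod_mul_distrib]
        exact Finset.prod_congr rfl fun v _ => zpow_add _ _ _ }
  have hs : s.comp (abExp Γ) = MonoidHom.id _ := by
    refine Abelianization.hom_ext _ _ (raag_hom_ext fun v => ?_)
    change ∏ w, Abelianization.of (gen Γ w) ^ ((abExp Γ (Abelianization.of (gen Γ v))).toAdd w) = _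
    rw [abExp_of, expHom_gen, Finset.prod_eq_single v]
    · simp
    · intro w _ hw
      simp [hw]
    · simp
  intro x y hxy
  have := congrArg s hxy
  rwa [← MonoidHom.comp_apply, ← MonoidHom.comp_apply, hs] at this

/-- The matrix of an endomorphism of the abelianization. -/
def abMatrix (Γ : SimpleGraph V) (β : Abelianization (Raag Γ) →* Abelianization (Raag Γ)) :
    Matrix V V ℤ :=
  Matrix.of fun w v => (abExp Γ (β (Abelianization.of (gen Γ v)))).toAdd w

theorem abExp_apply (Γ : SimpleGraph V) (β : Abelianization (Raag Γ) →* Abelianization (Raag Γ))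
    (x : Abelianization (Raag Γ)) :
    (abExp Γ (β x)).toAdd = abMatrix Γ β *ᵥ (abExp Γ x).toAdd := by
  have : (abExp Γ).comp β =
      (AddMonoidHom.toMultiplicative (abMatrix Γ β).mulVecLin.toAddMonoidHom).comp (abExp Γ) := by
    refine Abelianization.hom_ext _ _ (raag_hom_ext fun v => ?_)
    refine congrArg Multiplicative.ofAdd (?_ : _ = abMatrix Γ β *ᵥ
      (abExp Γ (Abelianization.of (gen Γ v))).toAdd)
    rw [abExp_of, expHom_gen, toAdd_ofAdd, mulVec_single_one]
    rfl
  exact congrArg Multiplicative.toAdd (DFunLike.congr_fun this x)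

/-- The matrix representation of the automorphism group of the abelianization. -/
def abGL (Γ : SimpleGraph V) : MulAut (Abelianization (Raag Γ)) →* GL V ℤ :=
  MonoidHom.toHomUnits
    { toFun := fun β => abMatrix Γ β.toMonoidHom
      map_one' := by
        ext w v
        change (abExp Γ (Abelianization.of (gen Γ v))).toAdd w = _
        rw [abExp_of, expHom_gen, toAdd_ofAdd, Matrix.one_apply, Pi.single_apply]
      map_mul' := fun β γ => by
        ext w v
        change (abExp Γ (β.toMonoidHom (γ (Abelianization.of (gen Γ v))))).toAdd w = _
        rw [abExp_apply]
        rfl }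

theorem abGL_apply (Γ : SimpleGraph V) (β : MulAut (Abelianization (Raag Γ))) (w v : V) :
    (abGL Γ β).1 w v = (abExp Γ (β (Abelianization.of (gen Γ v)))).toAdd w := rfl

theorem abGL_injective (Γ : SimpleGraph V) : Function.Injective (abGL Γ) := by
  intro β γ h
  have : β.toMonoidHom = γ.toMonoidHom := by
    refine Abelianization.hom_ext _ _ (raag_hom_ext fun v => abExp_injective Γ ?_)
    refine congrArg Multiplicative.ofAdd (funext fun w => ?_)
    exact congrArg (fun g : GL V ℤ => g.1 w v) h
  ext x
  exact DFunLike.congr_fun this x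

/-- The image of `Aut(A_Γ)` in `GL_V(ℤ)`. -/
def autGL (Γ : SimpleGraph V) : Subgroup (GL V ℤ) := (abAutHom Γ).range.map (abGL Γ)

theorem mem_autGL {Γ : SimpleGraph V} {g : GL V ℤ} :
    g ∈ autGL Γ ↔ ∃ α : MulAut (Raag Γ), ∀ w v, g.1 w v = (expHom Γ (α (gen Γ v))).toAdd w := by
  have key : ∀ (α : MulAut (Raag Γ)) (w v : V),
      (abGL Γ (abAutHom Γ α)).1 w v = (expHom Γ (α (gen Γ v))).toAdd w := by
    intro α w v
    rw [abGL_apply, ← abExp_of]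
    rfl
  constructor
  · rintro ⟨_, ⟨α, rfl⟩, rfl⟩
    exact ⟨α, key α⟩
  · rintro ⟨α, hα⟩
    refine ⟨_, ⟨α, rfl⟩, ?_⟩
    ext w v
    rw [hα, ← key]

/-- The image of `Aut(A_Γ)` in `Aut(A_Γ^{ab})` is isomorphic to its image in `GL_V(ℤ)`. -/
noncomputable def rangeEquivAutGL (Γ : SimpleGraph V) : (abAutHom Γ).range ≃* autGL Γ :=
  (abAutHom Γ).range.equivMapOfInjective (abGL Γ) (abGL_injective Γ)

/-- The endomorphism `v ↦ v w ^ c` for `v ≤ w`. -/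
def transvectionHom (Γ : SimpleGraph V) {v w : V} (h : Le Γ v w) (c : ℤ) : Raag Γ →* Raag Γ :=
  raagLift (fun z => if z = v then gen Γ v * gen Γ w ^ c else gen Γ z) (by
    have key : ∀ z, Γ.Adj v z → Commute (gen Γ v * gen Γ w ^ c) (gen Γ z) := by
      intro z hz
      refine (gen_commute Γ hz).mul_left (Commute.zpow_left ?_ c)
      rcases h hz with rfl | hw
      · exact Commute.refl _
      · exact gen_commute Γ hw
    intro a b hab
    by_cases ha : a = v
    · subst ha
      simpa [hab.ne'] using key b hab
    · by_cases hb : b = v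
      · subst hb
        simpa [ha] using (key a hab.symm).symm
      · simpa [ha, hb] using gen_commute Γ hab)

theorem transvectionHom_gen (Γ : SimpleGraph V) {v w : V} (h : Le Γ v w) (c : ℤ) (z : V) :
    transvectionHom Γ h c (gen Γ z) = if z = v then gen Γ v * gen Γ w ^ c else gen Γ z :=
  raagLift_gen _ _ z

theorem transvectionHom_comp_neg (Γ : SimpleGraph V) {v w : V} (h : Le Γ v w) (hvw : v ≠ w)
    (c : ℤ) : (transvectionHom Γ h c).comp (transvectionHom Γ h (-c)) = MonoidHom.id _ := by
  refine raag_hom_ext fun z => ?_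
  rw [MonoidHom.comp_apply, transvectionHom_gen]
  by_cases hz : z = v
  · subst hz
    simp [transvectionHom_gen, hvw.symm]
  · simp [transvectionHom_gen, hz]

theorem elemGL_mem_autGL (Γ : SimpleGraph V) {v w : V} (h : Le Γ v w) (hvw : v ≠ w) (c : ℤ) :
    elemGL w v c ∈ autGL Γ := by
  refine mem_autGL.2 ⟨(transvectionHom Γ h c).toMulEquiv (transvectionHom Γ h (-c)) ?_ ?_, ?_⟩
  · simpa using transvectionHom_comp_neg Γ h hvw (-c)
  · exact transvectionHom_comp_neg Γ h hvw c
  · intro a z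
    rw [elemGL_val hvw.symm, transvection, Matrix.add_apply, Matrix.one_apply, Matrix.single_apply]
    change _ = (expHom Γ (transvectionHom Γ h c (gen Γ z))).toAdd a
    rw [transvectionHom_gen]
    by_cases hz : z = v
    · subst hz
      simp [expHom_gen, Pi.single_apply, eq_comm]
    · simp [expHom_gen, Pi.single_apply, hz, Ne.symm hz]

/-- The integral Heisenberg group. -/
@[ext]
structure Heis where
  /-- The first coordinate. -/
  x : ℤ
  /-- The second coordinate. -/
  y : ℤ
  /-- The central coordinate. -/
  z : ℤ

instance : Mul Heis := ⟨fun p q => ⟨p.x + q.x, p.y + q.y, p.z + q.z + p.x * q.y⟩⟩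

instance : One Heis := ⟨⟨0, 0, 0⟩⟩

instance : Inv Heis := ⟨fun p => ⟨-p.x, -p.y, -p.z + p.x * p.y⟩⟩

theorem Heis.mul_def (p q : Heis) :
    p * q = ⟨p.x + q.x, p.y + q.y, p.z + q.z + p.x * q.y⟩ := rfl

theorem Heis.one_def : (1 : Heis) = ⟨0, 0, 0⟩ := rfl

theorem Heis.inv_def (p : Heis) : p⁻¹ = ⟨-p.x, -p.y, -p.z + p.x * p.y⟩ := rfl

instance : Group Heis :=
  Group.ofLeftAxioms (fun p q r => by ext <;> simp [Heis.mul_def] <;> ring)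
    (fun p => by ext <;> simp [Heis.mul_def, Heis.one_def])
    (fun p => by ext <;> simp [Heis.mul_def, Heis.one_def, Heis.inv_def])

theorem Heis.eq_of_commute {p q : Heis} (h : Commute p q) : p.x * q.y = q.x * p.y := by
  have := congrArg Heis.z h.eq
  simp only [Heis.mul_def] at this
  linarith

/-- The projection of the Heisenberg group to the plane. -/
def Heis.proj : Heis →* Multiplicative (ℤ × ℤ) where
  toFun p := Multiplicative.ofAdd (p.x, p.y)
  map_one' := rfl
  map_mul' _ _ := rfl

theorem expHom_mul_eq_of_commute {Γ : SimpleGraph V} {a b : V} (hab : a ≠ b) (h : ¬ Γ.Adj a b)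
    {p q : Raag Γ} (hpq : Commute p q) :
    (expHom Γ p).toAdd a * (expHom Γ q).toAdd b = (expHom Γ p).toAdd b * (expHom Γ q).toAdd a := by
  let f : V → Heis := fun v => if v = a then ⟨1, 0, 0⟩ else if v = b then ⟨0, 1, 0⟩ else 1
  have hf : ∀ u v, Γ.Adj u v → Commute (f u) (f v) := by
    have h1 : ∀ v, v ≠ a → v ≠ b → f v = 1 := fun v hva hvb => by simp [f, hva, hvb]
    intro u v huv
    by_cases hu : u = a ∨ u = b
    · have : f v = 1 := by
        rcases hu with rfl | rfl
        · exact h1 v huv.ne' fun e => h (e ▸ huv)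
        · exact h1 v (fun e => h (e ▸ huv.symm)) huv.ne'
      rw [this]
      exact Commute.one_right _
    · push Not at hu
      rw [h1 u hu.1 hu.2]
      exact Commute.one_left _
  let coord : Multiplicative (V → ℤ) →* Multiplicative (ℤ × ℤ) :=
    AddMonoidHom.toMultiplicative ((Pi.evalAddMonoidHom (fun _ => ℤ) a).prod
      (Pi.evalAddMonoidHom (fun _ => ℤ) b))
  have hcoord : Heis.proj.comp (raagLift f hf) = coord.comp (expHom Γ) := by
    refine raag_hom_ext fun v => ?_
    rw [MonoidHom.comp_apply, MonoidHom.comp_apply, raagLift_gen, expHom_gen]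
    refine congrArg Multiplicative.ofAdd (?_ : ((f v).x, (f v).y) =
      ((Pi.single v 1 : V → ℤ) a, (Pi.single v 1 : V → ℤ) b))
    by_cases hva : v = a
    · subst hva; simp [f, hab.symm]
    · by_cases hvb : v = b
      · subst hvb; simp [f, hva, Ne.symm hva]
      · simp [f, hva, hvb, Ne.symm hva, Ne.symm hvb, Heis.one_def]
  have hval : ∀ r : Raag Γ, ((raagLift f hf r).x, (raagLift f hf r).y) =
      ((expHom Γ r).toAdd a, (expHom Γ r).toAdd b) :=
    fun r => congrArg Multiplicative.toAdd (DFunLike.congr_fun hcoord r)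
  have hp := Prod.ext_iff.1 (hval p)
  have hq := Prod.ext_iff.1 (hval q)
  have := Heis.eq_of_commute (hpq.map (raagLift f hf))
  simp only at hp hq
  rw [hp.1, hp.2, hq.1, hq.2] at this
  rw [this, mul_comm]

theorem autGL_mul_eq {Γ : SimpleGraph V} {g : GL V ℤ} (hg : g ∈ autGL Γ) {u v a b : V}
    (huv : Γ.Adj u v) (hab : a ≠ b) (h : ¬ Γ.Adj a b) :
    g.1 a u * g.1 b v = g.1 b u * g.1 a v := by
  obtain ⟨α, hα⟩ := mem_autGL.1 hg
  rw [hα, hα, hα, hα]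
  exact expHom_mul_eq_of_commute hab h ((gen_commute Γ huv).map α.toMonoidHom)

/-- The skew-symmetric matrices supported on the edges of a graph. -/
def EdgeSkew (Γ : SimpleGraph V) (M : Matrix V V ℤ) : Prop :=
  Mᵀ = -M ∧ ∀ a b, ¬ Γ.Adj a b → M a b = 0

theorem EdgeSkew.conj {Γ : SimpleGraph V} {M : Matrix V V ℤ} (hM : EdgeSkew Γ M) {g : GL V ℤ}
    (hg : g ∈ autGL Γ) : EdgeSkew Γ (g.1 * M * g.1ᵀ) := by
  have hskew : (g.1 * M * g.1ᵀ)ᵀ = -(g.1 * M * g.1ᵀ) := by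
    rw [transpose_mul, transpose_mul, transpose_transpose, hM.1]
    simp [Matrix.mul_assoc]
  refine ⟨hskew, fun a b hab => ?_⟩
  have hsymm : (g.1 * M * g.1ᵀ) a b = (g.1 * M * g.1ᵀ) b a := by
    by_cases h : a = b
    · rw [h]
    simp only [Matrix.mul_apply, transpose_apply, Finset.sum_mul]
    refine Finset.sum_congr rfl fun v _ => Finset.sum_congr rfl fun u _ => ?_
    by_cases huv : Γ.Adj u v
    · linear_combination M u v * autGL_mul_eq hg huv h hab
    · simp [hM.2 u v huv]
  have h2 := congrFun (congrFun hskew b) a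
  rw [transpose_apply, Matrix.neg_apply, ← hsymm] at h2
  omega

/-- The matrices whose derivation action preserves the skew-symmetric matrices supported on the
edges. -/
def EdgeDer (Γ : SimpleGraph V) (X : Matrix V V ℤ) : Prop :=
  ∀ M, EdgeSkew Γ M → EdgeSkew Γ (X * M + M * Xᵀ)

theorem EdgeDer.conj {Γ : SimpleGraph V} {X : Matrix V V ℤ} (hX : EdgeDer Γ X) {g : GL V ℤ}
    (hg : g ∈ autGL Γ) : EdgeDer Γ (g.1 * X * (g⁻¹).1) := by
  intro M hM
  have h := (hX _ (hM.conj (inv_mem hg))).conj hg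
  have h1 : g.1 * (g⁻¹).1 = 1 := by rw [← Units.val_mul, mul_inv_cancel, Units.val_one]
  have h2 : (g⁻¹).1ᵀ * g.1ᵀ = 1 := by rw [← transpose_mul, h1, transpose_one]
  convert h using 1
  rw [transpose_mul, transpose_mul]
  calc g.1 * X * (g⁻¹).1 * M + M * ((g⁻¹).1ᵀ * (Xᵀ * g.1ᵀ))
      = g.1 * X * (g⁻¹).1 * M * ((g⁻¹).1ᵀ * g.1ᵀ) +
          (g.1 * (g⁻¹).1) * M * ((g⁻¹).1ᵀ * (Xᵀ * g.1ᵀ)) := by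
        rw [h1, h2, Matrix.mul_one, Matrix.one_mul]
    _ = _ := by simp only [Matrix.mul_add, Matrix.add_mul, Matrix.mul_assoc]

theorem EdgeDer.le {Γ : SimpleGraph V} {X : Matrix V V ℤ} (hX : EdgeDer Γ X) {w v : V}
    (h : X w v ≠ 0) : Le Γ v w := by
  intro u hu
  have huv : Γ.Adj v u := hu
  by_contra hst
  have hst' : u ≠ w ∧ ¬ Γ.Adj w u := by
    constructor
    · intro e
      exact hst (Or.inl e)
    · intro e
      exact hst (Or.inr e)
  have hM : EdgeSkew Γ (Matrix.single u v 1 - Matrix.single v u 1) := by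
    refine ⟨by simp, fun a b hab => ?_⟩
    rw [Matrix.sub_apply, Matrix.single_apply, Matrix.single_apply, if_neg, if_neg, sub_zero]
    · rintro ⟨rfl, rfl⟩
      exact hab huv
    · rintro ⟨rfl, rfl⟩
      exact hab huv.symm
  have h0 := (hX _ hM).2 w u hst'.2
  have hwv : v ≠ w := by
    rintro rfl
    exact hst'.2 huv
  rw [Matrix.add_apply, Matrix.mul_sub, Matrix.sub_mul, Matrix.sub_apply, Matrix.sub_apply] at h0
  simp [huv.ne', hst'.1.symm, hwv.symm] at h0
  exact h h0

theorem edgeDer_single {Γ : SimpleGraph V} {i w : V} (h : Le Γ i w) :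
    EdgeDer Γ (Matrix.single w i 1) := by
  intro M hM
  have hskew : ∀ a b, M a b = -M b a := fun a b => congrFun (congrFun hM.1 b) a
  refine ⟨?_, fun a b hab => ?_⟩
  · rw [transpose_add, transpose_mul, transpose_mul, hM.1, transpose_transpose]
    simp [add_comm]
  · have hcol : ∀ b, b ≠ w → ¬ Γ.Adj w b → M i b = 0 := by
      intro b hbw hwb
      refine hM.2 i b fun hib => ?_
      rcases h hib with h | h
      · exact hbw h
      · exact hwb h
    rw [Matrix.add_apply, transpose_single]
    by_cases ha : a = w
    · subst ha
      by_cases hb : b = a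
      · subst hb
        simp [hskew i b]
      · simp [hb, hcol b hb hab]
    · by_cases hb : b = w
      · subst hb
        simp [ha, hskew a i, hcol a ha fun e => hab e.symm]
      · simp [ha, hb]

theorem Le.refl (Γ : SimpleGraph V) (v : V) : Le Γ v v := fun _ hu => Or.inr hu

theorem Le.trans {Γ : SimpleGraph V} {u v w : V} (h₁ : Le Γ u v) (h₂ : Le Γ v w) : Le Γ u w := by
  intro x hx
  rcases h₁ hx with hxv | hxv
  · have huv : Γ.Adj u v := hxv ▸ hx
    rw [hxv]
    rcases h₂ (show u ∈ lk Γ v from huv.symm) with huw | hwu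
    · exact Or.inr (huw ▸ huv)
    · rcases h₁ (show w ∈ lk Γ u from SimpleGraph.Adj.symm hwu) with hwv | hvw
      · exact Or.inl hwv.symm
      · exact Or.inr (SimpleGraph.Adj.symm hvw)
  · exact h₂ hxv

/-- The vertices of a graph, preordered by reverse domination. -/
@[reducible]
def domPreorder (Γ : SimpleGraph V) : Preorder V where
  le i j := Le Γ j i
  le_refl := Le.refl Γ
  le_trans _ _ _ h₁ h₂ := h₂.trans h₁

/-- The vertices dominating some vertex in the support of the `v`-th column of `g`. -/
def dominatingSupport (Γ : SimpleGraph V) (g : GL V ℤ) (v : V) : Set V :=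
  {w | ∃ i, g.1 i v ≠ 0 ∧ Le Γ i w}

theorem le_of_inv_mul_apply_ne_zero {Γ : SimpleGraph V} {g h : GL V ℤ} (hg : g ∈ autGL Γ)
    (hgh : dominatingSupport Γ g = dominatingSupport Γ h) {k v : V}
    (hkv : (g⁻¹ * h).1 k v ≠ 0) : Le Γ v k := by
  rw [Units.val_mul, Matrix.mul_apply] at hkv
  obtain ⟨w, -, hw⟩ := Finset.exists_ne_zero_of_sum_ne_zero hkv
  have hwh : w ∈ dominatingSupport Γ h v := ⟨w, right_ne_zero_of_mul hw, Le.refl Γ w⟩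
  rw [← hgh] at hwh
  obtain ⟨i, hi, hiw⟩ := hwh
  refine ((edgeDer_single hiw).conj (inv_mem hg)).le ?_
  rw [inv_inv, Matrix.mul_assoc, Matrix.mul_apply, Finset.sum_eq_single w]
  · rw [Matrix.single_mul_apply_same, one_mul]
    exact mul_ne_zero (left_ne_zero_of_mul hw) hi
  · intro b _ hb
    rw [Matrix.single_mul_apply_of_ne _ _ _ _ _ hb, mul_zero]
  · simp

theorem finiteIndex_incGL_autGL (Γ : SimpleGraph V) :
    letI := domPreorder Γ
    ((incGL V).subgroupOf (autGL Γ)).FiniteIndex := by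
  let := domPreorder Γ
  refine finiteIndex_subgroupOf_of_finite_fibres (incGL V) (autGL Γ)
    (fun g => dominatingSupport Γ g.1) fun g h hgh => ⟨fun k v hkv => ?_, fun k v hkv => ?_⟩
  · exact le_of_inv_mul_apply_ne_zero g.2 hgh hkv
  · rw [_root_.mul_inv_rev, inv_inv] at hkv
    exact le_of_inv_mul_apply_ne_zero h.2 hgh.symm hkv

theorem elemSubgroup_le_autGL (Γ : SimpleGraph V) :
    letI := domPreorder Γ
    elemSubgroup (ι := V) 1 ∅ ≤ autGL Γ := by
  let := domPreorder Γ
  refine (Subgroup.closure_le _).2 ?_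
  rintro g ⟨i, j, c, hij, hle, -, -, -, rfl⟩
  exact elemGL_mem_autGL Γ hle hij.symm c

theorem not_virtuallyIndicable_autGL {Γ : SimpleGraph V} (hB : B2 Γ) :
    ¬ VirtuallyIndicable (autGL Γ) := by
  let := domPreorder Γ
  intro hVI
  have : ((elemSubgroup (ι := V) 1 ∅).subgroupOf (autGL Γ)).FiniteIndex :=
    ⟨Subgroup.relIndex_ne_zero_trans finiteIndex_elemSubgroup_incGL.index_ne_zero
      (finiteIndex_incGL_autGL Γ).index_ne_zero⟩
  refine not_virtuallyIndicable_elemSubgroup (ι := V) (fun i j hne hij => ?_)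
    ((hVI.subgroup _).of_mulEquiv (Subgroup.subgroupOfEquivOfLe (elemSubgroup_le_autGL Γ)))
  obtain ⟨k, hkj, hki, hjk, hki'⟩ := hB j i hne.symm hij
  exact ⟨k, hki, hkj, hki', hjk⟩

theorem virtuallyIndicable_autGL {Γ : SimpleGraph V} (hB : ¬ B2 Γ) :
    VirtuallyIndicable (autGL Γ) := by
  let := domPreorder Γ
  unfold B2 at hB
  push Not at hB
  obtain ⟨v, w, hvw, hle, h⟩ := hB
  refine virtuallyIndicable_of_interval (i := w) (j := v) hle hvw.symm (fun l hwl hlv => ?_)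
    (autGL Γ) (elemGL_mem_autGL Γ hle hvw 4) (finiteIndex_incGL_autGL Γ)
  by_contra! hl
  exact h l hl.2 hl.1 hlv hwl

end RaagMatrices

theorem B2_iff_image_of_Aut_not_virtually_indicable (Γ : SimpleGraph V) :
    B2 Γ ↔ ¬ ∃ K : Subgroup (abAutHom Γ).range, K.FiniteIndex ∧
      ∃ φ : K →* Multiplicative ℤ, Function.Surjective φ :=
  ⟨fun hB hVI => not_virtuallyIndicable_autGL hB
      (VirtuallyIndicable.of_mulEquiv (rangeEquivAutGL Γ) hVI),
    fun h => by_contra fun hB =>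
      h ((virtuallyIndicable_autGL hB).of_mulEquiv (rangeEquivAutGL Γ).symm)⟩

end RaagPaper
end

section
/- Let Γ be a finite simplicial graph satisfying property (NL). Then Aut(A_Γ) is not linear: for every field K and every n ≥ 1, there is no injective group homomorphism from Aut(A_Γ) into GL(n, K). -/
open SimpleGraph

open Module
open scoped commutatorElement

theorem Matrix.det_blockDiagonal_sigma {ι R : Type*} [Fintype ι] [DecidableEq ι] [CommRing R]
    {κ : ι → Type*} [∀ i, Fintype (κ i)] [∀ i, DecidableEq (κ i)]
    (M : ∀ i, Matrix (κ i) (κ i) R) :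
    (Matrix.blockDiagonal' M).det = ∏ i, (M i).det := by
  classical
  let _ : LinearOrder ι := LinearOrder.lift' (Fintype.equivFin ι) (Fintype.equivFin ι).injective
  have h : (Matrix.blockDiagonal' M).BlockTriangular Sigma.fst := by
    rintro ⟨i, x⟩ ⟨j, y⟩ hij
    exact Matrix.blockDiagonal'_apply_ne M x y (ne_of_gt hij)
  rw [Matrix.BlockTriangular.det_fintype h]
  refine Finset.prod_congr rfl fun i _ => ?_
  let e : κ i ≃ {x : Σ i, κ i // x.1 = i} :=
    { toFun := fun x => ⟨⟨i, x⟩, rfl⟩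
      invFun := fun x => cast (congrArg κ x.2) x.1.2
      left_inv := fun x => rfl
      right_inv := by rintro ⟨⟨j, x⟩, rfl⟩; rfl }
  rw [← Matrix.det_submatrix_equiv_self e]
  congr 1
  ext x y
  simp [e, Matrix.toSquareBlock, Matrix.toSquareBlockProp]

theorem LinearMap.charpoly_eq_prod_restrict {ι K V : Type*} [Fintype ι] [DecidableEq ι] [Field K]
    [AddCommGroup V] [Module K V] [FiniteDimensional K V] {N : ι → Submodule K V}
    (hN : DirectSum.IsInternal N) {f : End K V} (hf : ∀ i, Set.MapsTo f (N i) (N i)) :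
    f.charpoly = ∏ i, LinearMap.charpoly (f.restrict (hf i)) := by
  classical
  let b : ∀ i, Basis (Fin (finrank K (N i))) K (N i) := fun i => finBasis K (N i)
  rw [← LinearMap.charpoly_toMatrix f (hN.collectedBasis b),
    LinearMap.toMatrix_directSum_collectedBasis_eq_blockDiagonal' hN hN b b hf]
  have : (Matrix.blockDiagonal' fun i => LinearMap.toMatrix (b i) (b i) (f.restrict (hf i))).charmatrix
      = Matrix.blockDiagonal' fun i =>
        (LinearMap.toMatrix (b i) (b i) (f.restrict (hf i))).charmatrix := by
    ext ⟨i, x⟩ ⟨j, y⟩ : 1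
    by_cases hij : i = j
    · subst hij
      by_cases hxy : x = y
      · subst hxy; simp
      · simp [hxy]
    · rw [Matrix.blockDiagonal'_apply_ne _ _ _ hij, Matrix.charmatrix_apply_ne _ _ _ (by simp [hij]),
        Matrix.blockDiagonal'_apply_ne _ _ _ hij]
      simp
  rw [Matrix.charpoly, this, Matrix.det_blockDiagonal_sigma]
  refine Finset.prod_congr rfl fun i _ => ?_
  rw [← LinearMap.charpoly_toMatrix _ (b i), Matrix.charpoly]

section
variable {K V : Type*} [Field K] [AddCommGroup V] [Module K V]

theorem Module.End.mem_maxGenEigenspace_mul {a b : End K V} (hab : Commute a b) {α μ : K}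
    (hb : IsNilpotent (b - μ • 1)) {x : V} (hx : x ∈ a.maxGenEigenspace α) :
    x ∈ (a * b).maxGenEigenspace (α * μ) := by
  rw [End.mem_maxGenEigenspace] at hx ⊢
  obtain ⟨k, hk⟩ := hx
  obtain ⟨l, hl⟩ := hb
  have h1 : a * b - (α * μ) • 1 = b * (a - α • 1) + α • (b - μ • 1) := by
    simp only [mul_sub, smul_sub, hab.eq, smul_smul, mul_smul_comm, mul_one]; abel
  have hc : Commute (b * (a - α • 1)) (α • (b - μ • 1)) := by
    have h0 : Commute a (b - μ • 1) :=
      hab.sub_right ((Commute.one_right a).smul_right μ)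
    have h2 : Commute (a - α • 1) (b - μ • 1) :=
      h0.sub_left ((Commute.one_left _).smul_left α)
    have h3 : Commute b (b - μ • 1) :=
      (Commute.refl b).sub_right ((Commute.one_right b).smul_right μ)
    exact (h3.mul_left h2).smul_right α
  have hba : Commute b (a - α • 1) :=
    hab.symm.sub_right ((Commute.one_right b).smul_right α)
  refine ⟨k + l, ?_⟩
  rw [h1, hc.add_pow, LinearMap.sum_apply]
  refine Finset.sum_eq_zero fun i hi => ?_
  rcases le_or_gt k i with h | h
  · have hcc : Commute ((b * (a - α • 1)) ^ i)
        ((α • (b - μ • 1)) ^ (k + l - i) * ((k + l).choose i : End K V)) :=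
      (hc.pow_pow _ _).mul_right (Nat.commute_cast _ _)
    have hz : ((b * (a - α • 1)) ^ i) x = 0 := by
      rw [hba.mul_pow, ← Nat.sub_add_cancel h, pow_add (a - α • 1), Module.End.mul_apply,
        Module.End.mul_apply, hk, map_zero, map_zero]
    rw [mul_assoc, hcc.eq, Module.End.mul_apply, hz, map_zero]
  · have : (b - μ • 1) ^ (k + l - i) = 0 := by
      rw [show k + l - i = l + (k - i) by omega, pow_add, hl, zero_mul]
    rw [smul_pow, this]; simp

theorem Module.End.maxGenEigenspace_mul_eq {a b : End K V} (hab : Commute a b)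
    (hb' : IsUnit b) {μ : K} (hμ : μ ≠ 0) (hb : IsNilpotent (b - μ • 1)) (α : K) :
    (a * b).maxGenEigenspace (α * μ) = a.maxGenEigenspace α := by
  refine le_antisymm (fun x hx => ?_) fun x hx => End.mem_maxGenEigenspace_mul hab hb hx
  obtain ⟨u, rfl⟩ := hb'
  have hu : Commute ((u : End K V) - μ • 1) ((u⁻¹ : (End K V)ˣ) : End K V) :=
    (Commute.units_val (Commute.refl u).inv_right).sub_left ((Commute.one_left _).smul_left μ)
  have h1 : IsNilpotent (((u⁻¹ : (End K V)ˣ) : End K V) - μ⁻¹ • 1) := by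
    have : ((u⁻¹ : (End K V)ˣ) : End K V) - μ⁻¹ • 1
        = (-μ⁻¹) • (((u : End K V) - μ • 1) * ((u⁻¹ : (End K V)ˣ) : End K V)) := by
      simp [sub_mul, smul_sub, smul_smul, hμ, neg_add_eq_sub]
    rw [this]
    exact (hu.isNilpotent_mul_right hb).smul _
  have h2 : Commute (a * u) ((u⁻¹ : (End K V)ˣ) : End K V) :=
    (hab.units_inv_right).mul_left (Commute.units_val (Commute.refl u).inv_right)
  have := End.mem_maxGenEigenspace_mul h2 h1 hx
  simpa [mul_assoc, hμ] using this

theorem LinearMap.roots_charpoly_mul [FiniteDimensional K V] {a b : End K V} (hab : Commute a b)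
    (hb' : IsUnit b) {μ : K} (hμ : μ ≠ 0) (hb : IsNilpotent (b - μ • 1)) :
    (LinearMap.charpoly (a * b)).roots = a.charpoly.roots.map (· * μ) := by
  classical
  ext ν
  obtain ⟨α, rfl⟩ : ∃ α, ν = α * μ := ⟨ν / μ, by field_simp⟩
  rw [Multiset.count_map_eq_count' (· * μ) _ (mul_left_injective₀ hμ), Polynomial.count_roots,
    Polynomial.count_roots, ← LinearMap.finrank_maxGenEigenspace_eq,
    ← LinearMap.finrank_maxGenEigenspace_eq, End.maxGenEigenspace_mul_eq hab hb' hμ hb]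

end

theorem exists_hom_rat_ne_zero {M : Type*} [CommGroup M] {a : M} (ha : ¬ IsOfFinOrder a) :
    ∃ l : Additive M →+ ℚ, l (Additive.ofMul a) ≠ 0 := by
  have hinj : Function.Injective (zmultiplesHom (Additive M) (Additive.ofMul a)) := by
    intro m n hmn
    have : a ^ m = a ^ n := by simpa [← ofMul_zpow] using hmn
    exact injective_zpow_iff_not_isOfFinOrder.mpr ha this
  obtain ⟨l, hl⟩ := (Module.Baer.of_divisible ℚ).extension_property_addMonoidHom _ hinj
    (Int.castAddHom ℚ)
  refine ⟨l, ?_⟩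
  have := DFunLike.congr_fun hl 1
  simp at this
  simp [this]

theorem exists_mul_additive_ne_zero {K : Type*} [Field K] {a : K} (ha0 : a ≠ 0)
    (ha : ¬ IsOfFinOrder a) :
    ∃ l : K → ℚ, (∀ x y, x ≠ 0 → y ≠ 0 → l (x * y) = l x + l y) ∧ l 1 = 0 ∧ l a ≠ 0 := by
  classical
  have h : ¬ IsOfFinOrder (Units.mk0 a ha0) := by
    rwa [← Units.isOfFinOrder_val]
  obtain ⟨l, hl⟩ := exists_hom_rat_ne_zero h
  refine ⟨fun x => if hx : x = 0 then 0 else l (Additive.ofMul (Units.mk0 x hx)), ?_, ?_, ?_⟩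
  · intro x y hx hy
    simp [hx, hy, Units.mk0_mul]
  · simp
  · simpa [ha0] using hl

theorem Multiset.sum_map_mul_additive {K : Type*} [Field K] {l : K → ℚ}
    (hl : ∀ x y, x ≠ 0 → y ≠ 0 → l (x * y) = l x + l y) (h1 : l 1 = 0) (s : Multiset K)
    (hs : ∀ x ∈ s, x ≠ 0) : (s.map l).sum = l s.prod := by
  induction s using Multiset.induction with
  | empty => simp [h1]
  | cons a s ih =>
    have hs' : ∀ x ∈ s, x ≠ 0 := fun x hx => hs x (Multiset.mem_cons_of_mem hx)
    rw [Multiset.map_cons, Multiset.sum_cons, Multiset.prod_cons, ih hs',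
      hl _ _ (hs a (Multiset.mem_cons_self a s)) (Multiset.prod_ne_zero fun h => hs' 0 h rfl)]

section
variable {K V : Type*} [Field K] [AddCommGroup V] [Module K V] [FiniteDimensional K V]

theorem LinearMap.ne_zero_of_mem_roots_charpoly {f : End K V} (hf : IsUnit f) {x : K}
    (hx : x ∈ f.charpoly.roots) : x ≠ 0 := by
  rintro rfl
  have h := (End.hasEigenvalue_iff_isRoot_charpoly f 0).mpr (Polynomial.isRoot_of_mem_roots hx)
  exact (End.hasEigenvalue_iff_mem_spectrum.mp h) (by simpa [spectrum.mem_resolventSet_iff] using hf)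

theorem Module.End.exists_isInternal_maxGenEigenspace [IsAlgClosed K] (b : End K V) :
    ∃ s : Finset K, (∀ μ ∈ s, b.HasEigenvalue μ) ∧
      ∀ _ : DecidableEq s, DirectSum.IsInternal fun μ : s => b.maxGenEigenspace μ := by
  classical
  refine ⟨b.charpoly.roots.toFinset, ?_, fun _ => ?_⟩
  · intro μ hμ
    exact (End.hasEigenvalue_iff_isRoot_charpoly b μ).mpr
      (Polynomial.isRoot_of_mem_roots (Multiset.mem_toFinset.mp hμ))
  · refine DirectSum.isInternal_submodule_of_iSupIndep_of_iSup_eq_top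
      ((End.independent_maxGenEigenspace b).comp Subtype.val_injective) ?_
    rw [eq_top_iff, ← End.iSup_maxGenEigenspace_eq_top b]
    refine iSup_le fun μ => ?_
    by_cases hμ : μ ∈ b.charpoly.roots.toFinset
    · exact le_iSup (fun μ : b.charpoly.roots.toFinset => b.maxGenEigenspace μ) ⟨μ, hμ⟩
    · have : b.maxGenEigenspace μ = ⊥ := by
        rw [← Submodule.finrank_eq_zero, LinearMap.finrank_maxGenEigenspace_eq,
          ← Polynomial.count_roots, Multiset.count_eq_zero]
        simpa using hμ
      rw [this]; exact bot_le

theorem LinearMap.isUnit_restrict {f : End K V} (hf : IsUnit f) {p : Submodule K V}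
    (hp : Set.MapsTo f p p) : IsUnit (f.restrict hp : End K p) := by
  have hinj : Function.Injective f := ((End.isUnit_iff f).mp hf).injective
  rw [LinearMap.isUnit_iff_ker_eq_bot, LinearMap.ker_eq_bot]
  intro x y hxy
  exact Subtype.ext (hinj (congrArg Subtype.val hxy))

/-- The multiset of eigenvalues of a product of commuting automorphisms `a` and `b`, computed on the
generalized eigenspaces of `b`. -/
theorem LinearMap.sum_map_roots_charpoly_mul {b : End K V} (hb : IsUnit b) {s : Finset K}
    [DecidableEq s] (hs : ∀ μ ∈ s, μ ≠ 0)
    (hN : DirectSum.IsInternal fun μ : s => b.maxGenEigenspace μ) {a : End K V}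
    (hab : Commute b a) (F : K → ℚ) :
    ((LinearMap.charpoly (a * b)).roots.map F).sum = ∑ μ : s,
      ((LinearMap.charpoly (a.restrict (End.mapsTo_maxGenEigenspace_of_comm hab μ))).roots.map
        fun α => F (α * μ)).sum := by
  have hb1 : ∀ μ, Set.MapsTo b (b.maxGenEigenspace μ) (b.maxGenEigenspace μ) :=
    End.mapsTo_maxGenEigenspace_of_comm (Commute.refl b)
  have hab1 : ∀ μ : s, Set.MapsTo (a * b) (b.maxGenEigenspace μ) (b.maxGenEigenspace (μ : K)) :=
    fun μ => (End.mapsTo_maxGenEigenspace_of_comm hab μ).comp (hb1 μ)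
  rw [LinearMap.charpoly_eq_prod_restrict hN hab1,
    Polynomial.roots_prod _ _ (Finset.prod_ne_zero_iff.mpr
      fun i _ => (LinearMap.charpoly_monic _).ne_zero), Multiset.map_bind, Multiset.sum_bind]
  refine Finset.sum_congr rfl fun μ _ => ?_
  have hμ := hs μ μ.2
  have hnil := End.isNilpotent_restrict_maxGenEigenspace_sub_algebraMap b (μ : K)
  have hnil' : IsNilpotent ((b.restrict (hb1 μ) : End K (b.maxGenEigenspace (μ : K))) - (μ : K) • 1) := by
    convert hnil using 1
    ext x
    rfl
  have hc : Commute (a.restrict (End.mapsTo_maxGenEigenspace_of_comm hab μ) :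
      End K (b.maxGenEigenspace (μ : K))) (b.restrict (hb1 μ)) := by
    ext x
    exact DFunLike.congr_fun hab.symm.eq (x : V)
  have := LinearMap.roots_charpoly_mul hc (LinearMap.isUnit_restrict hb (hb1 μ)) hμ hnil'
  have h2 : ((a * b).restrict (hab1 μ) : End K (b.maxGenEigenspace (μ : K)))
     = (a.restrict (End.mapsTo_maxGenEigenspace_of_comm hab μ) :
      End K (b.maxGenEigenspace (μ : K))) * (b.restrict (hb1 μ)) := rfl
  rw [h2, this, Multiset.map_map]
  rfl

/-- If `t` conjugates `b` to `A g * b`, where `b` commutes with the image of the representation `A`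
and `g` is a product of commutators, then the eigenvalues of `A g` are roots of unity. -/
theorem isOfFinOrder_eigenvalue_of_conj [IsAlgClosed K] {G : Type*} [Group G] (A : G →* End K V)
    {b t : (End K V)ˣ} (hb : ∀ x, Commute (b : End K V) (A x)) {g : G} (hg : g ∈ commutator G)
    (ht : ((t * b * t⁻¹ : (End K V)ˣ) : End K V) = A g * b) {α : K}
    (hα : (A g).HasEigenvalue α) : IsOfFinOrder α := by
  classical
  have hA : ∀ x, IsUnit (A x) := fun x => (Group.isUnit x).map A
  obtain ⟨s, hs, hN⟩ := End.exists_isInternal_maxGenEigenspace (b : End K V)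
  have hN := hN inferInstance
  have hroots : ∀ {μ}, (b : End K V).HasEigenvalue μ → μ ≠ 0 := by
    intro μ hμ
    refine LinearMap.ne_zero_of_mem_roots_charpoly b.isUnit ?_
    rw [Polynomial.mem_roots (LinearMap.charpoly_monic _).ne_zero]
    exact (End.hasEigenvalue_iff_isRoot_charpoly _ _).mp hμ
  have hs0 : ∀ μ ∈ s, μ ≠ 0 := fun μ hμ => hroots (hs μ hμ)
  have hmap : ∀ (x : G) (μ : K), Set.MapsTo (A x) ((b : End K V).maxGenEigenspace μ)
      ((b : End K V).maxGenEigenspace μ) := fun x => End.mapsTo_maxGenEigenspace_of_comm (hb x)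
  let R : s → Multiset K := fun μ => (LinearMap.charpoly ((A g).restrict (hmap g μ))).roots
  have hR0 : ∀ μ, ∀ x ∈ R μ, x ≠ 0 := fun μ x hx =>
    LinearMap.ne_zero_of_mem_roots_charpoly (LinearMap.isUnit_restrict (hA g) (hmap g μ)) hx
  have hR1 : ∀ μ, (R μ).prod = 1 := by
    intro μ
    let D : G →* K :=
      { toFun := fun x => LinearMap.det ((A x).restrict (hmap x μ))
        map_one' := by
          have : ((A 1).restrict (hmap 1 μ) : End K ((b : End K V).maxGenEigenspace (μ : K))) = 1 := by
            ext x; simp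
          rw [this, map_one]
        map_mul' := fun x y => by
          have : ((A (x * y)).restrict (hmap (x * y) μ) :
              End K ((b : End K V).maxGenEigenspace (μ : K)))
              = (A x).restrict (hmap x μ) * (A y).restrict (hmap y μ) := by
            ext z; simp; rfl
          rw [this, map_mul] }
    have h1 : D.toHomUnits g = 1 := Abelianization.commutator_subset_ker D.toHomUnits hg
    have h2 : D g = 1 := by
      rw [← MonoidHom.coe_toHomUnits, h1, Units.val_one]
    rw [← h2]
    exact (End.det_eq_prod_roots_charpoly_of_splits (IsAlgClosed.splits _)).symm
  obtain ⟨μ, hμ⟩ : ∃ μ, α ∈ R μ := by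
    have := (End.hasEigenvalue_iff_isRoot_charpoly _ _).mp hα
    rw [LinearMap.charpoly_eq_prod_restrict hN (f := A g) fun μ => hmap g μ,
      Polynomial.isRoot_prod] at this
    obtain ⟨μ, -, h⟩ := this
    exact ⟨μ, (Polynomial.mem_roots (LinearMap.charpoly_monic _).ne_zero).mpr h⟩
  by_contra hfin
  obtain ⟨l, hl, hl1, hlα⟩ := exists_mul_additive_ne_zero (hR0 μ α hμ) hfin
  have e1 := LinearMap.sum_map_roots_charpoly_mul b.isUnit hs0 hN (hb g) fun x => l x ^ 2
  have e2 := LinearMap.sum_map_roots_charpoly_mul b.isUnit hs0 hN (hb 1) fun x => l x ^ 2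
  have hconj : LinearMap.charpoly (A g * (b : End K V)) =
      LinearMap.charpoly (A 1 * (b : End K V)) := by
    rw [← ht, map_one, one_mul,
      ← LinearEquiv.charpoly_conj (LinearMap.GeneralLinearGroup.toLinearEquiv t) (b : End K V)]
    rfl
  rw [← hconj, e1] at e2
  have hsq : ∀ ν : s, ((R ν).map fun x => l (x * ν) ^ 2).sum
      = ((R ν).map fun x => l x ^ 2).sum + Multiset.card (R ν) * l ν ^ 2 := by
    intro ν
    have h0 : ((R ν).map l).sum = 0 := by
      rw [Multiset.sum_map_mul_additive hl hl1 _ (hR0 ν), hR1, hl1]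
    have h1 : ((R ν).map fun x => l (x * ν) ^ 2)
        = (R ν).map fun x => (l x ^ 2 + l ν ^ 2) + 2 * l ν * l x :=
      Multiset.map_congr rfl fun x hx => by
        rw [hl x ν (hR0 ν x hx) (hs0 ν ν.2)]; ring
    rw [h1, Multiset.sum_map_add, Multiset.sum_map_add, Multiset.sum_map_mul_left, h0]
    simp
  have hid : ∀ ν : s,
      ((LinearMap.charpoly ((A 1).restrict (hmap 1 ν))).roots.map fun x => l (x * ν) ^ 2).sum
      = Multiset.card (R ν) * l ν ^ 2 := by
    intro ν
    have h1 : ((A 1).restrict (hmap 1 ν) : End K ((b : End K V).maxGenEigenspace (ν : K))) = 1 := by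
      ext x; simp
    have h2 : Multiset.card (R ν) = finrank K ((b : End K V).maxGenEigenspace (ν : K)) := by
      rw [← LinearMap.charpoly_natDegree ((A g).restrict (hmap g ν))]
      exact (IsAlgClosed.splits _).natDegree_eq_card_roots.symm
    rw [h1, LinearMap.charpoly_one, h2, ← Polynomial.C_1, Polynomial.roots_pow,
      Polynomial.roots_X_sub_C, Multiset.map_nsmul,
      Multiset.sum_nsmul]
    simp
  have hsum : ∑ ν : s, ((R ν).map fun x => l x ^ 2).sum = 0 := by
    have e3 : ∑ ν : s, ((R ν).map fun x => l (x * ν) ^ 2).sum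
        = ∑ ν : s, (Multiset.card (R ν) * l ν ^ 2 : ℚ) :=
      e2.trans (Finset.sum_congr rfl fun ν _ => hid ν)
    simp only [hsq, Finset.sum_add_distrib] at e3
    linarith
  have hnn : ∀ ν : s, ∀ x ∈ (R ν).map fun x => l x ^ 2, (0 : ℚ) ≤ x := by
    intro ν x hx
    obtain ⟨y, -, rfl⟩ := Multiset.mem_map.mp hx
    positivity
  have h0 := (Finset.sum_eq_zero_iff_of_nonneg fun ν _ => Multiset.sum_nonneg (hnn ν)).mp hsum μ
    (Finset.mem_univ _)
  have := Multiset.single_le_sum (hnn μ) _ (Multiset.mem_map_of_mem (fun x => l x ^ 2) hμ)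
  rw [h0] at this
  exact hlα (pow_eq_zero_iff two_ne_zero |>.mp (le_antisymm this (sq_nonneg _)))
end

section
variable {K V : Type*} [Field K] [AddCommGroup V] [Module K V] [FiniteDimensional K V]

theorem Module.End.isNilpotent_pow_sub_one_of_eigenvalues [IsAlgClosed K] {f : End K V} {N : ℕ}
    (h : ∀ μ, f.HasEigenvalue μ → μ ^ N = 1) : IsNilpotent (f ^ N - 1) := by
  classical
  have hdvd : f.charpoly ∣ (Polynomial.X ^ N - 1) ^ Multiset.card f.charpoly.roots := by
    conv_lhs => rw [(IsAlgClosed.splits f.charpoly).eq_prod_roots_of_monic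
      (LinearMap.charpoly_monic f)]
    have : (Polynomial.X ^ N - 1 : Polynomial K) ^ Multiset.card f.charpoly.roots
        = (f.charpoly.roots.map fun _ => (Polynomial.X ^ N - 1 : Polynomial K)).prod := by simp
    rw [this]
    refine Multiset.prod_dvd_prod_of_dvd _ _ fun a ha => ?_
    rw [Polynomial.dvd_iff_isRoot]
    have := h a ((End.hasEigenvalue_iff_isRoot_charpoly f a).mpr (Polynomial.isRoot_of_mem_roots ha))
    simp [this]
  refine ⟨Multiset.card f.charpoly.roots, ?_⟩
  have h2 := Polynomial.aeval_eq_zero_of_dvd_aeval_eq_zero hdvd (LinearMap.aeval_self_charpoly f)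
  simpa using h2

theorem Module.End.exists_isNilpotent_pow_sub_one [IsAlgClosed K] {f : End K V}
    (h : ∀ μ, f.HasEigenvalue μ → IsOfFinOrder μ) : ∃ N, 0 < N ∧ IsNilpotent (f ^ N - 1) := by
  classical
  refine ⟨∏ μ ∈ f.charpoly.roots.toFinset, orderOf μ, ?_,
    End.isNilpotent_pow_sub_one_of_eigenvalues fun μ hμ => ?_⟩
  · refine Finset.prod_pos fun μ hμ => (h μ ?_).orderOf_pos
    exact (End.hasEigenvalue_iff_isRoot_charpoly f μ).mpr
      (Polynomial.isRoot_of_mem_roots (Multiset.mem_toFinset.mp hμ))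
  · refine orderOf_dvd_iff_pow_eq_one.mp (Finset.dvd_prod_of_mem _ ?_)
    rw [Multiset.mem_toFinset, Polynomial.mem_roots (LinearMap.charpoly_monic f).ne_zero]
    exact (End.hasEigenvalue_iff_isRoot_charpoly f μ).mp hμ

end

theorem exists_pow_eq_one_of_isNilpotent_sub_one {R : Type*} [Ring R] (p : ℕ) [Fact p.Prime]
    [CharP R p] {a : R} (h : IsNilpotent (a - 1)) : ∃ k, a ^ p ^ k = 1 := by
  obtain ⟨n, hn⟩ := h
  refine ⟨n, ?_⟩
  have : (a - 1) ^ p ^ n = 0 :=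
    pow_eq_zero_of_le (Nat.lt_pow_self (Fact.out : p.Prime).one_lt).le hn
  rw [sub_pow_char_pow_of_commute _ _ (Commute.one_right a), one_pow, sub_eq_zero] at this
  exact this

theorem Int.isJacobsonRing : IsJacobsonRing ℤ := by
  refine isJacobsonRing_iff_prime_eq.mpr fun P hP => ?_
  rcases eq_or_ne P ⊥ with rfl | hne
  · refine le_antisymm (fun x hx => ?_) Ideal.le_jacobson
    rw [Ideal.mem_jacobson_bot] at hx
    rw [Ideal.mem_bot]
    rcases Int.isUnit_iff.mp (hx x) with h | h
    · simpa using h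
    · nlinarith
  · have := hP.isMaximal hne
    exact Ideal.jacobson_eq_self_of_isMaximal

theorem exists_valuationSubring_residue_char {K : Type*} [Field K] [CharZero K] (s : Finset K) :
    ∃ (O : ValuationSubring K) (p : ℕ), p.Prime ∧ (∀ x ∈ s, x ∈ O) ∧
      (p : K) ∈ O.nonunits := by
  let R : Subalgebra ℤ K := Algebra.adjoin ℤ (s : Set K)
  have : Algebra.FiniteType ℤ R := (Subalgebra.fg_iff_finiteType _).mp ⟨s, rfl⟩
  obtain ⟨m, hm⟩ := Ideal.exists_maximal R
  let _ : Field (R ⧸ m) := Ideal.Quotient.field m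
  have hft : Algebra.FiniteType ℤ (R ⧸ m) := inferInstance
  have := Int.isJacobsonRing
  have hfin : Module.Finite ℤ (R ⧸ m) := finite_of_finite_type_of_isJacobsonRing ℤ (R ⧸ m)
  obtain ⟨p, hp⟩ := CharP.exists (R ⧸ m)
  have hp0 : p ≠ 0 := by
    rintro rfl
    have : CharZero (R ⧸ m) := CharP.charP_to_charZero _
    have := isField_of_isIntegral_of_isField (R := ℤ) (S := R ⧸ m)
      (algebraMap ℤ (R ⧸ m)).injective_int
      (Field.toIsField _)
    exact Int.not_isField this
  have hpp : p.Prime := (CharP.char_is_prime_or_zero (R ⧸ m) p).resolve_right hp0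
  obtain ⟨O, hO, hmO⟩ := Ideal.image_subset_nonunits_valuationSubring (A := R.toSubring) m hm.ne_top
  refine ⟨O, p, hpp, fun x hx => hO (Algebra.subset_adjoin hx), hmO ⟨(p : R), ?_, by simp⟩⟩
  rw [SetLike.mem_coe]
  refine Ideal.Quotient.eq_zero_iff_mem.mp ?_
  simp

section
variable {K V : Type*} [Field K] [CharZero K] [AddCommGroup V] [Module K V] [FiniteDimensional K V]

theorem LinearMap.isNilpotent_of_trace_aeval_eq_zero {f : End K V}
    (h : ∀ p : Polynomial K, LinearMap.trace K V (f * Polynomial.aeval f p) = 0) :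
    IsNilpotent f := by
  have hm : minpoly K f ≠ 0 := minpoly.ne_zero (LinearMap.isIntegral f)
  obtain ⟨q, hq, hq0⟩ := Polynomial.exists_eq_pow_rootMultiplicity_mul_and_not_dvd (minpoly K f) hm 0
  set r := Polynomial.rootMultiplicity 0 (minpoly K f)
  rw [Polynomial.C_0, sub_zero] at hq hq0
  have hcop : IsCoprime ((Polynomial.X : Polynomial K) ^ (r + 1)) q :=
    ((Polynomial.irreducible_X.coprime_iff_not_dvd).mpr hq0).pow_left
  obtain ⟨u, w, huw⟩ := hcop
  have hz : Polynomial.aeval f (Polynomial.X ^ (r + 1) * q) = 0 := by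
    rw [pow_succ', mul_assoc, ← hq, map_mul, minpoly.aeval, mul_zero]
  have hide : IsIdempotentElem (Polynomial.aeval f (u * Polynomial.X ^ (r + 1))) := by
    have : u * Polynomial.X ^ (r + 1) * (u * Polynomial.X ^ (r + 1)) =
        u * Polynomial.X ^ (r + 1) - u * w * (Polynomial.X ^ (r + 1) * q) := by
      linear_combination u * Polynomial.X ^ (r + 1) * huw
    rw [IsIdempotentElem, ← map_mul, this, map_sub, map_mul _ (u * w), hz, mul_zero, sub_zero]
  have htr : LinearMap.trace K V (Polynomial.aeval f (u * Polynomial.X ^ (r + 1))) = 0 := by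
    rw [pow_succ', mul_left_comm, map_mul, Polynomial.aeval_X]
    exact h _
  have he0 := (IsIdempotentElem.trace_eq_zero_iff hide).mp htr
  refine ⟨r + 1, ?_⟩
  have : Polynomial.X ^ (r + 1) = Polynomial.X ^ (r + 1) * (u * Polynomial.X ^ (r + 1)) +
      w * (Polynomial.X ^ (r + 1) * q) := by
    linear_combination -Polynomial.X ^ (r + 1) * huw
  have h2 := congrArg (Polynomial.aeval f) this
  rwa [map_add, map_mul, he0, map_mul _ w, hz, mul_zero, mul_zero, add_zero,
    Polynomial.aeval_X_pow] at h2

attribute [local instance] LieRing.ofAssociativeRing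

/-- Kolchin's theorem: a group of unipotent automorphisms stabilizes a flag and acts trivially on
the successive quotients. -/
theorem exists_flag_of_unipotent {G : Type*} [Group G] (A : G →* End K V)
    (hA : ∀ x, IsNilpotent (A x - 1)) :
    ∃ (N : ℕ → Submodule K V) (m : ℕ), Antitone N ∧ N 0 = ⊤ ∧ N m = ⊥ ∧
      ∀ x k, ∀ v ∈ N k, (A x - 1) v ∈ N (k + 1) := by
  let I : Submodule K (End K V) := Submodule.span K (Set.range fun x => A x - 1)
  have hmul : ∀ {y z}, y ∈ I → z ∈ I → y * z ∈ I := by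
    intro y z hy hz
    have := Submodule.mul_mem_mul hy hz
    rw [Submodule.span_mul_span] at this
    refine Submodule.span_le.mpr ?_ this
    rintro _ ⟨_, ⟨x, rfl⟩, _, ⟨y, rfl⟩, rfl⟩
    have : (A x - 1) * (A y - 1) = (A (x * y) - 1) - (A x - 1) - (A y - 1) := by
      rw [map_mul]; noncomm_ring
    simp only [this]
    exact I.sub_mem (I.sub_mem (Submodule.subset_span ⟨_, rfl⟩) (Submodule.subset_span ⟨_, rfl⟩))
      (Submodule.subset_span ⟨_, rfl⟩)
  have htr : ∀ {y}, y ∈ I → LinearMap.trace K V y = 0 := by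
    intro y hy
    have : I ≤ LinearMap.ker (LinearMap.trace K V) := by
      refine Submodule.span_le.mpr ?_
      rintro _ ⟨x, rfl⟩
      exact (LinearMap.isNilpotent_trace_of_isNilpotent (hA x)).eq_zero
    exact this hy
  have hpow : ∀ {y}, y ∈ I → ∀ p : Polynomial K, y * Polynomial.aeval y p ∈ I := by
    intro y hy p
    induction p using Polynomial.induction_on' with
    | add p q hp hq => rw [map_add, mul_add]; exact I.add_mem hp hq
    | monomial n a =>
      rw [Polynomial.aeval_monomial, ← Algebra.smul_def, mul_smul_comm]
      refine I.smul_mem a ?_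
      induction n with
      | zero => simpa
      | succ n ih => rw [pow_succ, ← mul_assoc]; exact hmul ih hy
  let L : LieSubalgebra K (End K V) :=
    { I with
      lie_mem' := fun {y z} hy hz => by
        rw [Ring.lie_def]; exact I.sub_mem (hmul hy hz) (hmul hz hy) }
  have hnil : LieModule.IsNilpotent L V := by
    rw [LieModule.isNilpotent_iff_forall' (R := K)]
    rintro ⟨y, hy⟩
    exact LinearMap.isNilpotent_of_trace_aeval_eq_zero (f := y) fun p => htr (hpow hy p)
  obtain ⟨m, hm⟩ := (LieModule.isNilpotent_iff K L V).mp hnil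
  refine ⟨fun k => (LieModule.lowerCentralSeries K L V k).toSubmodule, m, ?_, ?_, ?_, ?_⟩
  · exact fun i j hij => LieModule.antitone_lowerCentralSeries K L V hij
  · simp
  · simp [hm]
  · intro x k v hv
    simp only [LieModule.lowerCentralSeries_succ]
    exact LieSubmodule.lie_mem_lie (x := (⟨A x - 1, Submodule.subset_span ⟨x, rfl⟩⟩ : L))
      (LieSubmodule.mem_top _) hv

end

/-- `c 0 = g`, `c (k + 1) = ⁅c k, h⁆`. -/
def iteratedCommutator {G : Type*} [Group G] (g h : G) : ℕ → G
  | 0 => g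
  | k + 1 => ⁅iteratedCommutator g h k, h⁆

theorem map_iteratedCommutator {G H : Type*} [Group G] [Group H] (f : G →* H) (g h : G) (k : ℕ) :
    f (iteratedCommutator g h k) = iteratedCommutator (f g) (f h) k := by
  induction k with
  | zero => rfl
  | succ k ih => simp only [iteratedCommutator, map_commutatorElement, ih]

theorem exists_iteratedCommutator_eq_one_of_unipotent {K V : Type*} [Field K] [CharZero K]
    [AddCommGroup V] [Module K V] [FiniteDimensional K V] {G : Type*} [Group G] (A : G →* End K V)
    (hA : ∀ x, IsNilpotent (A x - 1)) (g h : G) :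
    ∃ k, A (iteratedCommutator g h k) = 1 := by
  obtain ⟨N, m, hanti, h0, hm, hN⟩ := exists_flag_of_unipotent A hA
  have hstab : ∀ x k, ∀ v ∈ N k, A x v ∈ N k := fun x k v hv => by
    have := (N k).add_mem (hanti (Nat.le_succ k) (hN x k v hv)) hv
    simpa using this
  have key : ∀ k j, ∀ v ∈ N j, (A (iteratedCommutator g h k) - 1) v ∈ N (j + k + 1) := by
    intro k
    induction k with
    | zero => exact fun j v hv => hN g j v hv
    | succ k ih =>
      intro j v hv
      set x := iteratedCommutator g h k
      have e : A ⁅x, h⁆ - 1 =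
          ((A x - 1) * (A h - 1) - (A h - 1) * (A x - 1)) * A (x⁻¹ * h⁻¹) := by
        have h1 : (A x - 1) * (A h - 1) - (A h - 1) * (A x - 1) = A (x * h) - A (h * x) := by
          rw [map_mul, map_mul]; noncomm_ring
        rw [h1, sub_mul, ← map_mul, ← map_mul]
        congr 2
        · rw [commutatorElement_def]; group
        · rw [← map_one A]; congr 1; group
      have hw := hstab (x⁻¹ * h⁻¹) j v hv
      rw [iteratedCommutator, e, Module.End.mul_apply, LinearMap.sub_apply]
      refine (N _).sub_mem ?_ ?_
      · have := ih (j + 1) _ (hN h j _ hw)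
        rwa [show j + 1 + k + 1 = j + (k + 1) + 1 by ring] at this
      · exact hN h _ _ (ih j _ hw)
  refine ⟨m, LinearMap.ext fun v => ?_⟩
  have h1 := hanti (show m ≤ 0 + m + 1 by omega) (key m 0 v (by rw [h0]; trivial))
  rw [hm, Submodule.mem_bot, LinearMap.sub_apply, sub_eq_zero] at h1
  exact h1

namespace ValuationSubring
variable {K : Type*} [Field K] (O : ValuationSubring K)

theorem prime_eq_of_mem_nonunits {p q : ℕ} (hp : p.Prime) (hq : q.Prime)
    (hpO : (p : K) ∈ O.nonunits) (hqO : (q : K) ∈ O.nonunits) : p = q := by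
  by_contra hne
  rw [mem_nonunits_iff] at hpO hqO
  have hz : ∀ z : ℤ, O.valuation (z : K) ≤ 1 := fun z =>
    (O.valuation_le_one_iff _).mpr (intCast_mem O.toSubring z)
  have h := Nat.gcd_eq_gcd_ab p q
  rw [Nat.coprime_iff_gcd_eq_one.mp ((Nat.coprime_primes hp hq).mpr hne)] at h
  have h1 : (1 : K) = p * (p.gcdA q : ℤ) + q * (p.gcdB q : ℤ) := by
    exact_mod_cast congrArg (Int.cast : ℤ → K) h
  have h2 : O.valuation (1 : K) < 1 := by
    rw [h1]
    refine O.valuation.map_add_lt ?_ ?_ <;> rw [map_mul]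
    · exact mul_lt_one_of_lt_of_le hpO (hz _)
    · exact mul_lt_one_of_lt_of_le hqO (hz _)
  simp at h2

theorem mem_nonunits_iff_residue_eq_zero (x : O) :
    (x : K) ∈ O.nonunits ↔ IsLocalRing.residue O x = 0 := by
  rw [coe_mem_nonunits_iff, IsLocalRing.residue_eq_zero_iff, IsLocalRing.mem_maximalIdeal]

theorem prime_mem_nonunits_of_root_of_unity {z : K} (hz : z - 1 ∈ O.nonunits) {q : ℕ}
    (hq : q ∣ orderOf z) (hq1 : q ≠ 1) (hfin : IsOfFinOrder z) : (q : K) ∈ O.nonunits := by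
  have hzO : z ∈ O := by
    have := O.add_mem _ _ (O.nonunits_subset hz) O.one_mem
    simpa using this
  lift z to O using hzO
  set d := orderOf (z : K) / q with hd
  have hdq : d * q = orderOf (z : K) := Nat.div_mul_cancel hq
  have hpos := hfin.orderOf_pos
  have hd0 : 0 < d := Nat.pos_of_ne_zero fun h => by rw [h, zero_mul] at hdq; omega
  have hq0 : 0 < q := Nat.pos_of_ne_zero fun h => by rw [h, mul_zero] at hdq; omega
  have hres : IsLocalRing.residue O z = 1 := by
    have := (O.mem_nonunits_iff_residue_eq_zero (z - 1)).mp (by simpa using hz)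
    rwa [map_sub, map_one, sub_eq_zero] at this
  have hne : z ^ d ≠ 1 := fun h => by
    have h1 : (z : K) ^ d = 1 := by exact_mod_cast congrArg (Subtype.val) h
    have h2 := Nat.le_of_dvd hd0 (orderOf_dvd_of_pow_eq_one h1)
    have : 2 ≤ q := by omega
    nlinarith
  have h1 : (z ^ d) ^ q = 1 := by
    apply Subtype.ext
    push_cast
    rw [← pow_mul, hdq, pow_orderOf_eq_one]
  have hgeom : ∑ i ∈ Finset.range q, (z ^ d) ^ i = 0 := by
    have := geom_sum_mul (z ^ d) q
    rw [h1, sub_self] at this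
    exact (mul_eq_zero.mp this).resolve_right (sub_ne_zero.mpr hne)
  have h2 := congrArg (IsLocalRing.residue O) hgeom
  simp only [map_sum, map_pow, hres, one_pow, Finset.sum_const, Finset.card_range, map_zero,
    nsmul_eq_mul, mul_one] at h2
  have := (O.mem_nonunits_iff_residue_eq_zero (q : O)).mpr (by simpa using h2)
  simpa using this

variable {n : Type*} [Fintype n] [DecidableEq n]

/-- The invertible matrices over `O` congruent to the identity modulo the maximal ideal, as a
subgroup of the general linear group of the fraction field. -/
def congruenceSubgroup (n : Type*) [Fintype n] [DecidableEq n] :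
    Subgroup (Matrix.GeneralLinearGroup n K) :=
  (Matrix.GeneralLinearGroup.map (n := n) (IsLocalRing.residue O)).ker.map
    (Matrix.GeneralLinearGroup.map O.subtype)

theorem sub_one_mem_nonunits_of_hasEigenvalue {X : Matrix.GeneralLinearGroup n K}
    (hX : X ∈ O.congruenceSubgroup n) {z : K}
    (hz : End.HasEigenvalue (Matrix.toLin' (X : Matrix n n K)) z) : z - 1 ∈ O.nonunits := by
  obtain ⟨Y, hY, rfl⟩ := hX
  obtain ⟨v, hv⟩ := hz.exists_hasEigenvector
  have hv1 := hv.apply_eq_smul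
  obtain ⟨j, hj⟩ := Function.ne_iff.mp hv.2
  have : Nonempty n := ⟨j⟩
  obtain ⟨i, hi⟩ := Finite.exists_max fun i => O.valuation (v i)
  have hi0 : O.valuation (v i) ≠ 0 := by
    intro h
    have := hi j
    rw [h, le_zero_iff, map_eq_zero] at this
    exact hj this
  have hent : ∀ k, O.valuation (((Y : Matrix n n O) i k : K) - (1 : Matrix n n K) i k) < 1 := by
    intro k
    rw [← mem_nonunits_iff]
    have h1 : IsLocalRing.residue O ((Y : Matrix n n O) i k - (1 : Matrix n n O) i k) = 0 := by
      have h0 : Matrix.GeneralLinearGroup.map (IsLocalRing.residue O) Y = 1 := hY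
      have h3 : IsLocalRing.residue O ((Y : Matrix n n O) i k) = (1 : Matrix n n _) i k :=
        congrArg (fun Z : Matrix.GeneralLinearGroup n (IsLocalRing.ResidueField O) =>
          (Z : Matrix n n (IsLocalRing.ResidueField O)) i k) h0
      rw [map_sub, sub_eq_zero, h3, Matrix.one_apply, Matrix.one_apply]
      split_ifs <;> simp
    have h2 := (O.mem_nonunits_iff_residue_eq_zero _).mpr h1
    convert h2 using 1
    rw [Matrix.one_apply, Matrix.one_apply]
    split_ifs <;> simp
  have heq : (z - 1) * v i
      = ∑ k, (((Y : Matrix n n O) i k : K) - (1 : Matrix n n K) i k) * v k := by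
    have h1 := congrFun hv1 i
    simp only [sub_mul, Finset.sum_sub_distrib]
    have h2 : ∑ k, (1 : Matrix n n K) i k * v k = v i := by
      have := congrFun (Matrix.one_mulVec v) i
      simpa [Matrix.mulVec, dotProduct] using this
    rw [h2, one_mul]
    congr 1
    rw [Pi.smul_apply, smul_eq_mul] at h1
    rw [← h1]
    simp [Matrix.mulVec, dotProduct]
  rw [mem_nonunits_iff]
  have hlt : O.valuation ((z - 1) * v i) < O.valuation (v i) := by
    rw [heq]
    refine O.valuation.map_sum_lt hi0 fun k _ => ?_
    rw [map_mul]
    calc _ ≤ O.valuation (((Y : Matrix n n O) i k : K) - (1 : Matrix n n K) i k) *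
          O.valuation (v i) := mul_le_mul_right (hi k) _
      _ < 1 * O.valuation (v i) := mul_lt_mul_of_pos_right (hent k) (zero_lt_iff.mpr hi0)
      _ = _ := one_mul _
  rw [map_mul] at hlt
  by_contra hcon
  exact absurd hlt (not_lt.mpr (le_mul_of_one_le_left' (not_lt.mp hcon)))

theorem exists_pow_mem_congruenceSubgroup [Nonempty n] {p : ℕ} (hp : p.Prime)
    (hpO : (p : K) ∈ O.nonunits)
    {X : Matrix.GeneralLinearGroup n K}
    (hX : X ∈ (Matrix.GeneralLinearGroup.map (n := n) O.subtype).range) {N : ℕ} (hN : 0 < N)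
    (hnil : IsNilpotent ((X : Matrix n n K) ^ N - 1)) :
    ∃ M, 0 < M ∧ X ^ M ∈ O.congruenceSubgroup n := by
  obtain ⟨Y, rfl⟩ := hX
  have : Fact p.Prime := ⟨hp⟩
  have hpres : ((p : ℕ) : IsLocalRing.ResidueField O) = 0 := by
    have := (O.mem_nonunits_iff_residue_eq_zero (p : O)).mp (by simpa using hpO)
    simpa using this
  have : CharP (IsLocalRing.ResidueField O) p := (CharP.charP_iff_prime_eq_zero hp).mpr hpres
  have h1 : IsNilpotent ((Y : Matrix n n O) ^ N - 1) := by
    have hinj : Function.Injective (O.subtype.mapMatrix (m := n)) :=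
      Matrix.map_injective Subtype.val_injective
    refine (IsNilpotent.map_iff hinj).mp ?_
    rw [map_sub, map_pow, map_one]
    exact hnil
  have h2 := h1.map (IsLocalRing.residue O).mapMatrix
  rw [map_sub, map_pow, map_one] at h2
  obtain ⟨k, hk⟩ := exists_pow_eq_one_of_isNilpotent_sub_one p h2
  refine ⟨N * p ^ k, by have := hp.pos; positivity, Y ^ (N * p ^ k), ?_, map_pow _ _ _⟩
  rw [SetLike.mem_coe, MonoidHom.mem_ker, map_pow]
  apply Units.ext
  rw [Units.val_pow_eq_pow_val, pow_mul]
  exact hk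

theorem mem_range_map_subtype {X : Matrix.GeneralLinearGroup n K}
    (h1 : ∀ i j, (X : Matrix n n K) i j ∈ O)
    (h2 : ∀ i j, ((X⁻¹ : Matrix.GeneralLinearGroup n K) : Matrix n n K) i j ∈ O) :
    X ∈ (Matrix.GeneralLinearGroup.map (n := n) O.subtype).range := by
  have hinj : Function.Injective (O.subtype.mapMatrix (m := n)) :=
      Matrix.map_injective Subtype.val_injective
  let Y : Matrix n n O := Matrix.of fun i j => ⟨(X : Matrix n n K) i j, h1 i j⟩
  let Z : Matrix n n O :=
    Matrix.of fun i j => ⟨((X⁻¹ : Matrix.GeneralLinearGroup n K) : Matrix n n K) i j, h2 i j⟩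
  have hY : O.subtype.mapMatrix Y = (X : Matrix n n K) := rfl
  have hZ : O.subtype.mapMatrix Z = ((X⁻¹ : Matrix.GeneralLinearGroup n K) : Matrix n n K) := rfl
  refine ⟨⟨Y, Z, hinj ?_, hinj ?_⟩, ?_⟩
  · rw [map_mul, map_one, hY, hZ]; exact X.mul_inv
  · rw [map_mul, map_one, hY, hZ]; exact X.inv_mul
  · ext i j; rfl

end ValuationSubring

section
variable {K : Type*} [Field K] {n : Type*} [Fintype n] [DecidableEq n] {G : Type*} [Group G]

/-- A finitely generated linear group in characteristic zero is integral with respect to some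
valuation of positive residue characteristic. -/
theorem exists_valuationSubring_range_le [CharZero K] [Group.FG G]
    (ρ : G →* Matrix.GeneralLinearGroup n K) (t : Finset K) :
    ∃ (O : ValuationSubring K) (p : ℕ), p.Prime ∧ (∀ x ∈ t, x ∈ O) ∧ (p : K) ∈ O.nonunits ∧
      ρ.range ≤ (Matrix.GeneralLinearGroup.map (n := n) O.subtype).range := by
  classical
  obtain ⟨S, hS⟩ := Group.FG.out (G := G)
  let E : G × n × n → K := fun x => (ρ x.1 : Matrix n n K) x.2.1 x.2.2
  let F : G × n × n → K := fun x => (ρ x.1⁻¹ : Matrix n n K) x.2.1 x.2.2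
  obtain ⟨O, p, hp, hs, hpO⟩ := exists_valuationSubring_residue_char
    (t ∪ ((S ×ˢ Finset.univ).image E ∪ (S ×ˢ Finset.univ).image F))
  refine ⟨O, p, hp, fun x hx => hs x (Finset.mem_union_left _ hx), hpO, ?_⟩
  rw [MonoidHom.range_eq_map, ← hS, MonoidHom.map_closure, Subgroup.closure_le]
  rintro _ ⟨x, hx, rfl⟩
  have hmem : ∀ i j, (x, i, j) ∈ S ×ˢ (Finset.univ : Finset (n × n)) := fun i j =>
    Finset.mem_product.mpr ⟨hx, Finset.mem_univ _⟩
  refine O.mem_range_map_subtype (fun i j => hs _ ?_) (fun i j => hs _ ?_)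
  · exact Finset.mem_union_right _
      (Finset.mem_union_left _ (Finset.mem_image_of_mem E (hmem i j)))
  · rw [← map_inv]
    exact Finset.mem_union_right _
      (Finset.mem_union_right _ (Finset.mem_image_of_mem F (hmem i j)))

/-- The representation on column vectors attached to a matrix representation. -/
noncomputable def Matrix.GeneralLinearGroup.toEndHom (ρ : G →* Matrix.GeneralLinearGroup n K) :
    G →* End K (n → K) :=
  ((Matrix.toLinAlgEquiv' : Matrix n n K ≃ₐ[K] _) : Matrix n n K →* End K (n → K)).comp
    ((Units.coeHom (Matrix n n K)).comp ρ)

theorem Matrix.GeneralLinearGroup.toEndHom_apply (ρ : G →* Matrix.GeneralLinearGroup n K) (x : G) :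
    toEndHom ρ x = Matrix.toLinAlgEquiv' (ρ x : Matrix n n K) := rfl

open Matrix.GeneralLinearGroup (toEndHom toEndHom_apply)

theorem Matrix.GeneralLinearGroup.toEndHom_eq_one_iff {ρ : G →* Matrix.GeneralLinearGroup n K}
    {x : G} : toEndHom ρ x = 1 ↔ ρ x = 1 := by
  rw [toEndHom_apply, EmbeddingLike.map_eq_one_iff, Units.val_eq_one]

theorem Matrix.GeneralLinearGroup.exists_isNilpotent_pow_sub_one [IsAlgClosed K]
    {ρ : G →* Matrix.GeneralLinearGroup n K} {x : G}
    (h : ∀ α, (toEndHom ρ x).HasEigenvalue α → IsOfFinOrder α) :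
    ∃ N, 0 < N ∧ IsNilpotent ((ρ x : Matrix n n K) ^ N - 1) := by
  obtain ⟨N, hN, hnil⟩ := End.exists_isNilpotent_pow_sub_one h
  refine ⟨N, hN, (IsNilpotent.map_iff (Matrix.toLinAlgEquiv' (R := K) (n := n)).injective).mp ?_⟩
  rw [map_sub, map_pow, map_one]
  exact hnil

theorem exists_pow_eq_one_of_isOfFinOrder_eigenvalue [Nonempty n] [IsAlgClosed K]
    {ρ : G →* Matrix.GeneralLinearGroup n K} (p : ℕ) [Fact p.Prime] [CharP K p] {x : G}
    (h : ∀ α, (toEndHom ρ x).HasEigenvalue α → IsOfFinOrder α) :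
    ∃ M, 0 < M ∧ ρ (x ^ M) = 1 := by
  obtain ⟨N, hN, hnil⟩ := Matrix.GeneralLinearGroup.exists_isNilpotent_pow_sub_one h
  obtain ⟨k, hk⟩ := exists_pow_eq_one_of_isNilpotent_sub_one p hnil
  refine ⟨N * p ^ k, Nat.mul_pos hN (pow_pos (Fact.out : p.Prime).pos _), Units.ext ?_⟩
  rw [map_pow, Units.val_pow_eq_pow_val, pow_mul]
  exact hk

theorem exists_iteratedCommutator_pow_eq_one [Nonempty n] [IsAlgClosed K] [CharZero K]
    [Group.FG G] (ρ : G →* Matrix.GeneralLinearGroup n K) (D : Subgroup G)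
    (hD : ∀ x ∈ D, ∀ α, (toEndHom ρ x).HasEigenvalue α → IsOfFinOrder α)
    {g h : G} (hg : g ∈ D) (hh : h ∈ D) :
    ∃ M, 0 < M ∧ ∃ k, ρ (iteratedCommutator (g ^ M) (h ^ M) k) = 1 := by
  obtain ⟨O₁, p₁, hp₁, -, hpO₁, hr₁⟩ := exists_valuationSubring_range_le ρ ∅
  obtain ⟨O₂, p₂, hp₂, ht, hpO₂, hr₂⟩ := exists_valuationSubring_range_le ρ {(p₁ : K)⁻¹}
  have hp₁₂ : (p₁ : K) ∉ O₂.nonunits := fun hmem => by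
    have h1 := (O₂.valuation_le_one_iff _).mpr (ht _ (Finset.mem_singleton_self _))
    rw [ValuationSubring.mem_nonunits_iff] at hmem
    have h2 := mul_lt_one_of_lt_of_le hmem h1
    rw [← map_mul, mul_inv_cancel₀ (by exact_mod_cast hp₁.ne_zero), map_one] at h2
    exact lt_irrefl _ h2
  have hex : ∀ x ∈ D, ∃ M, 0 < M ∧
      ρ x ^ M ∈ O₁.congruenceSubgroup n ⊓ O₂.congruenceSubgroup n := by
    intro x hx
    obtain ⟨N, hN, hnil⟩ := Matrix.GeneralLinearGroup.exists_isNilpotent_pow_sub_one (hD x hx)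
    obtain ⟨M₁, hM₁, h1⟩ := O₁.exists_pow_mem_congruenceSubgroup hp₁ hpO₁ (hr₁ ⟨x, rfl⟩) hN hnil
    obtain ⟨M₂, hM₂, h2⟩ := O₂.exists_pow_mem_congruenceSubgroup hp₂ hpO₂ (hr₂ ⟨x, rfl⟩) hN hnil
    refine ⟨M₁ * M₂, Nat.mul_pos hM₁ hM₂, ?_, ?_⟩
    · rw [pow_mul]; exact pow_mem h1 _
    · rw [mul_comm, pow_mul]; exact pow_mem h2 _
  obtain ⟨M, hM, hgM⟩ := hex g hg
  obtain ⟨M', hM', hhM⟩ := hex h hh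
  let P : Subgroup G := D ⊓ (O₁.congruenceSubgroup n ⊓ O₂.congruenceSubgroup n).comap ρ
  have huni : ∀ x : P, IsNilpotent ((toEndHom ρ).comp P.subtype x - 1) := by
    rintro ⟨x, hxD, hx₁, hx₂⟩
    have := End.isNilpotent_pow_sub_one_of_eigenvalues (f := toEndHom ρ x) (N := 1) ?_
    · rwa [pow_one] at this
    intro α hα
    have hfin := hD x hxD α hα
    rw [pow_one]
    by_contra hne
    have hord : orderOf α ≠ 1 := fun h => hne (orderOf_eq_one_iff.mp h)
    have hq := Nat.minFac_prime hord
    have hn₁ := O₁.prime_mem_nonunits_of_root_of_unity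
      (O₁.sub_one_mem_nonunits_of_hasEigenvalue hx₁ hα) (Nat.minFac_dvd _) hq.ne_one hfin
    have hn₂ := O₂.prime_mem_nonunits_of_root_of_unity
      (O₂.sub_one_mem_nonunits_of_hasEigenvalue hx₂ hα) (Nat.minFac_dvd _) hq.ne_one hfin
    rw [← O₁.prime_eq_of_mem_nonunits hp₁ hq hpO₁ hn₁] at hn₂
    exact hp₁₂ hn₂
  have hgP : g ^ (M * M') ∈ P := Subgroup.mem_inf.mpr ⟨pow_mem hg _, by
    rw [Subgroup.mem_comap, map_pow, pow_mul]; exact pow_mem hgM _⟩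
  have hhP : h ^ (M * M') ∈ P := Subgroup.mem_inf.mpr ⟨pow_mem hh _, by
    rw [Subgroup.mem_comap, map_pow, mul_comm M, pow_mul]; exact pow_mem hhM _⟩
  obtain ⟨k, hk⟩ := exists_iteratedCommutator_eq_one_of_unipotent
    ((toEndHom ρ).comp P.subtype) huni ⟨_, hgP⟩ ⟨_, hhP⟩
  refine ⟨M * M', Nat.mul_pos hM hM', k, Matrix.GeneralLinearGroup.toEndHom_eq_one_iff.mp ?_⟩
  rw [MonoidHom.comp_apply, map_iteratedCommutator] at hk
  exact hk

end

section
open Matrix.GeneralLinearGroup (toEndHom toEndHom_apply)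
variable {K : Type*} [Field K] {n : Type*} [Fintype n] [DecidableEq n]
  {G H : Type*} [Group G] [Group H]

theorem isOfFinOrder_eigenvalue_of_comp_conj [IsAlgClosed K]
    (F : H →* Matrix.GeneralLinearGroup n K) (c : G →* H) {g : G} (hg : g ∈ commutator G)
    {ψ t : H} (hψ : ∀ x, Commute ψ (c x)) (ht : t * ψ * t⁻¹ = c g * ψ) {α : K}
    (hα : (toEndHom (F.comp c) g).HasEigenvalue α) : IsOfFinOrder α := by
  let T : H →* (End K (n → K))ˣ := (toEndHom F).toHomUnits
  refine isOfFinOrder_eigenvalue_of_conj (toEndHom (F.comp c)) (b := T ψ) (t := T t)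
    (fun x => (hψ x).map (toEndHom F)) hg ?_ hα
  rw [← map_inv, ← map_mul, ← map_mul, ht]
  exact map_mul (toEndHom F) _ _

/-- A linear representation over any field cannot separate powers and iterated commutators of
elements `g` for which some `ψ` centralizing the image of `c` is conjugate to `c g * ψ`. -/
theorem exists_map_eq_one_of_conj [Nonempty n] [Group.FG G]
    (F : H →* Matrix.GeneralLinearGroup n K) (c : G →* H)
    (hc : ∀ g ∈ commutator G, ∃ ψ t : H, (∀ x, Commute ψ (c x)) ∧ t * ψ * t⁻¹ = c g * ψ)
    {g h : G} (hg : g ∈ commutator G) (hh : h ∈ commutator G) :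
    ∃ M, 0 < M ∧ (F (c (h ^ M)) = 1 ∨
      ∃ k, F (c (iteratedCommutator (g ^ M) (h ^ M) k)) = 1) := by
  let L := AlgebraicClosure K
  let ι : Matrix.GeneralLinearGroup n K →* Matrix.GeneralLinearGroup n L :=
    Matrix.GeneralLinearGroup.map (algebraMap K L)
  have hι : ∀ X, ι X = 1 → X = 1 := by
    intro X hX
    apply Units.ext
    refine Matrix.map_injective (algebraMap K L).injective ?_
    have h1 : (X : Matrix n n K).map (algebraMap K L) = 1 := congrArg Units.val hX
    exact h1.trans (map_one (algebraMap K L).mapMatrix).symm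
  have hfin : ∀ x ∈ commutator G, ∀ α, (toEndHom ((ι.comp F).comp c) x).HasEigenvalue α →
      IsOfFinOrder α := fun x hx α hα => by
    obtain ⟨ψ, t, hψ, ht⟩ := hc x hx
    exact isOfFinOrder_eigenvalue_of_comp_conj _ c hx hψ ht hα
  obtain ⟨p, hp⟩ := CharP.exists L
  rcases CharP.char_is_prime_or_zero L p with hprime | rfl
  · have : Fact p.Prime := ⟨hprime⟩
    obtain ⟨M, hM, h1⟩ := exists_pow_eq_one_of_isOfFinOrder_eigenvalue p (hfin h hh)
    exact ⟨M, hM, Or.inl (hι _ h1)⟩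
  · have : CharZero L := CharP.charP_to_charZero L
    obtain ⟨M, hM, k, h1⟩ := exists_iteratedCommutator_pow_eq_one _ _ hfin hg hh
    exact ⟨M, hM, Or.inr ⟨k, hι _ h1⟩⟩
end

section
variable {K : Type*} [Field K]

theorem Matrix.GeneralLinearGroup.commutatorElement_lowerTriangular
    {X Y : Matrix.GeneralLinearGroup (Fin 2) K}
    {s a c e : K} (hX : (X : Matrix (Fin 2) (Fin 2) K) = !![1, 0; s, 1])
    (hY : (Y : Matrix (Fin 2) (Fin 2) K) = !![a, 0; c, e]) (ha : a ≠ 0) :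
    ((⁅X, Y⁆ : Matrix.GeneralLinearGroup (Fin 2) K) : Matrix (Fin 2) (Fin 2) K) =
      !![1, 0; s * (1 - e / a), 1] := by
  refine (Units.mul_left_inj (Y * X)).mp ?_
  rw [← Units.val_mul, show ⁅X, Y⁆ * (Y * X) = X * Y by rw [commutatorElement_def]; group]
  rw [Units.val_mul, Units.val_mul, hX, hY]
  ext i j
  fin_cases i <;> fin_cases j <;> simp [Matrix.mul_apply, Fin.sum_univ_two]
  field_simp
  ring

theorem Matrix.GeneralLinearGroup.iteratedCommutator_lowerTriangular
    {X Y : Matrix.GeneralLinearGroup (Fin 2) K}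
    {s a c e : K} (hX : (X : Matrix (Fin 2) (Fin 2) K) = !![1, 0; s, 1])
    (hY : (Y : Matrix (Fin 2) (Fin 2) K) = !![a, 0; c, e]) (ha : a ≠ 0) (k : ℕ) :
    ((iteratedCommutator X Y k : Matrix.GeneralLinearGroup (Fin 2) K) :
      Matrix (Fin 2) (Fin 2) K) = !![1, 0; s * (1 - e / a) ^ k, 1] := by
  induction k with
  | zero => simpa [iteratedCommutator] using hX
  | succ k ih =>
    rw [iteratedCommutator, commutatorElement_lowerTriangular ih hY ha, pow_succ, mul_assoc]

theorem Matrix.exists_pow_lowerTriangular (a c e : K) (M : ℕ) :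
    ∃ c' : K, (!![a, 0; c, e] : Matrix (Fin 2) (Fin 2) K) ^ M = !![a ^ M, 0; c', e ^ M] := by
  induction M with
  | zero => exact ⟨0, by rw [pow_zero, pow_zero, pow_zero, Matrix.one_fin_two]⟩
  | succ M ih =>
    obtain ⟨c', hc'⟩ := ih
    exact ⟨c' * a + e ^ M * c, by rw [pow_succ, hc', Matrix.mul_fin_two]; simp [pow_succ]⟩

theorem Matrix.pow_lowerUnipotent (s : K) (M : ℕ) :
    (!![1, 0; s, 1] : Matrix (Fin 2) (Fin 2) K) ^ M = !![1, 0; M * s, 1] := by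
  induction M with
  | zero => simp [Matrix.one_fin_two]
  | succ M ih => rw [pow_succ, ih, Matrix.mul_fin_two]; simp [add_mul]
end

namespace RaagPaper

section
variable {V : Type} {Γ : SimpleGraph V}

theorem commute_gen {u v : V} (h : Γ.Adj u v) : Commute (gen Γ u) (gen Γ v) := by
  have h1 : PresentedGroup.mk (Rels Γ) (FreeGroup.of u * FreeGroup.of v * (FreeGroup.of u)⁻¹ *
      (FreeGroup.of v)⁻¹) = 1 := PresentedGroup.one_of_mem ⟨u, v, h, rfl⟩
  simp only [map_mul, map_inv] at h1
  exact mul_inv_eq_iff_eq_mul.mp (mul_inv_eq_one.mp h1)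

/-- The universal property of `Raag Γ`. -/
theorem exists_hom_gen {H : Type*} [Group H] (φ : V → H)
    (hφ : ∀ u v, Γ.Adj u v → Commute (φ u) (φ v)) :
    ∃ F : Raag Γ →* H, ∀ v, F (gen Γ v) = φ v := by
  have h : ∀ r ∈ Rels Γ, FreeGroup.lift φ r = 1 := by
    rintro _ ⟨u, v, huv, rfl⟩
    simp only [map_mul, map_inv, FreeGroup.lift_apply_of]
    rw [(hφ u v huv).eq]
    group
  exact ⟨PresentedGroup.toGroup h, fun v => PresentedGroup.toGroup.of h⟩

theorem hom_ext {H : Type*} [Group H] {F F' : Raag Γ →* H}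
    (h : ∀ v, F (gen Γ v) = F' (gen Γ v)) : F = F' :=
  PresentedGroup.ext h

section
variable {v : V} {S : Set V}

/-- Elements supported on vertices whose stars contain the link of `v` can be used as
transvection multipliers for `v`. -/
theorem exists_endo_mul (hv : v ∉ S) (hS : ∀ w ∈ S, ∀ u, Γ.Adj v u → Γ.Adj u w) {g : Raag Γ}
    (hg : g ∈ Subgroup.closure (gen Γ '' S)) :
    ∃ F : Raag Γ →* Raag Γ, F (gen Γ v) = gen Γ v * g ∧ (∀ u, u ≠ v → F (gen Γ u) = gen Γ u) ∧
      ∀ x ∈ Subgroup.closure (gen Γ '' S), F x = x := by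
  classical
  have hcomm : ∀ u, Γ.Adj v u → Commute (gen Γ u) g := by
    intro u hu
    refine Subgroup.mem_centralizer_singleton_iff.mp
      ((Subgroup.closure_le (Subgroup.centralizer {gen Γ u})).mpr ?_ hg) |>.symm
    rintro _ ⟨w, hw, rfl⟩
    exact Subgroup.mem_centralizer_singleton_iff.mpr (commute_gen (hS w hw u hu)).eq.symm
  obtain ⟨F, hF⟩ := exists_hom_gen (Γ := Γ) (Function.update (gen Γ) v (gen Γ v * g)) (by
    intro a b hab
    by_cases ha : a = v
    · subst ha
      rw [Function.update_self, Function.update_of_ne hab.ne']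
      exact (commute_gen hab).mul_left (hcomm b hab).symm
    · rw [Function.update_of_ne ha]
      by_cases hb : b = v
      · subst hb
        rw [Function.update_self]
        exact (commute_gen hab).mul_right (hcomm a hab.symm)
      · rw [Function.update_of_ne hb]
        exact commute_gen hab)
  have hne : ∀ u, u ≠ v → F (gen Γ u) = gen Γ u := fun u hu => by
    rw [hF, Function.update_of_ne hu]
  refine ⟨F, by rw [hF, Function.update_self], hne, fun x hx => ?_⟩
  refine MonoidHom.eqOn_closure (g := MonoidHom.id _) ?_ hx
  rintro _ ⟨w, hw, rfl⟩
  exact hne w fun h => hv (h ▸ hw)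

theorem exists_mulAut_mul (hv : v ∉ S) (hS : ∀ w ∈ S, ∀ u, Γ.Adj v u → Γ.Adj u w) {g : Raag Γ}
    (hg : g ∈ Subgroup.closure (gen Γ '' S)) :
    ∃ ψ : MulAut (Raag Γ), ψ (gen Γ v) = gen Γ v * g ∧
      ∀ x ∈ Subgroup.closure (gen Γ '' S), ψ x = x := by
  obtain ⟨F, hFv, hFu, hFx⟩ := exists_endo_mul hv hS hg
  obtain ⟨F', hFv', hFu', hFx'⟩ := exists_endo_mul hv hS (inv_mem hg)
  have h1 : F'.comp F = MonoidHom.id _ := hom_ext fun u => by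
    by_cases hu : u = v
    · subst hu
      simp [hFv, hFv', hFx' g hg]
    · simp [hFu u hu, hFu' u hu]
  have h2 : F.comp F' = MonoidHom.id _ := hom_ext fun u => by
    by_cases hu : u = v
    · subst hu
      simp [hFv, hFv', hFx g hg]
    · simp [hFu u hu, hFu' u hu]
  exact ⟨F.toMulEquiv F' h1 h2, hFv, hFx⟩

end

theorem commute_conj_of_apply_eq {A : Type*} [Group A] {ψ : MulAut A} {x : A} (h : ψ x = x) :
    Commute ψ (MulAut.conj x) := by
  ext w
  simp [h]

theorem conj_inv_mul_mul_conj {A : Type*} [Group A] {ψ : MulAut A} {v g : A} (h : ψ v = v * g) :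
    (MulAut.conj v)⁻¹ * ψ * ((MulAut.conj v)⁻¹)⁻¹ = MulAut.conj g * ψ := by
  ext w
  simp [h, mul_assoc]

/-- A representation of `Raag Γ` detecting that two non-adjacent generators generate a
non-virtually-nilpotent group. -/
theorem exists_hom_GL_two {v₁ v₂ : V} (hne : v₁ ≠ v₂) (hadj : ¬ Γ.Adj v₁ v₂) :
    ∃ σ : Raag Γ →* Matrix.GeneralLinearGroup (Fin 2) ℚ,
      (σ (gen Γ v₁) : Matrix (Fin 2) (Fin 2) ℚ) = !![2, 0; 0, 1] ∧
      (σ (gen Γ v₂) : Matrix (Fin 2) (Fin 2) ℚ) = !![0, 1; 1, 1] := by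
  classical
  let d : Matrix.GeneralLinearGroup (Fin 2) ℚ :=
    Matrix.GeneralLinearGroup.mkOfDetNeZero !![2, 0; 0, 1] (by simp)
  let y : Matrix.GeneralLinearGroup (Fin 2) ℚ :=
    Matrix.GeneralLinearGroup.mkOfDetNeZero !![0, 1; 1, 1] (by simp)
  obtain ⟨σ, hσ⟩ := exists_hom_gen (Γ := Γ) (fun v => if v = v₁ then d else if v = v₂ then y else 1)
    (by
      intro u v huv
      by_cases hu : u = v₁ <;> by_cases hv : v = v₁ <;> by_cases hu' : u = v₂ <;>
        by_cases hv' : v = v₂ <;> simp_all [Γ.adj_comm])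
  refine ⟨σ, ?_, ?_⟩
  · rw [hσ, if_pos rfl]; rfl
  · rw [hσ, if_neg hne.symm, if_pos rfl]; rfl

/-- The explicit elements of the commutator subgroup of a two-generator group, and their images in
`GL₂(ℚ)`, used to contradict linearity. -/
theorem exists_mem_commutator_map_lowerTriangular {G : Type*} [Group G]
    (σ : G →* Matrix.GeneralLinearGroup (Fin 2) ℚ) {x y : G}
    (hx : (σ x : Matrix (Fin 2) (Fin 2) ℚ) = !![2, 0; 0, 1])
    (hy : (σ y : Matrix (Fin 2) (Fin 2) ℚ) = !![0, 1; 1, 1]) :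
    ∃ g ∈ commutator G, ∃ h ∈ commutator G,
      (σ g : Matrix (Fin 2) (Fin 2) ℚ) = !![1, 0; 1 / 8, 1] ∧
      (σ h : Matrix (Fin 2) (Fin 2) ℚ) = !![2, 0; 1 / 2, 1 / 2] := by
  have hmem : ∀ a b : G, ⁅a, b⁆ ∈ commutator G := fun a b =>
    Subgroup.commutator_mem_commutator (Subgroup.mem_top a) (Subgroup.mem_top b)
  have hz : (σ ⁅x, y⁆ : Matrix (Fin 2) (Fin 2) ℚ) = !![2, 0; 1 / 2, 1 / 2] := by
    refine (Units.mul_left_inj (σ (y * x))).mp ?_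
    rw [← Units.val_mul, ← map_mul,
      show ⁅x, y⁆ * (y * x) = x * y by rw [commutatorElement_def]; group]
    rw [map_mul, map_mul, Units.val_mul, Units.val_mul, hx, hy]
    norm_num [Matrix.mul_fin_two]
  refine ⟨⁅⁅x, y⁆, x⁆, hmem _ _, ⁅x, y⁆, hmem _ _, ?_, hz⟩
  refine (Units.mul_left_inj (σ (x * ⁅x, y⁆))).mp ?_
  rw [← Units.val_mul, ← map_mul,
    show ⁅⁅x, y⁆, x⁆ * (x * ⁅x, y⁆) = ⁅x, y⁆ * x by rw [commutatorElement_def ⁅x, y⁆ x]; group]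
  rw [map_mul, map_mul, Units.val_mul, Units.val_mul, hx, hz]
  norm_num [Matrix.mul_fin_two]

theorem adj_of_le {v w u : V} (h : Le Γ v w) (hvw : ¬ Γ.Adj w v) (hu : Γ.Adj v u) :
    Γ.Adj u w := by
  rcases h hu with rfl | h
  · exact absurd hu.symm hvw
  · exact h.symm

end

variable {V : Type} [Fintype V] [DecidableEq V]

theorem Aut_not_linear_of_NL (Γ : SimpleGraph V) (hNL : NL Γ) :
    ∀ (K : Type) [Field K] (n : ℕ), 1 ≤ n →
      ∀ f : MulAut (Raag Γ) →* Matrix.GeneralLinearGroup (Fin n) K,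
        ¬ Function.Injective f := by
  intro K _ n hn f hf
  obtain ⟨v₁, v₂, v₃, h12, h13, h23, ha12, ha13, ha23, hle1, hle2⟩ := hNL
  have : Nonempty (Fin n) := ⟨⟨0, hn⟩⟩
  let S : Set V := {v₁, v₂}
  let G : Subgroup (Raag Γ) := Subgroup.closure (gen Γ '' S)
  have : Group.FG G := (Group.fg_iff_subgroup_fg G).mpr
    ((Subgroup.fg_iff G).mpr ⟨_, rfl, (Set.toFinite S).image _⟩)
  have hv₃ : v₃ ∉ S := by
    rintro (h | h)
    exacts [h13 h.symm, h23 h.symm]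
  have hS : ∀ w ∈ S, ∀ u, Γ.Adj v₃ u → Γ.Adj u w := by
    rintro w (rfl | rfl) u hu
    exacts [adj_of_le hle1 ha13 hu, adj_of_le hle2 ha23 hu]
  let c : G →* MulAut (Raag Γ) := MulAut.conj.comp G.subtype
  have hc : ∀ g ∈ commutator G, ∃ ψ t : MulAut (Raag Γ),
      (∀ x, Commute ψ (c x)) ∧ t * ψ * t⁻¹ = c g * ψ := by
    intro g _
    obtain ⟨ψ, hψ, hψG⟩ := exists_mulAut_mul hv₃ hS g.2
    exact ⟨ψ, (MulAut.conj (gen Γ v₃))⁻¹, fun x => commute_conj_of_apply_eq (hψG x x.2),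
      conj_inv_mul_mul_conj hψ⟩
  let x₁ : G := ⟨gen Γ v₁, Subgroup.subset_closure ⟨v₁, Or.inl rfl, rfl⟩⟩
  let x₂ : G := ⟨gen Γ v₂, Subgroup.subset_closure ⟨v₂, Or.inr rfl, rfl⟩⟩
  obtain ⟨σ, hσ₁, hσ₂⟩ := exists_hom_GL_two h12 ha12
  have hcentral : ∀ x : G, f (c x) = 1 → ∀ y : G,
      (σ x * σ y : Matrix (Fin 2) (Fin 2) ℚ) = σ y * σ x := by
    intro x hx y
    have h1 : c x = 1 := hf (hx.trans (map_one f).symm)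
    have h2 : (x : Raag Γ) * y * (x : Raag Γ)⁻¹ = y :=
      congrArg (fun α : MulAut (Raag Γ) => α y) h1
    rw [← Units.val_mul, ← Units.val_mul, ← map_mul, ← map_mul, mul_inv_eq_iff_eq_mul.mp h2]
  obtain ⟨g, hg, h, hh, hσg, hσh⟩ := exists_mem_commutator_map_lowerTriangular
    (σ.comp G.subtype) (x := x₁) (y := x₂) hσ₁ hσ₂
  obtain ⟨M, hM, hfM⟩ := exists_map_eq_one_of_conj f c hc hg hh
  obtain ⟨c', hc'⟩ := Matrix.exists_pow_lowerTriangular (2 : ℚ) (1 / 2) (1 / 2) M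
  have hhM : ((σ.comp G.subtype (h ^ M) : Matrix.GeneralLinearGroup (Fin 2) ℚ) :
      Matrix (Fin 2) (Fin 2) ℚ) = !![2 ^ M, 0; c', (1 / 2) ^ M] := by
    rw [map_pow, Units.val_pow_eq_pow_val, hσh, hc']
  have hgM : ((σ.comp G.subtype (g ^ M) : Matrix.GeneralLinearGroup (Fin 2) ℚ) :
      Matrix (Fin 2) (Fin 2) ℚ) = !![1, 0; (M : ℚ) * (1 / 8), 1] := by
    rw [map_pow, Units.val_pow_eq_pow_val, hσg, Matrix.pow_lowerUnipotent]
  have hlt : (1 / 2 : ℚ) ^ M < 2 ^ M := by gcongr; norm_num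
  rcases hfM with hfM | ⟨k, hfM⟩
  · have h1 : (!![2 ^ M, 0; c', (1 / 2) ^ M] * !![0, 1; 1, 1] : Matrix (Fin 2) (Fin 2) ℚ) =
        !![0, 1; 1, 1] * !![2 ^ M, 0; c', (1 / 2) ^ M] := by
      rw [← hhM, ← hσ₂]
      exact hcentral _ hfM x₂
    have h2 := congrFun (congrFun h1 0) 1
    have h3 : (2 : ℚ) ^ M = (1 / 2) ^ M := by simpa using h2
    exact hlt.ne' h3
  · have h3 := Matrix.GeneralLinearGroup.iteratedCommutator_lowerTriangular hgM hhM
      (by positivity) k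
    rw [← map_iteratedCommutator] at h3
    set s : ℚ := M * (1 / 8) * (1 - (1 / 2) ^ M / 2 ^ M) ^ k
    have h1 : (!![1, 0; s, 1] * !![2, 0; 0, 1] : Matrix (Fin 2) (Fin 2) ℚ) =
        !![2, 0; 0, 1] * !![1, 0; s, 1] := by
      rw [← h3, ← hσ₁]
      exact hcentral _ hfM x₁
    have h2 := congrFun (congrFun h1 1) 0
    have hs0 : 0 < s := by
      have h4 : (1 / 2 : ℚ) ^ M / 2 ^ M < 1 := (div_lt_one (by positivity)).mpr hlt
      have h5 : (0 : ℚ) < 1 - (1 / 2) ^ M / 2 ^ M := sub_pos.mpr h4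
      have h6 : (0 : ℚ) < M := by exact_mod_cast hM
      positivity
    have h7 : s * 2 = s := by simpa using h2
    linarith

end RaagPaper
end
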